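/- arXiv:1705.09703 — 3 statements merged into one kernel-verified Lean document; each statement's English description precedes it below -/
import Mathlib

section
/- Let G be a finite abelian group, let A, P ⊆ G be subsets, and let k ≥ 1 be an integer. Then (Σ_{x∈P} r_{A−A}(x)^k)² ≤ |A|^k · Σ_{x∈G} r_{A−A}(x)^k · r_{P−P}(x). Consequently, (Σ_{x∈P} r_{A−A}(x)^k)⁴ ≤ |A|^{2k} · E⁺_{2k}(A) · E⁺(P). -/
open Finset Pointwise

/-- `r_{A−A}(x) = #{(a,a') ∈ A×A : a−a' = x}`. -/
def rsub {G : Type*} [AddCommGroup G] [DecidableEq G] (A : Finset G) (x : G) : ℕ :=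
  ((A ×ˢ A).filter fun ab => ab.1 - ab.2 = x).card

/-- `E⁺_k(A) = Σ_{x∈G} r_{A−A}(x)^k`. -/
def Ek {G : Type*} [AddCommGroup G] [DecidableEq G] [Fintype G] (k : ℕ) (A : Finset G) : ℕ :=
  ∑ x : G, (rsub A x) ^ k

/-- The additive energy `E⁺(P) = #{(p1,p2,p3,p4) ∈ P⁴ : p1+p2 = p3+p4}`. -/
def Eplus {G : Type*} [AddCommGroup G] [DecidableEq G] (P : Finset G) : ℕ :=
  ((P ×ˢ P ×ˢ P ×ˢ P).filter fun q => q.1 + q.2.1 = q.2.2.1 + q.2.2.2).card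

/-- Sums over pairs in `P` of a function of the difference, grouped by the difference. -/
lemma sum_sum_sub_eq {G : Type*} [AddCommGroup G] [DecidableEq G] [Fintype G]
    (P : Finset G) (g : G → ℕ) :
    ∑ x ∈ P, ∑ y ∈ P, g (x - y) = ∑ z : G, g z * rsub P z := by
  rw [← sum_product' P P fun x y => g (x - y), ← sum_fiberwise _ fun p : G × G => p.1 - p.2]
  refine sum_congr rfl fun z _ => ?_
  rw [sum_congr rfl fun p hp => congrArg g (mem_filter.1 hp).2, sum_const, smul_eq_mul, mul_comm,
    rsub]

/-- `r_{A-A}(x)` counts the `a ∈ A` with `a - x ∈ A`. -/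
lemma rsub_eq_sum_ite {G : Type*} [AddCommGroup G] [DecidableEq G] (A : Finset G) (x : G) :
    rsub A x = ∑ a ∈ A, if a - x ∈ A then 1 else 0 := by
  rw [rsub, card_filter, sum_product]
  refine sum_congr rfl fun a _ => ?_
  have h (b : G) : a - b = x ↔ a - x = b := by rw [sub_eq_iff_eq_add, sub_eq_iff_eq_add']
  simp only [h, sum_ite_eq]

/-- The `a ∈ A` with both `a - x` and `a - y` in `A` number at most `r_{A-A}(x - y)`. -/
lemma sum_ite_mul_ite_le_rsub {G : Type*} [AddCommGroup G] [DecidableEq G]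
    (A : Finset G) (x y : G) :
    ∑ a ∈ A, (if a - x ∈ A then 1 else 0) * (if a - y ∈ A then 1 else 0) ≤ rsub A (x - y) := by
  simp only [← ite_and, mul_ite, mul_one, mul_zero, ← card_filter, rsub]
  refine card_le_card_of_injOn (fun a => (a - y, a - x)) ?_ ?_
  · intro a ha
    simp only [coe_filter, Set.mem_ofPred_eq, mem_product] at ha ⊢
    exact ⟨⟨ha.2.1, ha.2.2⟩, by abel⟩
  · intro a _ b _ h
    simpa using congrArg Prod.fst h

/-- The additive energy is the second moment of `r_{P-P}`. -/
lemma Eplus_eq_sum_sq {G : Type*} [AddCommGroup G] [DecidableEq G] [Fintype G] (P : Finset G) :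
    Eplus P = ∑ z : G, rsub P z ^ 2 := by
  simp only [sq]
  rw [← sum_sum_sub_eq]
  simp only [Eplus, rsub, card_filter, sum_product]
  refine sum_congr rfl fun x _ => ?_
  rw [sum_comm]
  refine sum_congr rfl fun y _ => ?_
  rw [sum_comm]
  refine sum_congr rfl fun a _ => sum_congr rfl fun b _ => ?_
  congr 1
  rw [sub_eq_sub_iff_add_eq_add, eq_iff_iff, eq_comm, add_comm y a]

lemma sq_sum_rsub_pow_le {G : Type*} [AddCommGroup G] [DecidableEq G] [Fintype G]
    (A P : Finset G) (k : ℕ) :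
    (∑ x ∈ P, rsub A x ^ k) ^ 2 ≤ A.card ^ k * ∑ x : G, rsub A x ^ k * rsub P x := by
  have sum_pow_eq (f : G → ℕ) : (∑ a ∈ A, f a) ^ k =
      ∑ c ∈ Fintype.piFinset fun _ : Fin k => A, ∏ i, f (c i) := by
    rw [← prod_univ_sum (fun _ : Fin k => A) fun _ a => f a]
    simp
  have key : ∑ x ∈ P, rsub A x ^ k = ∑ c ∈ Fintype.piFinset fun _ : Fin k => A,
      ∑ x ∈ P, ∏ i, if c i - x ∈ A then 1 else 0 := by
    rw [sum_comm]
    exact sum_congr rfl fun x _ => by rw [rsub_eq_sum_ite, sum_pow_eq]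
  rw [key]
  refine sq_sum_le_card_mul_sum_sq.trans ?_
  rw [Fintype.card_piFinset_const, ← sum_sum_sub_eq P fun z => rsub A z ^ k]
  refine Nat.mul_le_mul_left _ ?_
  simp only [sq, sum_mul_sum, ← prod_mul_distrib]
  rw [sum_comm]
  refine sum_le_sum fun x _ => ?_
  rw [sum_comm]
  refine sum_le_sum fun y _ => ?_
  rw [← sum_pow_eq fun a => (if a - x ∈ A then 1 else 0) * (if a - y ∈ A then 1 else 0)]
  exact Nat.pow_le_pow_left (sum_ite_mul_ite_le_rsub A x y) k

/-- for a finite abelian group `G`, subsets `A, P ⊆ G` and `k ≥ 1`,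
`(Σ_{x∈P} r_{A−A}(x)^k)² ≤ |A|^k Σ_{x∈G} r_{A−A}(x)^k r_{P−P}(x)`, and consequently
`(Σ_{x∈P} r_{A−A}(x)^k)⁴ ≤ |A|^{2k} E⁺_{2k}(A) E⁺(P)`. -/
theorem stmt_1 {G : Type*} [AddCommGroup G] [DecidableEq G] [Fintype G]
    (A P : Finset G) (k : ℕ) (hk : 1 ≤ k) :
    (∑ x ∈ P, (rsub A x) ^ k) ^ 2 ≤ A.card ^ k * ∑ x : G, (rsub A x) ^ k * rsub P x ∧
    (∑ x ∈ P, (rsub A x) ^ k) ^ 4 ≤ A.card ^ (2 * k) * Ek (2 * k) A * Eplus P := by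
  refine ⟨sq_sum_rsub_pow_le A P k, ?_⟩
  calc (∑ x ∈ P, (rsub A x) ^ k) ^ 4 = ((∑ x ∈ P, (rsub A x) ^ k) ^ 2) ^ 2 := by ring
    _ ≤ (A.card ^ k * ∑ x : G, (rsub A x) ^ k * rsub P x) ^ 2 :=
      Nat.pow_le_pow_left (sq_sum_rsub_pow_le A P k) 2
    _ = A.card ^ (2 * k) * (∑ x : G, (rsub A x) ^ k * rsub P x) ^ 2 := by ring
    _ ≤ A.card ^ (2 * k) * ((∑ x : G, ((rsub A x) ^ k) ^ 2) * ∑ x : G, (rsub P x) ^ 2) :=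
      Nat.mul_le_mul_left _ (sum_mul_sq_le_sq_mul_sq _ _ _)
    _ = A.card ^ (2 * k) * Ek (2 * k) A * Eplus P := by
      rw [Eplus_eq_sum_sq, Ek, mul_assoc]
      simp only [← pow_mul, mul_comm k 2]
end

section
/- For every δ > 0 there exist constants C = C(δ) > 0 and c = c(δ) > 0 such that the following holds. Let p be a prime, Γ ⊆ F_p^* a multiplicative subgroup with |Γ| ≥ p^δ, and Q ⊆ F_p^* a set with QΓ = Q and |Q|²|Γ| ≤ p². Then for every set A ⊆ F_p one has E⁺(A,Q) ≤ C · ( |Q||A|² · p^{−δ/2^{7+2/δ}} · log|Q| + |A||Q| ), and consequently |A+Q| ≥ c · |Q| · min{ |A|, p^{δ/2^{7+2/δ}} / log|Q| }. -/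
open Finset Pointwise

/-- `Γ` is a multiplicative subgroup of `F_p^*` (as a finite set of field elements). -/
def IsMulSubgroup {F : Type*} [Field F] [DecidableEq F] (Γ : Finset F) : Prop :=
  (0 : F) ∉ Γ ∧ (1 : F) ∈ Γ ∧ (∀ x ∈ Γ, ∀ y ∈ Γ, x * y ∈ Γ) ∧ (∀ x ∈ Γ, x⁻¹ ∈ Γ)

/-- The common additive energy `E⁺(A,Q) = #{(a1,a2,q1,q2) : a1+q1 = a2+q2}`. -/
def EplusTwo {G : Type*} [AddCommGroup G] [DecidableEq G] (A Q : Finset G) : ℕ :=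
  ((A ×ˢ A ×ˢ Q ×ˢ Q).filter fun t => t.1 + t.2.2.1 = t.2.1 + t.2.2.2).card

section Polynomials

open MvPolynomial

variable {K : Type*} [Field K]

/-- The line `y = a + g x`, `z = w` attached to `u = (a, g, w)`; coordinates are ordered `(y, x, z)`. -/
noncomputable def lineX (u : K × K × K) : Fin 3 → Polynomial K :=
  ![Polynomial.C u.1 + Polynomial.C u.2.1 * Polynomial.X, Polynomial.X, Polynomial.C u.2.2]

/-- The line `y = a + g z`, `x = w` attached to `u = (a, g, w)`; coordinates are ordered `(y, x, z)`. -/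
noncomputable def lineZ (u : K × K × K) : Fin 3 → Polynomial K :=
  ![Polynomial.C u.1 + Polynomial.C u.2.1 * Polynomial.X, Polynomial.C u.2.2, Polynomial.X]

theorem natDegree_aeval_le {σ : Type*} (f : σ → Polynomial K) (hf : ∀ i, (f i).natDegree ≤ 1)
    (F : MvPolynomial σ K) : (aeval f F).natDegree ≤ F.totalDegree := by
  rw [aeval_def, eval₂_eq]
  refine Polynomial.natDegree_sum_le_of_forall_le _ _ fun d hd => ?_
  refine (Polynomial.natDegree_C_mul_le _ _).trans ?_
  refine (Polynomial.natDegree_prod_le _ _).trans ?_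
  refine le_trans ?_ (le_totalDegree hd)
  refine Finset.sum_le_sum fun i _ => ?_
  refine Polynomial.natDegree_pow_le.trans ?_
  nlinarith [hf i]

theorem lineX_natDegree_le (u : K × K × K) (i : Fin 3) : (lineX u i).natDegree ≤ 1 := by
  fin_cases i
  · change (Polynomial.C u.1 + Polynomial.C u.2.1 * Polynomial.X).natDegree ≤ 1
    rw [add_comm]
    exact Polynomial.natDegree_linear_le
  · simp [lineX]
  · simp [lineX]

theorem lineZ_natDegree_le (u : K × K × K) (i : Fin 3) : (lineZ u i).natDegree ≤ 1 := by
  fin_cases i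
  · change (Polynomial.C u.1 + Polynomial.C u.2.1 * Polynomial.X).natDegree ≤ 1
    rw [add_comm]
    exact Polynomial.natDegree_linear_le
  · simp [lineZ]
  · simp [lineZ]

theorem eval_aeval_mvPolynomial {σ : Type*} (f : σ → Polynomial K) (t : K) (F : MvPolynomial σ K) :
    (aeval f F).eval t = eval (fun i => (f i).eval t) F := by
  induction F using MvPolynomial.induction_on with
  | C a => simp
  | add p q hp hq => simp [hp, hq]
  | mul_X p i hp => simp [hp]

theorem eval_aeval_lineX (u : K × K × K) (t : K) (F : MvPolynomial (Fin 3) K) :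
    (aeval (lineX u) F).eval t = eval ![u.1 + u.2.1 * t, t, u.2.2] F := by
  rw [eval_aeval_mvPolynomial]
  congr 2
  funext i
  fin_cases i <;> simp [lineX]

theorem eval_aeval_lineZ (u : K × K × K) (t : K) (F : MvPolynomial (Fin 3) K) :
    (aeval (lineZ u) F).eval t = eval ![u.1 + u.2.1 * t, u.2.2, t] F := by
  rw [eval_aeval_mvPolynomial]
  congr 2
  funext i
  fin_cases i <;> simp [lineZ]

/-- Exchange of the second and third coordinates. -/
noncomputable def swapXZ : MvPolynomial (Fin 3) K ≃ₐ[K] MvPolynomial (Fin 3) K :=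
  renameEquiv K (Equiv.swap 1 2)

theorem swapXZ_apply (F : MvPolynomial (Fin 3) K) :
    swapXZ F = rename (Equiv.swap (1 : Fin 3) 2) F := rfl

theorem aeval_lineX_swapXZ (u : K × K × K) (F : MvPolynomial (Fin 3) K) :
    aeval (lineX u) (swapXZ F) = aeval (lineZ u) F := by
  rw [swapXZ_apply, aeval_rename]
  congr 2
  funext i
  fin_cases i <;> simp [lineX, lineZ, Equiv.swap_apply_def]

theorem aeval_lineZ_swapXZ (u : K × K × K) (F : MvPolynomial (Fin 3) K) :
    aeval (lineZ u) (swapXZ F) = aeval (lineX u) F := by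
  rw [swapXZ_apply, aeval_rename]
  congr 2
  funext i
  fin_cases i <;> simp [lineX, lineZ, Equiv.swap_apply_def]

theorem totalDegree_swapXZ (F : MvPolynomial (Fin 3) K) :
    (swapXZ F).totalDegree = F.totalDegree := by
  rw [swapXZ_apply]
  exact totalDegree_renameEquiv (R := K) (Equiv.swap (1 : Fin 3) 2) F

theorem derivative_aeval_mvPolynomial {σ : Type*} [Fintype σ] (f : σ → Polynomial K)
    (F : MvPolynomial σ K) :
    (aeval f F).derivative = ∑ i, aeval f (pderiv i F) * (f i).derivative := by
  classical
  induction F using MvPolynomial.induction_on with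
  | C a => simp
  | add p q hp hq => simp [hp, hq, add_mul, Finset.sum_add_distrib]
  | mul_X p j hp =>
    have h : ∀ i, aeval f (pderiv i (p * X j)) * (f i).derivative =
        f j * (aeval f (pderiv i p) * (f i).derivative) +
          if i = j then aeval f p * (f i).derivative else 0 := by
      intro i
      rw [Derivation.leibniz, smul_eq_mul, smul_eq_mul, map_add, map_mul, map_mul, aeval_X]
      split_ifs with hij
      · subst hij
        rw [pderiv_X_self, map_one]
        ring
      · rw [pderiv_X_of_ne (Ne.symm hij), map_zero]
        ring
    rw [Finset.sum_congr rfl fun i _ => h i, Finset.sum_add_distrib, ← Finset.mul_sum,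
      Finset.sum_ite_eq' Finset.univ j, if_pos (Finset.mem_univ j), map_mul, aeval_X,
      Polynomial.derivative_mul, hp]
    ring

theorem totalDegree_pderiv_add_one_le {σ : Type*} (i : σ) (F : MvPolynomial σ K)
    (h : pderiv i F ≠ 0) : (pderiv i F).totalDegree + 1 ≤ F.totalDegree := by
  classical
  obtain ⟨d, hd, hdeg⟩ := Finset.exists_mem_eq_sup (pderiv i F).support
    (support_nonempty.mpr h) (fun s => s.sum fun _ e => e)
  have h1 : (pderiv i F).totalDegree = d.sum fun _ e => e := hdeg
  have h2 : d + Finsupp.single i 1 ∈ F.support := by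
    rw [mem_support_iff] at hd ⊢
    intro h0
    apply hd
    rw [coeff_pderiv, h0]
    simp
  have h3 := le_totalDegree h2
  rw [Finsupp.sum_add_index' (by simp) (by simp), Finsupp.sum_single_index rfl] at h3
  omega

theorem totalDegree_pderiv_le {σ : Type*} (i : σ) (F : MvPolynomial σ K) :
    (pderiv i F).totalDegree ≤ F.totalDegree := by
  by_cases h : pderiv i F = 0
  · simp [h]
  · have := totalDegree_pderiv_add_one_le i F h
    omega

theorem X_sub_dvd_of_aeval_eq_zero (G L : MvPolynomial (Fin 3) K)
    (h : aeval ![L, X 1, X 2] G = 0) : (X 0 - L) ∣ G := by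
  rw [← Ideal.mem_span_singleton, ← Ideal.Quotient.eq_zero_iff_mem]
  have key : (Ideal.Quotient.mkₐ K (Ideal.span {X 0 - L})) =
      (Ideal.Quotient.mkₐ K (Ideal.span {X 0 - L})).comp (aeval ![L, X 1, X 2]) := by
    apply algHom_ext
    intro i
    fin_cases i
    · simp only [AlgHom.comp_apply, aeval_X, Ideal.Quotient.mkₐ_eq_mk]
      exact Ideal.Quotient.eq.mpr (Ideal.mem_span_singleton_self _)
    · simp
    · simp
  have := DFunLike.congr_fun key G
  simp only [AlgHom.comp_apply, h, map_zero, Ideal.Quotient.mkₐ_eq_mk] at this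
  exact this

end Polynomials

section Elimination

open MvPolynomial

variable {K : Type*} [Field K]

theorem totalDegree_det_le {σ : Type*} {N d : ℕ} (M : Matrix (Fin N) (Fin N) (MvPolynomial σ K))
    (h : ∀ i j, (M i j).totalDegree ≤ d) : M.det.totalDegree ≤ N * d := by
  rw [Matrix.det_apply]
  refine totalDegree_finsetSum_le fun τ _ => ?_
  rw [Units.smul_def]
  refine (totalDegree_smul_le _ _).trans ?_
  refine (totalDegree_finsetProd _ _).trans ?_
  refine (Finset.sum_le_sum fun i _ => h _ _).trans ?_
  simp

theorem totalDegree_resultant_le {σ : Type*} {d m n : ℕ} (f g : Polynomial (MvPolynomial σ K))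
    (hf : ∀ i, (f.coeff i).totalDegree ≤ d) (hg : ∀ i, (g.coeff i).totalDegree ≤ d) :
    (Polynomial.resultant f g m n).totalDegree ≤ (m + n) * d := by
  refine totalDegree_det_le _ fun i j => ?_
  induction j using Fin.addCases with
  | left j =>
    simp only [Polynomial.sylvester, Matrix.of_apply, Fin.addCases_left]
    split_ifs
    · exact hg _
    · simp
  | right j =>
    simp only [Polynomial.sylvester, Matrix.of_apply, Fin.addCases_right]
    split_ifs
    · exact hf _
    · simp

theorem aeval_cons_eq_eval₂_finSuccEquiv (f0 f1 f2 : Polynomial K) (F : MvPolynomial (Fin 3) K) :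
    aeval ![f0, f1, f2] F = (finSuccEquiv K 2 F).eval₂ (aeval ![f1, f2]).toRingHom f0 := by
  induction F using MvPolynomial.induction_on with
  | C a => simp [finSuccEquiv_apply]
  | add p q hp hq => simp only [map_add, hp, hq, Polynomial.eval₂_add]
  | mul_X p i hp =>
    rw [map_mul, map_mul, hp, Polynomial.eval₂_mul]
    congr 1
    fin_cases i
    · change aeval ![f0, f1, f2] (X 0) = Polynomial.eval₂ _ _ (finSuccEquiv K 2 (X 0))
      rw [finSuccEquiv_X_zero]
      simp
    · change aeval ![f0, f1, f2] (X (Fin.succ 0)) =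
        Polynomial.eval₂ _ _ (finSuccEquiv K 2 (X (Fin.succ 0)))
      rw [finSuccEquiv_X_succ]
      simp
    · change aeval ![f0, f1, f2] (X (Fin.succ 1)) =
        Polynomial.eval₂ _ _ (finSuccEquiv K 2 (X (Fin.succ 1)))
      rw [finSuccEquiv_X_succ]
      simp

theorem totalDegree_coeff_finSuccEquiv_le (F : MvPolynomial (Fin 3) K) (i : ℕ) :
    ((finSuccEquiv K 2 F).coeff i).totalDegree ≤ F.totalDegree := by
  by_cases h : (finSuccEquiv K 2 F).coeff i = 0
  · simp [h]
  · have := totalDegree_coeff_finSuccEquiv_add_le F i h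
    omega

theorem natDegree_finSuccEquiv_le (F : MvPolynomial (Fin 3) K) :
    (finSuccEquiv K 2 F).natDegree ≤ F.totalDegree := by
  rw [natDegree_finSuccEquiv]
  exact degreeOf_le_totalDegree F 0

theorem exists_eliminant_of_natDegree_eq_zero {F : MvPolynomial (Fin 3) K} (hF : F ≠ 0)
    (h0 : (finSuccEquiv K 2 F).natDegree = 0) :
    ∃ P : MvPolynomial (Fin 2) K, P ≠ 0 ∧ P.totalDegree ≤ F.totalDegree ∧
      ∀ f0 f1 f2 : Polynomial K, aeval ![f0, f1, f2] F = 0 → aeval ![f1, f2] P = 0 := by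
  rw [Polynomial.natDegree_eq_zero] at h0
  obtain ⟨P, hP⟩ := h0
  refine ⟨P, ?_, ?_, fun f0 f1 f2 hf => ?_⟩
  · rintro rfl
    rw [Polynomial.C_0] at hP
    exact hF ((EmbeddingLike.map_eq_zero_iff (f := finSuccEquiv K 2)).mp hP.symm)
  · have := totalDegree_coeff_finSuccEquiv_le F 0
    rwa [← hP, Polynomial.coeff_C_zero] at this
  · rw [aeval_cons_eq_eval₂_finSuccEquiv, ← hP, Polynomial.eval₂_C] at hf
    exact hf

theorem exists_eliminant {F G : MvPolynomial (Fin 3) K} (hF : Irreducible F) (hG : ¬ F ∣ G)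
    {D E : ℕ} (hD : F.totalDegree ≤ D) (hE : G.totalDegree ≤ E) (hDE : D ≤ E) :
    ∃ P : MvPolynomial (Fin 2) K, P ≠ 0 ∧ P.totalDegree ≤ (D + E) * E ∧
      ∀ f0 f1 f2 : Polynomial K, aeval ![f0, f1, f2] F = 0 → aeval ![f0, f1, f2] G = 0 →
        aeval ![f1, f2] P = 0 := by
  by_cases h0 : (finSuccEquiv K 2 F).natDegree = 0
  · obtain ⟨P, h1, h2, h3⟩ := exists_eliminant_of_natDegree_eq_zero hF.ne_zero h0
    refine ⟨P, h1, ?_, fun f0 f1 f2 hf _ => h3 f0 f1 f2 hf⟩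
    rcases Nat.eq_zero_or_pos E with rfl | hE0
    · omega
    · nlinarith
  set f := finSuccEquiv K 2 F with hf
  set g := finSuccEquiv K 2 G with hg
  have hfi : Irreducible f := (MulEquiv.irreducible_iff (finSuccEquiv K 2)).mpr hF
  have hfg : ¬ f ∣ g := fun h => hG ((map_dvd_iff (finSuccEquiv K 2)).mp h)
  have hprim : f.IsPrimitive := hfi.isPrimitive h0
  let L := FractionRing (MvPolynomial (Fin 2) K)
  have hfm : Irreducible (f.map (algebraMap _ L)) := by
    let _ : NormalizedGCDMonoid (MvPolynomial (Fin 2) K) := Classical.choice inferInstance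
    exact hprim.irreducible_iff_irreducible_map_fraction_map.mp hfi
  have hfgm : ¬ f.map (algebraMap _ L) ∣ g.map (algebraMap _ L) := by
    let _ : NormalizedGCDMonoid (MvPolynomial (Fin 2) K) := Classical.choice inferInstance
    exact fun h => hfg (hprim.dvd_of_fraction_map_dvd_fraction_map (K := L) h)
  have hcop : IsCoprime (f.map (algebraMap _ L)) (g.map (algebraMap _ L)) :=
    (hfm.coprime_iff_not_dvd).mpr hfgm
  have hinj : Function.Injective (algebraMap (MvPolynomial (Fin 2) K) L) :=
    IsFractionRing.injective _ _
  have hres : Polynomial.resultant f g ≠ 0 := by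
    intro h
    have h2 := Polynomial.resultant_map_map f g f.natDegree g.natDegree (algebraMap _ L)
    rw [h, map_zero] at h2
    have h3 := Polynomial.resultant_eq_zero_iff (f := f.map (algebraMap _ L))
      (g := g.map (algebraMap _ L))
    rw [Polynomial.natDegree_map_eq_of_injective hinj,
      Polynomial.natDegree_map_eq_of_injective hinj] at h3
    exact (h3.mp h2).2 hcop
  refine ⟨Polynomial.resultant f g, hres, ?_, fun f0 f1 f2 h1 h2 => ?_⟩
  · refine (totalDegree_resultant_le f g (d := E) (fun i => ?_) fun i => ?_).trans ?_
    · exact (totalDegree_coeff_finSuccEquiv_le F i).trans (hD.trans hDE)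
    · exact (totalDegree_coeff_finSuccEquiv_le G i).trans hE
    · exact Nat.mul_le_mul_right _ (Nat.add_le_add ((natDegree_finSuccEquiv_le F).trans hD)
        ((natDegree_finSuccEquiv_le G).trans hE))
  · obtain ⟨a, b, -, -, hab⟩ := Polynomial.exists_mul_add_mul_eq_C_resultant f g le_rfl le_rfl
      (Or.inl h0)
    rw [aeval_cons_eq_eval₂_finSuccEquiv] at h1 h2
    have := congrArg (Polynomial.eval₂ (aeval ![f1, f2]).toRingHom f0) hab
    rw [Polynomial.eval₂_add, Polynomial.eval₂_mul, Polynomial.eval₂_mul] at this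
    rw [← hf] at h1
    rw [← hg] at h2
    rw [h1, h2, zero_mul, zero_mul, add_zero, Polynomial.eval₂_C] at this
    exact this.symm

theorem card_le_totalDegree_of_aeval_C_X [Infinite K] {P : MvPolynomial (Fin 2) K} (hP : P ≠ 0)
    (Z : Finset K) (h : ∀ w ∈ Z, aeval ![Polynomial.X, Polynomial.C w] P = 0) :
    Z.card ≤ P.totalDegree := by
  obtain ⟨v, hv⟩ : ∃ v, eval v P ≠ 0 := by
    by_contra! hall
    exact hP (MvPolynomial.funext fun v => by simp [hall])
  set q := aeval ![Polynomial.C (v 0), Polynomial.X] P with hq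
  have hev : ∀ t, q.eval t = eval ![v 0, t] P := by
    intro t
    rw [hq, eval_aeval_mvPolynomial]
    congr 2
    funext i
    fin_cases i <;> simp
  have hq0 : q ≠ 0 := by
    intro h0
    have := hev (v 1)
    rw [h0, Polynomial.eval_zero] at this
    apply hv
    rw [this]
    congr 2
    funext i
    fin_cases i <;> simp
  have hdeg : q.natDegree ≤ P.totalDegree := natDegree_aeval_le _ (by
    intro i
    fin_cases i <;> simp) _
  have hroot : Z.val ≤ q.roots := by
    rw [Multiset.le_iff_subset Z.nodup]
    intro w hw
    rw [Polynomial.mem_roots hq0, Polynomial.IsRoot, hev]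
    have := congrArg (Polynomial.eval (v 0)) (h w hw)
    rw [eval_aeval_mvPolynomial, Polynomial.eval_zero] at this
    rw [← this]
    congr 2
    funext i
    fin_cases i <;> simp
  exact (Multiset.card_le_card hroot).trans ((Polynomial.card_roots' q).trans hdeg)

/-- The set of third coordinates of lines on which an irreducible `F` and a polynomial not divisible
by `F` both vanish has bounded size. -/
theorem card_le_of_aeval_lineX_eq_zero [Infinite K] {F G : MvPolynomial (Fin 3) K}
    (hF : Irreducible F) (hG : ¬ F ∣ G) {D : ℕ} (hD : F.totalDegree ≤ D)
    (hE : G.totalDegree ≤ 3 * D) (A : Finset (K × K × K))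
    (hA : Set.InjOn (fun u : K × K × K => u.2.2) A)
    (h1 : ∀ u ∈ A, aeval (lineX u) F = 0) (h2 : ∀ u ∈ A, aeval (lineX u) G = 0) :
    A.card ≤ 12 * D ^ 2 := by
  classical
  obtain ⟨P, hP, hdeg, hvan⟩ := exists_eliminant hF hG hD hE (by omega)
  rw [← Finset.card_image_of_injOn hA]
  refine (card_le_totalDegree_of_aeval_C_X hP _ fun w hw => ?_).trans (hdeg.trans (by nlinarith))
  obtain ⟨u, hu, rfl⟩ := Finset.mem_image.mp hw
  exact hvan _ _ _ (h1 u hu) (h2 u hu)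

theorem irreducible_swapXZ {F : MvPolynomial (Fin 3) K} (hF : Irreducible F) :
    Irreducible (swapXZ F) := (MulEquiv.irreducible_iff swapXZ).mpr hF

theorem card_le_of_aeval_lineZ_eq_zero [Infinite K] {F G : MvPolynomial (Fin 3) K}
    (hF : Irreducible F) (hG : ¬ F ∣ G) {D : ℕ} (hD : F.totalDegree ≤ D)
    (hE : G.totalDegree ≤ 3 * D) (A : Finset (K × K × K))
    (hA : Set.InjOn (fun u : K × K × K => u.2.2) A)
    (h1 : ∀ u ∈ A, aeval (lineZ u) F = 0) (h2 : ∀ u ∈ A, aeval (lineZ u) G = 0) :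
    A.card ≤ 12 * D ^ 2 := by
  refine card_le_of_aeval_lineX_eq_zero (irreducible_swapXZ hF) (G := swapXZ G)
    (fun h => hG ((map_dvd_iff swapXZ).mp h)) (by rwa [totalDegree_swapXZ])
    (by rwa [totalDegree_swapXZ]) A hA ?_ ?_
  · simpa only [aeval_lineX_swapXZ] using h1
  · simpa only [aeval_lineX_swapXZ] using h2

/-- In small degree a polynomial with vanishing `y`-derivative does not involve `y`. -/
theorem natDegree_finSuccEquiv_eq_zero_of_pderiv_eq_zero {p : ℕ} [CharP K p]
    {F : MvPolynomial (Fin 3) K} (hFp : F.totalDegree < p) (h : pderiv 0 F = 0) :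
    (finSuccEquiv K 2 F).natDegree = 0 := by
  rw [natDegree_finSuccEquiv, ← Nat.le_zero, degreeOf_le_iff]
  intro d hd
  by_contra! h0
  have h1 := le_totalDegree hd
  have h2 : d 0 ≤ d.sum fun _ e => e := by
    rw [Finsupp.sum]
    exact Finset.single_le_sum (f := fun i => d i) (fun _ _ => Nat.zero_le _)
      (Finsupp.mem_support_iff.mpr h0.ne')
  have h3 := congrArg (coeff (d - Finsupp.single 0 1)) h
  rw [coeff_pderiv, coeff_zero, tsub_add_cancel_of_le (Finsupp.single_le_iff.mpr h0)] at h3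
  rcases mul_eq_zero.mp h3 with h4 | h4
  · exact mem_support_iff.mp hd h4
  · have h5 : ((d 0 : ℕ) : K) = 0 := by
      rw [← h4, Finsupp.tsub_apply, Finsupp.single_eq_same]
      have : d 0 = (d 0 - 1) + 1 := by omega
      conv_lhs => rw [this]
      push_cast
      rfl
    rw [CharP.cast_eq_zero_iff K p] at h5
    exact absurd (Nat.le_of_dvd h0 h5) (by omega)

end Elimination

section Ruling

open MvPolynomial

variable {K : Type*} [Field K]

/-- A polynomial solution of a second order linear equation with vanishing initial data at a regular
point is zero, provided that its degree is below the characteristic. -/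
theorem eq_zero_of_second_order {p : ℕ} [CharP K p] {h u Ψ Θ : Polynomial K} {t : K}
    (heq : u ^ 2 * h.derivative.derivative = h * Ψ + h.derivative * Θ) (h0 : h.eval t = 0)
    (h1 : h.derivative.eval t = 0) (hu : u.eval t ≠ 0) (hp : h.natDegree < p) : h = 0 := by
  by_contra hne
  obtain ⟨q, hq, hnd⟩ := Polynomial.exists_eq_pow_rootMultiplicity_mul_and_not_dvd h hne t
  generalize h.rootMultiplicity t = r at hq
  have hq0 : q.eval t ≠ 0 := fun hz => hnd (Polynomial.dvd_iff_isRoot.mpr hz)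
  have hqne : q ≠ 0 := by rintro rfl; simp at hq0
  match r, hq with
  | 0, hq => rw [hq] at h0; simp [hq0] at h0
  | 1, hq => rw [hq] at h1; simp [hq0] at h1
  | k + 2, hq =>
    set L : Polynomial K := Polynomial.X - Polynomial.C t with hL
    have hLm : L.Monic := Polynomial.monic_X_sub_C t
    have hdL : L.derivative = 1 := by simp [hL]
    have hLt : L.eval t = 0 := by simp [hL]
    have d1 : h.derivative = L ^ (k + 1) * (((k : Polynomial K) + 2) * q + L * q.derivative) := by
      have hC : (Polynomial.C 2 : Polynomial K) = 2 := map_ofNat _ 2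
      rw [hq, Polynomial.derivative_mul, Polynomial.derivative_pow, hdL]
      simp [hC]
      ring
    have d2 : h.derivative.derivative = L ^ k * (((k : Polynomial K) + 1) * (((k : Polynomial K) + 2) * q
        + L * q.derivative) + L * (((k : Polynomial K) + 2) * q.derivative + (q.derivative
        + L * q.derivative.derivative))) := by
      rw [d1, Polynomial.derivative_mul, Polynomial.derivative_pow, hdL]
      simp [Polynomial.derivative_mul, hdL]
      ring
    have hc : u ^ 2 * (((k : Polynomial K) + 1) * (((k : Polynomial K) + 2) * q
        + L * q.derivative) + L * (((k : Polynomial K) + 2) * q.derivative + (q.derivative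
        + L * q.derivative.derivative))) =
        L * (L * q * Ψ + (((k : Polynomial K) + 2) * q + L * q.derivative) * Θ) := by
      apply mul_left_cancel₀ (pow_ne_zero k hLm.ne_zero)
      rw [d2, d1, hq] at heq
      linear_combination heq
    have hcev := congrArg (Polynomial.eval t) hc
    simp only [Polynomial.eval_mul, Polynomial.eval_add, Polynomial.eval_pow, hLt, zero_mul,
      add_zero, Polynomial.eval_natCast, Polynomial.eval_one, Polynomial.eval_ofNat] at hcev
    have hdeg : k + 2 ≤ h.natDegree := by
      rw [hq, Polynomial.natDegree_mul (pow_ne_zero _ hLm.ne_zero) hqne,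
        Polynomial.natDegree_pow, hL, Polynomial.natDegree_X_sub_C]
      omega
    have hk1 : (k : K) + 1 ≠ 0 := by
      have : ((k + 1 : ℕ) : K) ≠ 0 := by
        rw [Ne, CharP.cast_eq_zero_iff K p]
        exact fun hd => absurd (Nat.le_of_dvd (by omega) hd) (by omega)
      exact_mod_cast this
    have hk2 : (k : K) + 2 ≠ 0 := by
      have : ((k + 2 : ℕ) : K) ≠ 0 := by
        rw [Ne, CharP.cast_eq_zero_iff K p]
        exact fun hd => absurd (Nat.le_of_dvd (by omega) hd) (by omega)
      exact_mod_cast this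
    exact mul_ne_zero (pow_ne_zero 2 hu) (mul_ne_zero hk1 (mul_ne_zero hk2 hq0)) hcev

theorem derivative_aeval_lineX (u : K × K × K) (F : MvPolynomial (Fin 3) K) :
    (aeval (lineX u) F).derivative =
      Polynomial.C u.2.1 * aeval (lineX u) (pderiv 0 F) + aeval (lineX u) (pderiv 1 F) := by
  rw [derivative_aeval_mvPolynomial, Fin.sum_univ_three]
  simp [lineX]
  ring

/-- The numerator of the second derivative of the implicit function `y` with respect to the `i`-th
coordinate along a surface `F = 0`. -/
noncomputable def implicitSecondDeriv (i : Fin 3) (F : MvPolynomial (Fin 3) K) :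
    MvPolynomial (Fin 3) K :=
  pderiv 0 F ^ 2 * pderiv i (pderiv i F)
    - C 2 * (pderiv i F * pderiv 0 F * pderiv i (pderiv 0 F))
    + pderiv i F ^ 2 * pderiv 0 (pderiv 0 F)

theorem totalDegree_implicitSecondDeriv_le (i : Fin 3) (F : MvPolynomial (Fin 3) K) :
    (implicitSecondDeriv i F).totalDegree ≤ 3 * F.totalDegree := by
  have h0 := totalDegree_pderiv_le (K := K) 0 F
  have hi := totalDegree_pderiv_le i F
  have h00 := (totalDegree_pderiv_le 0 (pderiv 0 F)).trans h0
  have hi0 := (totalDegree_pderiv_le i (pderiv 0 F)).trans h0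
  have hii := (totalDegree_pderiv_le i (pderiv i F)).trans hi
  have h0s := totalDegree_pow (R := K) (pderiv 0 F) 2
  have his := totalDegree_pow (pderiv i F) 2
  refine (totalDegree_add _ _).trans (max_le ((totalDegree_sub _ _).trans (max_le ?_ ?_)) ?_)
  · refine (totalDegree_mul _ _).trans ?_
    omega
  · refine (totalDegree_mul _ _).trans ?_
    rw [totalDegree_C]
    have := (totalDegree_mul (pderiv i F * pderiv 0 F) (pderiv i (pderiv 0 F)))
    have := (totalDegree_mul (pderiv i F) (pderiv 0 F))
    omega
  · refine (totalDegree_mul _ _).trans ?_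
    omega

theorem pderiv_pderiv_comm {σ : Type*} (i j : σ) (F : MvPolynomial σ K) :
    pderiv i (pderiv j F) = pderiv j (pderiv i F) := by
  classical
  have h : (⁅(pderiv i : Derivation K (MvPolynomial σ K) (MvPolynomial σ K)),
      pderiv j⁆ : Derivation K (MvPolynomial σ K) (MvPolynomial σ K)) = 0 := by
    apply derivation_ext
    intro k
    have h0 : ∀ i j, pderiv i (pderiv j (X k : MvPolynomial σ K)) = 0 := fun i j => by
      rw [pderiv_X, Pi.single_apply]
      split_ifs <;> simp
    rw [Derivation.commutator_apply, h0, h0, sub_zero, Derivation.zero_apply]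
  have := DFunLike.congr_fun h F
  rw [Derivation.commutator_apply] at this
  exact sub_eq_zero.mp this

theorem swapXZ_pderiv (i : Fin 3) (F : MvPolynomial (Fin 3) K) :
    swapXZ (pderiv i F) = pderiv (Equiv.swap (1 : Fin 3) 2 i) (swapXZ F) := by
  rw [swapXZ_apply, swapXZ_apply, pderiv_rename (Equiv.injective _)]

theorem swapXZ_implicitSecondDeriv (i : Fin 3) (F : MvPolynomial (Fin 3) K) :
    swapXZ (implicitSecondDeriv i F) =
      implicitSecondDeriv (Equiv.swap (1 : Fin 3) 2 i) (swapXZ F) := by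
  have h0 : Equiv.swap (1 : Fin 3) 2 0 = 0 := by decide
  have hC : swapXZ (C 2 : MvPolynomial (Fin 3) K) = C 2 := by rw [swapXZ_apply, rename_C]
  simp only [implicitSecondDeriv, map_add, map_sub, map_mul, map_pow, swapXZ_pderiv, h0, hC]

theorem second_derivative_aeval_lineX (u : K × K × K) (F : MvPolynomial (Fin 3) K) :
    (aeval (lineX u) F).derivative.derivative =
      Polynomial.C u.2.1 ^ 2 * aeval (lineX u) (pderiv 0 (pderiv 0 F))
        + 2 * Polynomial.C u.2.1 * aeval (lineX u) (pderiv 1 (pderiv 0 F))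
        + aeval (lineX u) (pderiv 1 (pderiv 1 F)) := by
  rw [derivative_aeval_lineX, Polynomial.derivative_add, Polynomial.derivative_mul,
    derivative_aeval_lineX, derivative_aeval_lineX, Polynomial.derivative_C, pderiv_pderiv_comm 0 1]
  ring

theorem aeval_lineX_implicitSecondDeriv (u : K × K × K) (F : MvPolynomial (Fin 3) K) :
    aeval (lineX u) (implicitSecondDeriv 1 F) =
      aeval (lineX u) (pderiv 0 F) ^ 2 * aeval (lineX u) (pderiv 1 (pderiv 1 F))
      - 2 * (aeval (lineX u) (pderiv 1 F) * aeval (lineX u) (pderiv 0 F) *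
          aeval (lineX u) (pderiv 1 (pderiv 0 F)))
      + aeval (lineX u) (pderiv 1 F) ^ 2 * aeval (lineX u) (pderiv 0 (pderiv 0 F)) := by
  have hC : (Polynomial.C 2 : Polynomial K) = 2 := map_ofNat _ 2
  simp only [implicitSecondDeriv, map_add, map_sub, map_mul, map_pow, aeval_C,
    Polynomial.algebraMap_eq, hC]

theorem aeval_lineX_implicitSecondDeriv_eq_zero {u : K × K × K} {F : MvPolynomial (Fin 3) K}
    (h : aeval (lineX u) F = 0) : aeval (lineX u) (implicitSecondDeriv 1 F) = 0 := by
  have h1 := derivative_aeval_lineX u F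
  have h2 := second_derivative_aeval_lineX u F
  rw [h] at h1 h2
  simp only [Polynomial.derivative_zero] at h1 h2
  rw [aeval_lineX_implicitSecondDeriv]
  have h3 : aeval (lineX u) (pderiv 1 F) = - (Polynomial.C u.2.1 * aeval (lineX u) (pderiv 0 F)) := by
    linear_combination -h1
  rw [h3]
  linear_combination -(aeval (lineX u) (pderiv 0 F)) ^ 2 * h2

theorem aeval_lineZ_implicitSecondDeriv_eq_zero {u : K × K × K} {F : MvPolynomial (Fin 3) K}
    (h : aeval (lineZ u) F = 0) : aeval (lineZ u) (implicitSecondDeriv 2 F) = 0 := by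
  rw [← aeval_lineX_swapXZ, swapXZ_implicitSecondDeriv, Equiv.swap_apply_right]
  apply aeval_lineX_implicitSecondDeriv_eq_zero
  rwa [aeval_lineX_swapXZ]

/-- If `F` divides its implicit second derivative along `x`, then every regular point of the surface
lies on a line of the surface in the direction of the `x`-axis. -/
theorem aeval_lineX_eq_zero_of_dvd {p : ℕ} [CharP K p] {F : MvPolynomial (Fin 3) K}
    (hp : F.totalDegree < p) (hdvd : F ∣ implicitSecondDeriv 1 F) {y x z m : K}
    (h0 : eval ![y, x, z] F = 0) (h1 : eval ![y, x, z] (pderiv 0 F) ≠ 0)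
    (hm : m * eval ![y, x, z] (pderiv 0 F) + eval ![y, x, z] (pderiv 1 F) = 0) :
    aeval (lineX (y - m * x, m, z)) F = 0 := by
  obtain ⟨G, hG⟩ := hdvd
  set ℓ : K × K × K := (y - m * x, m, z) with hℓ
  have hev : ∀ H : MvPolynomial (Fin 3) K, (aeval (lineX ℓ) H).eval x = eval ![y, x, z] H := by
    intro H
    rw [eval_aeval_lineX]
    simp [hℓ]
  have hd1 := derivative_aeval_lineX ℓ F
  have hd2 := second_derivative_aeval_lineX ℓ F
  have hΦ := aeval_lineX_implicitSecondDeriv ℓ F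
  rw [hG, map_mul] at hΦ
  refine eq_zero_of_second_order (p := p) (u := aeval (lineX ℓ) (pderiv 0 F))
    (Ψ := aeval (lineX ℓ) G)
    (Θ := 2 * aeval (lineX ℓ) (pderiv 0 F) * aeval (lineX ℓ) (pderiv 1 (pderiv 0 F))
      - ((aeval (lineX ℓ) F).derivative - 2 * Polynomial.C m * aeval (lineX ℓ) (pderiv 0 F)) *
        aeval (lineX ℓ) (pderiv 0 (pderiv 0 F))) (t := x) ?_ ?_ ?_ ?_ ?_
  · have h3 : aeval (lineX ℓ) (pderiv 1 F) = (aeval (lineX ℓ) F).derivative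
        - Polynomial.C m * aeval (lineX ℓ) (pderiv 0 F) := by
      rw [hd1]; ring
    rw [hΦ, hd2, h3]
    ring
  · rw [hev, h0]
  · rw [hd1, Polynomial.eval_add, Polynomial.eval_mul, hev, hev, Polynomial.eval_C]
    exact hm
  · rwa [hev]
  · exact (natDegree_aeval_le _ (lineX_natDegree_le ℓ) F).trans_lt hp

theorem eval_swapXZ (y x z : K) (F : MvPolynomial (Fin 3) K) :
    eval ![y, x, z] (swapXZ F) = eval ![y, z, x] F := by
  rw [swapXZ_apply, eval_rename]
  congr 2
  funext i
  fin_cases i <;> simp [Equiv.swap_apply_def]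

theorem aeval_lineZ_eq_zero_of_dvd {p : ℕ} [CharP K p] {F : MvPolynomial (Fin 3) K}
    (hp : F.totalDegree < p) (hdvd : F ∣ implicitSecondDeriv 2 F) {y x z m : K}
    (h0 : eval ![y, x, z] F = 0) (h1 : eval ![y, x, z] (pderiv 0 F) ≠ 0)
    (hm : m * eval ![y, x, z] (pderiv 0 F) + eval ![y, x, z] (pderiv 2 F) = 0) :
    aeval (lineZ (y - m * z, m, x)) F = 0 := by
  rw [← aeval_lineX_swapXZ]
  have e0 : pderiv 0 (swapXZ F) = swapXZ (pderiv 0 F) := by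
    rw [swapXZ_pderiv]; rfl
  have e1 : pderiv 1 (swapXZ F) = swapXZ (pderiv 2 F) := by
    rw [swapXZ_pderiv, Equiv.swap_apply_right]
  refine aeval_lineX_eq_zero_of_dvd (p := p) (by rwa [totalDegree_swapXZ]) ?_ ?_ ?_ ?_
  · have := (map_dvd_iff swapXZ).mpr hdvd
    rwa [swapXZ_implicitSecondDeriv, Equiv.swap_apply_right] at this
  · rwa [eval_swapXZ]
  · rwa [e0, eval_swapXZ]
  · rwa [e0, e1, eval_swapXZ, eval_swapXZ]

end Ruling

section DoublyRuled

open MvPolynomial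

variable {K : Type*} [Field K]

theorem exists_eval_eq_pow_mul_eval_div (R W : Polynomial K) (z : K) (G : MvPolynomial (Fin 3) K) :
    ∃ (N : Polynomial K) (d : ℕ), ∀ x, R.eval x ≠ 0 →
      N.eval x = R.eval x ^ d * eval ![W.eval x / R.eval x, x, z] G := by
  induction G using MvPolynomial.induction_on with
  | C a => exact ⟨Polynomial.C a, 0, fun x _ => by simp⟩
  | add G₁ G₂ h₁ h₂ =>
    obtain ⟨N₁, d₁, h₁⟩ := h₁
    obtain ⟨N₂, d₂, h₂⟩ := h₂
    refine ⟨R ^ d₂ * N₁ + R ^ d₁ * N₂, d₁ + d₂, fun x hx => ?_⟩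
    simp only [Polynomial.eval_add, Polynomial.eval_mul, Polynomial.eval_pow, h₁ x hx, h₂ x hx,
      map_add]
    ring
  | mul_X G i h =>
    obtain ⟨N, d, h⟩ := h
    fin_cases i
    · refine ⟨N * W, d + 1, fun x hx => ?_⟩
      rw [Polynomial.eval_mul, h x hx, map_mul, eval_X]
      have := div_mul_cancel₀ (W.eval x) hx
      simp only [Fin.zero_eta, Matrix.cons_val_zero]
      linear_combination
        -(R.eval x ^ d * eval ![W.eval x / R.eval x, x, z] G) * this
    · refine ⟨N * Polynomial.X, d, fun x hx => ?_⟩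
      rw [Polynomial.eval_mul, h x hx, map_mul, eval_X]
      simp
      ring
    · refine ⟨N * Polynomial.C z, d, fun x hx => ?_⟩
      rw [Polynomial.eval_mul, h x hx, map_mul, eval_X]
      simp
      ring

theorem eval_aeval_vec3 (L : MvPolynomial (Fin 3) K) (M : MvPolynomial (Fin 3) K)
    (N : MvPolynomial (Fin 3) K) (v : Fin 3 → K) (F : MvPolynomial (Fin 3) K) :
    eval v (aeval ![L, M, N] F) = eval ![eval v L, eval v M, eval v N] F := by
  induction F using MvPolynomial.induction_on with
  | C a => simp
  | add p q hp hq => rw [map_add, map_add, map_add, hp, hq]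
  | mul_X p i hp =>
    rw [map_mul, map_mul, hp, map_mul, aeval_X, eval_X]
    congr 1
    fin_cases i <;> simp

theorem eval_aeval_X {σ : Type*} (v : σ → K) (i : σ) (R : Polynomial K) :
    eval v (Polynomial.aeval (X i : MvPolynomial σ K) R) = R.eval (v i) := by
  rw [Polynomial.aeval_def, Polynomial.hom_eval₂, eval_X]
  have : (eval v).comp (algebraMap K (MvPolynomial σ K)) = RingHom.id K := by
    ext
    simp
  rw [this, Polynomial.eval₂_id]

theorem exists_polynomial_eval_ne_zero [Infinite K] {q : Polynomial K} (hq : q ≠ 0) :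
    ∃ x, q.eval x ≠ 0 := by
  by_contra! h
  exact hq (Polynomial.funext fun x => by simp [h])

/-- Two branches of `F(y, x, z) = 0` over the `x`-axis, one linear and one rational, that meet at a
regular point coincide. -/
theorem linear_branch_unique [Infinite K] {F : MvPolynomial (Fin 3) K} {R W : Polynomial K}
    {a g z x₀ : K} (hline : aeval (lineX (a, g, z)) F = 0)
    (hbranch : ∀ x, R.eval x ≠ 0 → eval ![W.eval x / R.eval x, x, z] F = 0)
    (hx₀ : R.eval x₀ ≠ 0) (hW : W.eval x₀ / R.eval x₀ = a + g * x₀)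
    (hreg : eval ![a + g * x₀, x₀, z] (pderiv 0 F) ≠ 0) :
    W = R * (Polynomial.C a + Polynomial.C g * Polynomial.X) := by
  set F' : MvPolynomial (Fin 3) K := aeval ![X 0, X 1, C z] F with hF'
  have hF'ev : ∀ y x t, eval ![y, x, t] F' = eval ![y, x, z] F := by
    intro y x t
    rw [hF', eval_aeval_vec3]
    simp
  obtain ⟨q, hq⟩ : (X 0 - (C a + C g * X 1)) ∣ F' := by
    apply X_sub_dvd_of_aeval_eq_zero
    apply MvPolynomial.funext
    intro v
    rw [eval_aeval_vec3, hF'ev]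
    have := congrArg (Polynomial.eval (v 1)) hline
    rw [eval_aeval_lineX] at this
    simpa using this
  have hprod : ∀ y x, eval ![y, x, z] F = (y - (a + g * x)) * eval ![y, x, z] q := by
    intro y x
    rw [← hF'ev y x z, hq]
    simp
  have hq₀ : eval ![a + g * x₀, x₀, z] q = eval ![a + g * x₀, x₀, z] (pderiv 0 F) := by
    set ℓ : Fin 3 → Polynomial K := ![Polynomial.X, Polynomial.C x₀, Polynomial.C z] with hℓ
    have hev : ∀ G : MvPolynomial (Fin 3) K, ∀ t, (aeval ℓ G).eval t = eval ![t, x₀, z] G := by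
      intro G t
      rw [eval_aeval_mvPolynomial]
      congr 2
      funext i
      fin_cases i <;> simp [hℓ]
    have h1 : aeval ℓ F = (Polynomial.X - Polynomial.C (a + g * x₀)) * aeval ℓ q := by
      apply Polynomial.funext
      intro t
      rw [hev, hprod, Polynomial.eval_mul, hev]
      simp
    have h2 := derivative_aeval_mvPolynomial ℓ F
    rw [h1, Fin.sum_univ_three] at h2
    have d0 : (ℓ 0).derivative = 1 := Polynomial.derivative_X
    have d1 : (ℓ 1).derivative = 0 := Polynomial.derivative_C
    have d2 : (ℓ 2).derivative = 0 := Polynomial.derivative_C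
    rw [d0, d1, d2] at h2
    have h3 := congrArg (Polynomial.eval (a + g * x₀)) h2
    simpa only [mul_one, mul_zero, add_zero, Polynomial.derivative_mul, Polynomial.eval_add,
      Polynomial.eval_mul, Polynomial.derivative_X_sub_C, Polynomial.eval_sub, Polynomial.eval_X,
      Polynomial.eval_C, sub_self, zero_mul, Polynomial.eval_one, one_mul, hev] using h3
  obtain ⟨N, d, hN⟩ := exists_eval_eq_pow_mul_eval_div R W z q
  have hR : R ≠ 0 := by rintro rfl; simp at hx₀
  have hN0 : N ≠ 0 := by
    rintro rfl
    have := hN x₀ hx₀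
    rw [hW, hq₀, Polynomial.eval_zero] at this
    exact mul_ne_zero (pow_ne_zero d hx₀) hreg this.symm
  have hzero : (W - R * (Polynomial.C a + Polynomial.C g * Polynomial.X)) * (N * R) = 0 := by
    apply Polynomial.funext
    intro x
    by_cases hx : R.eval x = 0
    · simp [hx]
    have h1 := hbranch x hx
    rw [hprod] at h1
    have h2 := div_mul_cancel₀ (W.eval x) hx
    simp only [Polynomial.eval_mul, Polynomial.eval_sub, Polynomial.eval_add, Polynomial.eval_C,
      Polynomial.eval_X, Polynomial.eval_zero, hN x hx]
    linear_combination (R.eval x ^ (d + 2)) * h1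
      - R.eval x ^ (d + 1) * eval ![W.eval x / R.eval x, x, z] q * h2
  exact sub_eq_zero.mp ((mul_eq_zero.mp hzero).resolve_right (mul_ne_zero hN0 hR))

/-- A surface of small degree which is ruled both in the `x`- and in the `z`-direction contains the
graph of a bilinear function through each of its regular lines. -/
theorem exists_bilinear_of_doubly_ruled [Infinite K] {p : ℕ} [CharP K p]
    {F : MvPolynomial (Fin 3) K} (hp : F.totalDegree < p) (h1 : F ∣ implicitSecondDeriv 1 F)
    (h2 : F ∣ implicitSecondDeriv 2 F) {u : K × K × K} (hu : aeval (lineX u) F = 0)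
    (hreg : aeval (lineX u) (pderiv 0 F) ≠ 0) :
    ∃ l₀ l₁ : K, aeval (![C u.1 + C u.2.1 * X 1 - (C l₀ + C l₁ * X 1) * (X 2 - C u.2.2), X 1, X 2] :
      Fin 3 → MvPolynomial (Fin 3) K) F = 0 := by
  obtain ⟨a, g, ζ⟩ := u
  set R := aeval (lineX (a, g, ζ)) (pderiv 0 F) with hR
  set S := aeval (lineX (a, g, ζ)) (pderiv 2 F) with hS
  have hRev : ∀ x, R.eval x = eval ![a + g * x, x, ζ] (pderiv 0 F) := fun x => eval_aeval_lineX _ _ _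
  have hSev : ∀ x, S.eval x = eval ![a + g * x, x, ζ] (pderiv 2 F) := fun x => eval_aeval_lineX _ _ _
  have hFev : ∀ x, eval ![a + g * x, x, ζ] F = 0 := fun x => by
    have := congrArg (Polynomial.eval x) hu
    rw [eval_aeval_lineX, Polynomial.eval_zero] at this
    exact this
  have hruled : ∀ x, R.eval x ≠ 0 →
      aeval (lineZ (a + g * x - (-(S.eval x / R.eval x)) * ζ, -(S.eval x / R.eval x), x)) F = 0 := by
    intro x hx
    refine aeval_lineZ_eq_zero_of_dvd (p := p) hp h2 (hFev x) (by rwa [← hRev]) ?_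
    rw [← hRev, ← hSev]
    field_simp
    ring
  have hruled' : ∀ x, R.eval x ≠ 0 → ∀ z,
      eval ![a + g * x - S.eval x / R.eval x * (z - ζ), x, z] F = 0 := by
    intro x hx z
    have := congrArg (Polynomial.eval z) (hruled x hx)
    rw [eval_aeval_lineZ, Polynomial.eval_zero] at this
    rw [← this]
    congr 3
    ring
  obtain ⟨x₀, hx₀⟩ := exists_polynomial_eval_ne_zero hreg
  set m := S.eval x₀ / R.eval x₀ with hm
  set q := aeval (lineZ (a + g * x₀ + m * ζ, -m, x₀)) (pderiv 0 F) with hq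
  have hqev : ∀ z, q.eval z = eval ![a + g * x₀ - m * (z - ζ), x₀, z] (pderiv 0 F) := by
    intro z
    rw [hq, eval_aeval_lineZ]
    congr 3
    ring
  have hq0 : q ≠ 0 := by
    intro h0
    have := hqev ζ
    rw [h0, sub_self, mul_zero, sub_zero, ← hRev, Polynomial.eval_zero] at this
    exact hx₀ this.symm
  obtain ⟨z₁, hz₁⟩ := exists_polynomial_eval_ne_zero
    (mul_ne_zero hq0 (Polynomial.X_sub_C_ne_zero ζ))
  rw [Polynomial.eval_mul, Polynomial.eval_sub, Polynomial.eval_X, Polynomial.eval_C] at hz₁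
  have hc : z₁ - ζ ≠ 0 := right_ne_zero_of_mul hz₁
  have hqz : eval ![a + g * x₀ - m * (z₁ - ζ), x₀, z₁] (pderiv 0 F) ≠ 0 := by
    rw [← hqev]
    exact left_ne_zero_of_mul hz₁
  set y₁ := a + g * x₀ - m * (z₁ - ζ) with hy₁
  set g₁ := -(eval ![y₁, x₀, z₁] (pderiv 1 F) / eval ![y₁, x₀, z₁] (pderiv 0 F)) with hg₁
  have hlin : aeval (lineX (y₁ - g₁ * x₀, g₁, z₁)) F = 0 := by
    refine aeval_lineX_eq_zero_of_dvd (p := p) hp h1 (hruled' x₀ hx₀ z₁) hqz ?_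
    rw [hg₁]
    field_simp
    ring
  have hWev : ∀ x, R.eval x ≠ 0 → (R * (Polynomial.C a + Polynomial.C g * Polynomial.X)
      - Polynomial.C (z₁ - ζ) * S).eval x / R.eval x =
      a + g * x - S.eval x / R.eval x * (z₁ - ζ) := by
    intro x hx
    simp only [Polynomial.eval_sub, Polynomial.eval_mul, Polynomial.eval_add, Polynomial.eval_C,
      Polynomial.eval_X]
    field_simp
  have hW := linear_branch_unique (R := R)
    (W := R * (Polynomial.C a + Polynomial.C g * Polynomial.X) - Polynomial.C (z₁ - ζ) * S) hlin
    (fun x hx => by rw [hWev x hx]; exact hruled' x hx z₁) hx₀ (by rw [hWev x₀ hx₀]; ring)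
    (by rwa [sub_add_cancel])
  set a₁ := y₁ - g₁ * x₀ with ha₁
  have hSR : ∀ x, S.eval x * (z₁ - ζ) = R.eval x * (a - a₁ + (g - g₁) * x) := by
    intro x
    have := congrArg (Polynomial.eval x) hW
    simp only [Polynomial.eval_sub, Polynomial.eval_mul, Polynomial.eval_add, Polynomial.eval_C,
      Polynomial.eval_X] at this
    linear_combination -this
  refine ⟨(a - a₁) / (z₁ - ζ), (g - g₁) / (z₁ - ζ), ?_⟩
  have hRe : ∀ v, eval v (Polynomial.aeval (X 1 : MvPolynomial (Fin 3) K) R) = R.eval (v 1) :=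
    fun v => eval_aeval_X v 1 R
  have hRX : (Polynomial.aeval (X 1 : MvPolynomial (Fin 3) K) R) ≠ 0 := by
    intro h0
    have := hRe fun _ => x₀
    rw [h0, map_zero] at this
    exact hx₀ this.symm
  apply mul_left_cancel₀ hRX
  rw [mul_zero]
  apply MvPolynomial.funext
  intro v
  rw [map_mul, hRe, eval_aeval_vec3, map_zero]
  by_cases hx : R.eval (v 1) = 0
  · rw [hx, zero_mul]
  convert mul_zero _ using 2
  rw [← hruled' (v 1) hx (v 2)]
  have hmx : S.eval (v 1) / R.eval (v 1) = (a - a₁ + (g - g₁) * v 1) / (z₁ - ζ) := by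
    rw [div_eq_div_iff hx hc, hSR]
    ring
  rw [hmx]
  simp only [map_sub, map_add, map_mul, eval_C, eval_X]
  congr 3
  field_simp

end DoublyRuled

section Collinear

open MvPolynomial

variable {K : Type*} [Field K]

theorem affine_of_dvd {F : MvPolynomial (Fin 3) K} (hF : Irreducible F) {a g ζ l₀ l₁ : K}
    (h : aeval (![C a + C g * X 1 - (C l₀ + C l₁ * X 1) * (X 2 - C ζ), X 1, X 2] :
      Fin 3 → MvPolynomial (Fin 3) K) F = 0) {u : K × K × K} (hu : aeval (lineX u) F = 0) :
    u.1 = (a + l₀ * ζ) + -l₀ * u.2.2 ∧ u.2.1 = (g + l₁ * ζ) + -l₁ * u.2.2 := by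
  set L : MvPolynomial (Fin 3) K := C a + C g * X 1 - (C l₀ + C l₁ * X 1) * (X 2 - C ζ) with hL
  have hdvd := X_sub_dvd_of_aeval_eq_zero F L h
  have hunit : ¬ IsUnit (X 0 - L) := by
    intro hu
    have := hu.map (eval ![a + l₀ * ζ, 0, 0])
    rw [hL] at this
    simp at this
  have hassoc : F ∣ X 0 - L := (hF.dvd_iff.mp hdvd).resolve_left hunit |>.dvd
  obtain ⟨G, hG⟩ := hassoc
  have h0 : aeval (lineX u) (X 0 - L) = 0 := by rw [hG, map_mul, hu, zero_mul]
  have h1 : Polynomial.C (u.1 - (a + l₀ * ζ + -l₀ * u.2.2)) +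
      Polynomial.C (u.2.1 - (g + l₁ * ζ + -l₁ * u.2.2)) * Polynomial.X = 0 := by
    rw [← h0, hL]
    simp only [map_sub, map_add, map_mul, aeval_C, aeval_X, lineX, Polynomial.algebraMap_eq,
      Matrix.cons_val_zero, Matrix.cons_val_one, Matrix.cons_val, map_neg]
    ring
  have c0 := congrArg (Polynomial.coeff · 0) h1
  have c1 := congrArg (Polynomial.coeff · 1) h1
  simp only [Polynomial.coeff_add, Polynomial.coeff_C_mul, Polynomial.coeff_X_zero,
    Polynomial.coeff_X_one, Polynomial.coeff_C_zero, Polynomial.coeff_zero, mul_zero, add_zero,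
    Polynomial.coeff_C_succ, mul_one, zero_add] at c0 c1
  exact ⟨sub_eq_zero.mp c0, sub_eq_zero.mp c1⟩

/-- Two families of lines, too many to lie on the intersection of two surfaces of degrees `D` and
`3 D`, which lie on an irreducible surface of degree `D` and cannot be told apart by polynomials of
degree at most `3 D`: the first family is cut out by affine equations. -/
theorem exists_affine_of_indistinguishable [Infinite K] {p : ℕ} [CharP K p]
    {F : MvPolynomial (Fin 3) K} (hF : Irreducible F) (hp : F.totalDegree < p)
    {A B : Finset (K × K × K)} (hAi : Set.InjOn (fun u : K × K × K => u.2.2) A)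
    (hBi : Set.InjOn (fun u : K × K × K => u.2.2) B)
    (hA : ∀ u ∈ A, aeval (lineX u) F = 0) (hB : ∀ v ∈ B, aeval (lineZ v) F = 0)
    (hAB : ∀ G : MvPolynomial (Fin 3) K, G.totalDegree ≤ 3 * F.totalDegree →
      (∀ u ∈ A, aeval (lineX u) G = 0) → ∀ v ∈ B, aeval (lineZ v) G = 0)
    (hBA : ∀ G : MvPolynomial (Fin 3) K, G.totalDegree ≤ 3 * F.totalDegree →
      (∀ v ∈ B, aeval (lineZ v) G = 0) → ∀ u ∈ A, aeval (lineX u) G = 0)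
    (hcard : F.totalDegree < A.card)
    (hcard' : 12 * F.totalDegree ^ 2 < A.card ∨ 12 * F.totalDegree ^ 2 < B.card) :
    ∃ α ζ β κ : K, ∀ u ∈ A, u.1 = α + ζ * u.2.2 ∧ u.2.1 = β + κ * u.2.2 := by
  have hdvd : ∀ G : MvPolynomial (Fin 3) K, G.totalDegree ≤ 3 * F.totalDegree →
      (∀ u ∈ A, aeval (lineX u) G = 0) → F ∣ G := by
    intro G hG hGA
    by_contra hn
    have h1 := card_le_of_aeval_lineX_eq_zero hF hn le_rfl hG A hAi hA hGA
    have h2 := card_le_of_aeval_lineZ_eq_zero hF hn le_rfl hG B hBi hB (hAB G hG hGA)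
    omega
  have h1 : F ∣ implicitSecondDeriv 1 F :=
    hdvd _ (totalDegree_implicitSecondDeriv_le 1 F) fun u hu =>
      aeval_lineX_implicitSecondDeriv_eq_zero (hA u hu)
  have h2 : F ∣ implicitSecondDeriv 2 F :=
    hdvd _ (totalDegree_implicitSecondDeriv_le 2 F) <|
      hBA _ (totalDegree_implicitSecondDeriv_le 2 F) fun v hv =>
        aeval_lineZ_implicitSecondDeriv_eq_zero (hB v hv)
  have hy : pderiv 0 F ≠ 0 := by
    classical
    intro h0
    obtain ⟨P, hP, hdeg, hvan⟩ := exists_eliminant_of_natDegree_eq_zero hF.ne_zero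
      (natDegree_finSuccEquiv_eq_zero_of_pderiv_eq_zero (p := p) hp h0)
    have := card_le_totalDegree_of_aeval_C_X hP (A.image fun u => u.2.2) fun w hw => by
      obtain ⟨u, hu, rfl⟩ := Finset.mem_image.mp hw
      exact hvan _ _ _ (hA u hu)
    rw [Finset.card_image_of_injOn hAi] at this
    omega
  obtain ⟨u, huA, hu⟩ : ∃ u ∈ A, aeval (lineX u) (pderiv 0 F) ≠ 0 := by
    by_contra! hall
    obtain ⟨G, hG⟩ := hdvd _ ((totalDegree_pderiv_le 0 F).trans (by omega)) hall
    have hG0 : G ≠ 0 := by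
      rintro rfl
      exact hy (by rw [hG, mul_zero])
    have h3 := totalDegree_pderiv_add_one_le 0 F hy
    rw [hG, totalDegree_mul_of_isDomain hF.ne_zero hG0] at h3
    omega
  obtain ⟨l₀, l₁, hl⟩ := exists_bilinear_of_doubly_ruled (p := p) hp h1 h2 (hA u huA) hu
  exact ⟨_, _, _, _, fun v hv => affine_of_dvd hF hl (hA v hv)⟩

end Collinear

section Siegel

open MvPolynomial

variable {K : Type*} [Field K]

theorem exists_mvPolynomial_vanishing (e : ℕ) (S : Finset (Fin 3 → K)) (hS : S.card < (e + 1) ^ 3) :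
    ∃ F : MvPolynomial (Fin 3) K, F ≠ 0 ∧ F.totalDegree ≤ 3 * e ∧ ∀ v ∈ S, eval v F = 0 := by
  classical
  let ex : (Fin 3 → Fin (e + 1)) → (Fin 3 →₀ ℕ) := fun d =>
    Finsupp.equivFunOnFinite.symm fun i => (d i : ℕ)
  have hex : Function.Injective ex := by
    intro d d' h
    funext i
    have := DFunLike.congr_fun h i
    exact Fin.ext this
  let P : ((Fin 3 → Fin (e + 1)) → K) →ₗ[K] MvPolynomial (Fin 3) K :=
    Fintype.linearCombination K fun d => monomial (ex d) 1
  have hP : ∀ c, P c = ∑ d, monomial (ex d) (c d) := by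
    intro c
    simp [P, Fintype.linearCombination_apply, smul_monomial]
  let E : ((Fin 3 → Fin (e + 1)) → K) →ₗ[K] (S → K) :=
    (LinearMap.pi fun v : S => (aeval (v : Fin 3 → K)).toLinearMap) ∘ₗ P
  have hker : LinearMap.ker E ≠ ⊥ := by
    apply LinearMap.ker_ne_bot_of_finrank_lt
    simpa using hS
  obtain ⟨c, hc, hc0⟩ := (Submodule.ne_bot_iff _).mp hker
  have hcoeff : ∀ d, coeff (ex d) (P c) = c d := by
    intro d
    rw [hP, coeff_sum, Finset.sum_eq_single d]
    · simp
    · intro b _ hb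
      rw [coeff_monomial, if_neg fun h => hb (hex h)]
    · simp
  refine ⟨P c, ?_, ?_, fun v hv => ?_⟩
  · intro h
    apply hc0
    funext d
    rw [← hcoeff d, h, coeff_zero, Pi.zero_apply]
  · rw [hP]
    refine totalDegree_finsetSum_le fun d _ => (totalDegree_monomial_le _ _).trans ?_
    rw [Finsupp.sum_fintype _ _ fun _ => rfl, Fin.sum_univ_three]
    have h0 := (d 0).2
    have h1 := (d 1).2
    have h2 := (d 2).2
    simp only [ex, Finsupp.equivFunOnFinite_symm_apply_apply, id_eq]
    omega
  · have := congrFun (LinearMap.mem_ker.mp hc) ⟨v, hv⟩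
    simpa [E, aeval_eq_eval] using this

end Siegel

section Sampling

/-- Derandomised second moment bound for a random subset with density `q`. -/
theorem exists_subset_second_moment_le {ι β : Type*} [DecidableEq β] (A : Finset ι) (B : Finset β)
    (N : ι → β → Prop) [∀ i b, Decidable (N i b)] (w : ι → ℝ) (a q : ℝ) (hq0 : 0 ≤ q) (hq1 : q ≤ 1)
    (s : ι → ℝ) :
    ∃ T ⊆ B, a * (T.card : ℝ) + ∑ i ∈ A, w i * (s i + q * ((B.filter (N i)).card : ℝ)
        - ((T.filter (N i)).card : ℝ)) ^ 2 ≤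
      a * q * (B.card : ℝ) + ∑ i ∈ A, w i * (s i ^ 2 + q * (1 - q) * ((B.filter (N i)).card : ℝ)) := by
  induction B using Finset.induction_on generalizing s with
  | empty => exact ⟨∅, subset_rfl, by simp⟩
  | insert b B hb ih =>
    have hcard : ∀ (S : Finset β), b ∉ S → ∀ i, (((insert b S).filter (N i)).card : ℝ) =
        ((S.filter (N i)).card : ℝ) + if N i b then 1 else 0 := by
      intro S hS i
      rw [Finset.filter_insert]
      split_ifs
      · rw [Finset.card_insert_of_notMem (fun h => hS (Finset.mem_filter.mp h).1)]
        push_cast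
        rfl
      · simp
    obtain ⟨T₁, hT₁, h₁⟩ := ih fun i => s i + (q - 1) * if N i b then 1 else 0
    obtain ⟨T₂, hT₂, h₂⟩ := ih fun i => s i + q * if N i b then 1 else 0
    have hbT₁ : b ∉ T₁ := fun h => hb (hT₁ h)
    set R₁ := a * q * (B.card : ℝ) + ∑ i ∈ A, w i * ((s i + (q - 1) * if N i b then 1 else 0) ^ 2 +
      q * (1 - q) * ((B.filter (N i)).card : ℝ)) with hR₁
    set R₂ := a * q * (B.card : ℝ) + ∑ i ∈ A, w i * ((s i + q * if N i b then 1 else 0) ^ 2 +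
      q * (1 - q) * ((B.filter (N i)).card : ℝ)) with hR₂
    set R := a * q * ((insert b B).card : ℝ) + ∑ i ∈ A, w i * (s i ^ 2 +
      q * (1 - q) * (((insert b B).filter (N i)).card : ℝ)) with hR
    have havg : R = q * (R₁ + a) + (1 - q) * R₂ := by
      have : ∑ i ∈ A, w i * (s i ^ 2 + q * (1 - q) * (((insert b B).filter (N i)).card : ℝ)) =
          q * ∑ i ∈ A, w i * ((s i + (q - 1) * if N i b then 1 else 0) ^ 2 +
            q * (1 - q) * ((B.filter (N i)).card : ℝ)) +
          (1 - q) * ∑ i ∈ A, w i * ((s i + q * if N i b then 1 else 0) ^ 2 +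
            q * (1 - q) * ((B.filter (N i)).card : ℝ)) := by
        rw [Finset.mul_sum, Finset.mul_sum, ← Finset.sum_add_distrib]
        refine Finset.sum_congr rfl fun i _ => ?_
        rw [hcard B hb]
        split_ifs <;> ring
      rw [hR, this, hR₁, hR₂, Finset.card_insert_of_notMem hb]
      push_cast
      ring
    by_cases hcase : R₁ + a ≤ R
    · refine ⟨insert b T₁, Finset.insert_subset_insert b hT₁, le_trans ?_ hcase⟩
      rw [Finset.card_insert_of_notMem hbT₁]
      refine le_trans (le_of_eq ?_) (add_le_add_left h₁ a)
      have : ∀ i ∈ A, w i * (s i + q * (((insert b B).filter (N i)).card : ℝ)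
          - (((insert b T₁).filter (N i)).card : ℝ)) ^ 2 =
          w i * (s i + (q - 1) * (if N i b then 1 else 0) + q * ((B.filter (N i)).card : ℝ)
          - ((T₁.filter (N i)).card : ℝ)) ^ 2 := by
        intro i _
        rw [hcard B hb, hcard T₁ hbT₁]
        ring
      rw [Finset.sum_congr rfl this]
      push_cast
      ring
    · have hR₂R : R₂ ≤ R := by
        by_contra hlt
        push Not at hcase hlt
        rcases hq0.eq_or_lt with h0 | h0
        · rw [← h0] at havg
          linarith
        · nlinarith [mul_lt_mul_of_pos_left hcase h0,
            mul_le_mul_of_nonneg_left hlt.le (sub_nonneg.mpr hq1)]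
      refine ⟨T₂, hT₂.trans (Finset.subset_insert b B), le_trans ?_ hR₂R⟩
      refine le_trans (le_of_eq ?_) h₂
      congr 1
      refine Finset.sum_congr rfl fun i _ => ?_
      rw [hcard B hb]
      ring

end Sampling

section Incidences

open MvPolynomial

variable {K : Type*} [Field K]

/-- The lines `lineX u` and `lineZ v` meet. -/
def Incident (u v : K × K × K) : Prop := u.1 + u.2.1 * v.2.2 = v.1 + v.2.1 * u.2.2

theorem incident_comm {u v : K × K × K} : Incident u v ↔ Incident v u := eq_comm

theorem aeval_lineX_eq_zero_of_card {u : K × K × K} {F : MvPolynomial (Fin 3) K} (S : Finset K)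
    (hS : F.totalDegree < S.card) (h : ∀ t ∈ S, eval ![u.1 + u.2.1 * t, t, u.2.2] F = 0) :
    aeval (lineX u) F = 0 := by
  refine Polynomial.eq_zero_of_natDegree_lt_card_of_eval_eq_zero' _ S (fun t ht => ?_)
    ((natDegree_aeval_le _ (lineX_natDegree_le u) F).trans_lt hS)
  rw [eval_aeval_lineX]
  exact h t ht

theorem aeval_lineZ_eq_zero_of_card {u : K × K × K} {F : MvPolynomial (Fin 3) K} (S : Finset K)
    (hS : F.totalDegree < S.card) (h : ∀ t ∈ S, eval ![u.1 + u.2.1 * t, u.2.2, t] F = 0) :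
    aeval (lineZ u) F = 0 := by
  refine Polynomial.eq_zero_of_natDegree_lt_card_of_eval_eq_zero' _ S (fun t ht => ?_)
    ((natDegree_aeval_le _ (lineZ_natDegree_le u) F).trans_lt hS)
  rw [eval_aeval_lineZ]
  exact h t ht

theorem eval_eq_zero_of_incident_lineZ {u v : K × K × K} (h : Incident u v)
    {F : MvPolynomial (Fin 3) K} (hv : aeval (lineZ v) F = 0) :
    eval ![u.1 + u.2.1 * v.2.2, v.2.2, u.2.2] F = 0 := by
  have := eval_aeval_lineZ v u.2.2 F
  rw [hv, Polynomial.eval_zero] at this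
  rw [show u.1 + u.2.1 * v.2.2 = v.1 + v.2.1 * u.2.2 from h, ← this]

theorem eval_eq_zero_of_incident_lineX {u v : K × K × K} (h : Incident u v)
    {F : MvPolynomial (Fin 3) K} (hu : aeval (lineX u) F = 0) :
    eval ![v.1 + v.2.1 * u.2.2, v.2.2, u.2.2] F = 0 := by
  have := eval_aeval_lineX u v.2.2 F
  rw [hu, Polynomial.eval_zero] at this
  rw [← show u.1 + u.2.1 * v.2.2 = v.1 + v.2.1 * u.2.2 from h, ← this]

variable [DecidableEq K]

instance (u v : K × K × K) : Decidable (Incident u v) :=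
  inferInstanceAs (Decidable (u.1 + u.2.1 * v.2.2 = v.1 + v.2.1 * u.2.2))

theorem aeval_lineX_eq_zero_of_rich {B : Finset (K × K × K)}
    (hB : Set.InjOn (fun v : K × K × K => v.2.2) B) {u : K × K × K} {F : MvPolynomial (Fin 3) K}
    (hF : F.totalDegree < (B.filter (Incident u)).card) (h : ∀ v ∈ B, aeval (lineZ v) F = 0) :
    aeval (lineX u) F = 0 := by
  refine aeval_lineX_eq_zero_of_card ((B.filter (Incident u)).image fun v => v.2.2) ?_ ?_
  · rwa [Finset.card_image_of_injOn (hB.mono (Finset.coe_subset.mpr (Finset.filter_subset _ _)))]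
  · intro t ht
    obtain ⟨v, hv, rfl⟩ := Finset.mem_image.mp ht
    rw [Finset.mem_filter] at hv
    exact eval_eq_zero_of_incident_lineZ hv.2 (h v hv.1)

theorem aeval_lineZ_eq_zero_of_rich {A : Finset (K × K × K)}
    (hA : Set.InjOn (fun v : K × K × K => v.2.2) A) {v : K × K × K} {F : MvPolynomial (Fin 3) K}
    (hF : F.totalDegree < (A.filter (Incident v)).card) (h : ∀ u ∈ A, aeval (lineX u) F = 0) :
    aeval (lineZ v) F = 0 := by
  refine aeval_lineZ_eq_zero_of_card ((A.filter (Incident v)).image fun v => v.2.2) ?_ ?_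
  · rwa [Finset.card_image_of_injOn (hA.mono (Finset.coe_subset.mpr (Finset.filter_subset _ _)))]
  · intro t ht
    obtain ⟨u, hu, rfl⟩ := Finset.mem_image.mp ht
    rw [Finset.mem_filter] at hu
    exact eval_eq_zero_of_incident_lineX (incident_comm.mp hu.2) (h u hu.1)

theorem sub_le_sq_div {x a t : ℝ} (ha : 0 < a) (hx : 2 * a ≤ x) : a - t ≤ 1 / (2 * x) * (x - t) ^ 2 := by
  have hx0 : 0 < 2 * x := by linarith
  rw [one_div, ← div_eq_inv_mul, le_div_iff₀ hx0]
  nlinarith [sq_nonneg t]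

theorem exists_low_degree_vanishing_of_card_le [Infinite K] {A B : Finset (K × K × K)}
    (hAi : Set.InjOn (fun v : K × K × K => v.2.2) A) (hBi : Set.InjOn (fun v : K × K × K => v.2.2) B)
    {e M : ℕ} (hM : 4356 * (e + 1) ≤ M) (hBA : B.card ≤ A.card) (hAe : A.card < 121 * (e + 1) ^ 2)
    (he : 121 ≤ e + 1) (hA : ∀ u ∈ A, M ≤ (B.filter (Incident u)).card)
    (hB : ∀ v ∈ B, M ≤ (A.filter (Incident v)).card) :
    ∃ F : MvPolynomial (Fin 3) K, F ≠ 0 ∧ F.totalDegree ≤ 3 * e ∧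
      (∀ u ∈ A, aeval (lineX u) F = 0) ∧ ∀ v ∈ B, aeval (lineZ v) F = 0 := by
  have hM0 : (0 : ℝ) < M := by
    have : 0 < M := by omega
    exact_mod_cast this
  have hMr : (4356 : ℝ) * (e + 1) ≤ M := by exact_mod_cast hM
  set a : ℕ := 3 * e + 1 with ha
  have har : (a : ℝ) = 3 * e + 1 := by rw [ha]; push_cast; ring
  have ha0 : (0 : ℝ) < a := by rw [har]; positivity
  have her : (121 : ℝ) ≤ e + 1 := by exact_mod_cast he
  set q : ℝ := 2 * a / M with hq
  have hq0 : 0 < q := by positivity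
  have hq1 : q ≤ 1 := by
    rw [hq, div_le_one hM0, har]
    linarith
  have hd : ∀ u ∈ A, 2 * (a : ℝ) ≤ q * ((B.filter (Incident u)).card : ℝ) := by
    intro u hu
    have : (M : ℝ) ≤ ((B.filter (Incident u)).card : ℝ) := by exact_mod_cast hA u hu
    calc 2 * (a : ℝ) = q * M := by rw [hq]; field_simp
      _ ≤ _ := mul_le_mul_of_nonneg_left this hq0.le
  obtain ⟨T, hTB, hT⟩ := exists_subset_second_moment_le A B Incident
    (fun u => 1 / (2 * (q * ((B.filter (Incident u)).card : ℝ)))) a q hq0.le hq1 fun _ => 0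
  have hex : ∀ u : K × K × K, ∃ X : Finset K, X.card ≤ a - (T.filter (Incident u)).card ∧
      a ≤ (X ∪ (T.filter (Incident u)).image fun v => v.2.2).card := by
    intro u
    have hc : ((T.filter (Incident u)).image fun v => v.2.2).card = (T.filter (Incident u)).card :=
      Finset.card_image_of_injOn (hBi.mono fun v hv => hTB (Finset.mem_filter.mp hv).1)
    rcases le_total a (T.filter (Incident u)).card with h | h
    · exact ⟨∅, by simp, by rwa [Finset.empty_union, hc]⟩
    · obtain ⟨P, hP, hPc⟩ := Infinite.exists_superset_card_eq
        ((T.filter (Incident u)).image fun v => v.2.2) a (by rwa [hc])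
      refine ⟨P \ (T.filter (Incident u)).image fun v => v.2.2, ?_, ?_⟩
      · rw [Finset.card_sdiff_of_subset hP, hc, hPc]
      · rw [Finset.sdiff_union_of_subset hP, hPc]
  choose X hXc hX using hex
  obtain ⟨Y, hY⟩ := Infinite.exists_subset_card_eq K a
  set S : Finset (Fin 3 → K) :=
    (T ×ˢ Y).image (fun x => ![x.1.1 + x.1.2.1 * x.2, x.1.2.2, x.2]) ∪
      A.biUnion fun u => (X u).image fun t => ![u.1 + u.2.1 * t, t, u.2.2] with hS
  have hScard : S.card ≤ a * T.card + ∑ u ∈ A, (a - (T.filter (Incident u)).card) := by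
    refine (Finset.card_union_le _ _).trans (add_le_add ?_ ?_)
    · refine Finset.card_image_le.trans ?_
      rw [Finset.card_product, hY, mul_comm]
    · refine Finset.card_biUnion_le.trans (Finset.sum_le_sum fun u _ => ?_)
      exact Finset.card_image_le.trans (hXc u)
  have hSlt : S.card < (e + 1) ^ 3 := by
    have h1 : (S.card : ℝ) ≤ a * q * B.card + A.card / 2 := by
      calc (S.card : ℝ) ≤ a * T.card + ∑ u ∈ A, ((a - (T.filter (Incident u)).card : ℕ) : ℝ) := by
            exact_mod_cast hScard
        _ ≤ _ := add_le_add le_rfl (Finset.sum_le_sum fun u hu => ?_)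
        _ ≤ _ := hT
        _ ≤ _ := add_le_add le_rfl ?_
      · rcases le_total a (T.filter (Incident u)).card with h | h
        · rw [Nat.sub_eq_zero_of_le h, Nat.cast_zero]
          positivity
        · rw [Nat.cast_sub h, zero_add]
          exact sub_le_sq_div ha0 (hd u hu)
      · rw [div_eq_mul_one_div, ← nsmul_eq_mul]
        refine Finset.sum_le_card_nsmul _ _ _ fun u hu => ?_
        have hpos := lt_of_lt_of_le (by positivity) (hd u hu)
        have hne := hpos.ne'
        rw [show (1 : ℝ) / (2 * (q * ((B.filter (Incident u)).card : ℝ))) * (0 ^ 2 + q * (1 - q) *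
          ((B.filter (Incident u)).card : ℝ)) = (1 - q) / 2 * ((q * ((B.filter (Incident u)).card : ℝ)) /
            (q * ((B.filter (Incident u)).card : ℝ))) by ring, div_self hne]
        linarith
    have hBr : (B.card : ℝ) ≤ 121 * (e + 1) ^ 2 := by exact_mod_cast hBA.trans hAe.le
    have hAr : (A.card : ℝ) < 121 * (e + 1) ^ 2 := by exact_mod_cast hAe
    have h2 : a * q * B.card ≤ ((e : ℝ) + 1) ^ 3 / 2 := by
      rw [hq, show a * (2 * a / M) * (B.card : ℝ) = 2 * (a * a) * B.card / M by ring, div_le_iff₀ hM0]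
      have haa : (a : ℝ) ≤ 3 * (e + 1) := by rw [har]; linarith
      calc 2 * ((a : ℝ) * a) * B.card ≤ 2 * ((3 * (e + 1)) * (3 * (e + 1))) * (121 * (e + 1) ^ 2) := by
            gcongr
        _ = ((e : ℝ) + 1) ^ 3 / 2 * (4356 * (e + 1)) := by ring
        _ ≤ _ := by gcongr
    have h3 : (121 : ℝ) * (e + 1) ^ 2 ≤ (e + 1) ^ 3 := by
      rw [pow_succ _ 2, mul_comm]
      gcongr
    have : (S.card : ℝ) < (e + 1) ^ 3 := by linarith
    exact_mod_cast this
  obtain ⟨F, hF0, hFd, hF⟩ := exists_mvPolynomial_vanishing e S hSlt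
  have hFT : ∀ v ∈ T, aeval (lineZ v) F = 0 := fun v hv =>
    aeval_lineZ_eq_zero_of_card Y (by omega) fun t ht => hF _ <| Finset.mem_union_left _ <|
      Finset.mem_image.mpr ⟨(v, t), Finset.mem_product.mpr ⟨hv, ht⟩, rfl⟩
  have hFA : ∀ u ∈ A, aeval (lineX u) F = 0 := by
    intro u hu
    refine aeval_lineX_eq_zero_of_card _ (lt_of_lt_of_le (by omega) (hX u)) fun t ht => ?_
    rcases Finset.mem_union.mp ht with h | h
    · exact hF _ <| Finset.mem_union_right _ <| Finset.mem_biUnion.mpr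
        ⟨u, hu, Finset.mem_image_of_mem _ h⟩
    · obtain ⟨v, hv, rfl⟩ := Finset.mem_image.mp h
      rw [Finset.mem_filter] at hv
      exact eval_eq_zero_of_incident_lineZ hv.2 (hFT v hv.1)
  exact ⟨F, hF0, hFd, hFA, fun v hv => aeval_lineZ_eq_zero_of_rich hAi
    (lt_of_lt_of_le (by omega) (hB v hv)) hFA⟩

theorem exists_low_degree_vanishing [Infinite K] {A B : Finset (K × K × K)}
    (hAi : Set.InjOn (fun v : K × K × K => v.2.2) A) (hBi : Set.InjOn (fun v : K × K × K => v.2.2) B)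
    {e M : ℕ} (hM : 4356 * (e + 1) ≤ M) (hAe : max A.card B.card < 121 * (e + 1) ^ 2)
    (he : 121 ≤ e + 1) (hA : ∀ u ∈ A, M ≤ (B.filter (Incident u)).card)
    (hB : ∀ v ∈ B, M ≤ (A.filter (Incident v)).card) :
    ∃ F : MvPolynomial (Fin 3) K, F ≠ 0 ∧ F.totalDegree ≤ 3 * e ∧
      (∀ u ∈ A, aeval (lineX u) F = 0) ∧ ∀ v ∈ B, aeval (lineZ v) F = 0 := by
  rw [max_lt_iff] at hAe
  rcases le_total B.card A.card with h | h
  · exact exists_low_degree_vanishing_of_card_le hAi hBi hM h hAe.1 he hA hB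
  · obtain ⟨F, hF0, hFd, hFB, hFA⟩ :=
      exists_low_degree_vanishing_of_card_le hBi hAi hM h hAe.2 he hB hA
    refine ⟨swapXZ F, by simpa using hF0, by rwa [totalDegree_swapXZ], fun u hu => ?_, fun v hv => ?_⟩
    · rw [aeval_lineX_swapXZ, hFA u hu]
    · rw [aeval_lineZ_swapXZ, hFB v hv]

end Incidences

section IncidenceBound

open MvPolynomial

variable {K : Type*} [Field K]

theorem totalDegree_pos_of_not_isUnit {σ : Type*} {F : MvPolynomial σ K} (hF : F ≠ 0) (hu : ¬ IsUnit F) :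
    0 < F.totalDegree := by
  rw [Nat.pos_iff_ne_zero]
  intro h
  rw [totalDegree_eq_zero_iff_eq_C] at h
  apply hu
  rw [h] at hF ⊢
  exact (isUnit_iff_ne_zero.mpr fun h0 => hF (by rw [h0, C_0])).map C

theorem exists_scale {N : ℕ} (hN : 121 ^ 3 ≤ N) :
    ∃ e : ℕ, 121 ≤ e + 1 ∧ 121 * e ^ 2 ≤ N ∧ N < 121 * (e + 1) ^ 2 ∧ 11 * e ≤ N.sqrt := by
  have h1331 : 1331 ≤ N.sqrt := by
    rw [Nat.le_sqrt]
    omega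
  have h1 : 11 * (N.sqrt / 11) ≤ N.sqrt := Nat.mul_div_le _ _
  have h2 : N.sqrt + 1 ≤ 11 * (N.sqrt / 11 + 1) := by omega
  refine ⟨N.sqrt / 11, by omega, ?_, ?_, h1⟩
  · calc 121 * (N.sqrt / 11) ^ 2 = 11 * (N.sqrt / 11) * (11 * (N.sqrt / 11)) := by ring
      _ ≤ N.sqrt * N.sqrt := Nat.mul_le_mul h1 h1
      _ ≤ N := Nat.sqrt_le N
  · calc N < (N.sqrt + 1) * (N.sqrt + 1) := Nat.lt_succ_sqrt N
      _ ≤ 11 * (N.sqrt / 11 + 1) * (11 * (N.sqrt / 11 + 1)) := Nat.mul_le_mul h2 h2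
      _ = _ := by ring

variable [DecidableEq K]

/-- The number of incident pairs between two families of lines. -/
def incidences (A B : Finset (K × K × K)) : ℕ := ∑ u ∈ A, (B.filter (Incident u)).card

theorem incidences_comm (A B : Finset (K × K × K)) : incidences A B = incidences B A := by
  have h := Finset.sum_card_bipartiteAbove_eq_sum_card_bipartiteBelow (s := A) (t := B) Incident
  unfold Finset.bipartiteAbove Finset.bipartiteBelow at h
  unfold incidences
  rw [h]
  refine Finset.sum_congr rfl fun v _ => congrArg _ (Finset.filter_congr fun u _ => incident_comm)

theorem incidences_eq_add_left (A B : Finset (K × K × K)) (P : K × K × K → Prop) [DecidablePred P] :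
    incidences A B = incidences (A.filter P) B + incidences (A.filter fun u => ¬ P u) B :=
  (Finset.sum_filter_add_sum_filter_not A P _).symm

theorem incidences_eq_add_right (A B : Finset (K × K × K)) (P : K × K × K → Prop) [DecidablePred P] :
    incidences A B = incidences A (B.filter P) + incidences A (B.filter fun u => ¬ P u) := by
  rw [incidences_comm, incidences_eq_add_left B A P, incidences_comm A, incidences_comm A]

theorem incidences_le_left {A B : Finset (K × K × K)} {D : ℕ}
    (h : ∀ u ∈ A, (B.filter (Incident u)).card ≤ D) : incidences A B ≤ D * A.card := by
  refine (Finset.sum_le_card_nsmul A _ D h).trans ?_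
  rw [smul_eq_mul, mul_comm]

theorem incidences_le_right {A B : Finset (K × K × K)} {D : ℕ}
    (h : ∀ v ∈ B, (A.filter (Incident v)).card ≤ D) : incidences A B ≤ D * B.card := by
  rw [incidences_comm]
  exact incidences_le_left h

theorem incidences_erase_add {A B : Finset (K × K × K)} {u : K × K × K} (hu : u ∈ A) :
    incidences A B = incidences (A.erase u) B + (B.filter (Incident u)).card :=
  (Finset.sum_erase_add A _ hu).symm

/-- Incidence bound for two families contained in the zero set of a polynomial of degree `D`. -/
theorem incidences_le_of_vanishing [Infinite K] {p : ℕ} [CharP K p] {L₁ L₂ : Finset (K × K × K)}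
    (hi₁ : Set.InjOn (fun v : K × K × K => v.2.2) L₁) (hi₂ : Set.InjOn (fun v : K × K × K => v.2.2) L₂)
    {n k : ℕ} (hn₁ : L₁.card ≤ n) (hn₂ : L₂.card ≤ n) (hnp : n < p ^ 2)
    (hk : ∀ α ζ β κ : K,
      (L₁.filter fun u => u.1 = α + ζ * u.2.2 ∧ u.2.1 = β + κ * u.2.2).card ≤ k)
    (D m : ℕ) (F : MvPolynomial (Fin 3) K) (hF0 : F ≠ 0) (hFD : F.totalDegree = D)
    (A B : Finset (K × K × K)) (hAL : A ⊆ L₁) (hBL : B ⊆ L₂) (hm : A.card + B.card = m)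
    (hA : ∀ u ∈ A, aeval (lineX u) F = 0) (hB : ∀ v ∈ B, aeval (lineZ v) F = 0) :
    incidences A B ≤ (400 * (n.sqrt + 1) + k + 121 ^ 3 + D) * (A.card + B.card) := by
  induction D using Nat.strong_induction_on generalizing m F A B with
  | _ D ihD =>
  induction m using Nat.strong_induction_on generalizing A B with
  | _ m ihm =>
  set M₀ := 400 * (n.sqrt + 1) + k + 121 ^ 3 with hM₀
  by_cases hrA : ∃ u ∈ A, (B.filter (Incident u)).card ≤ M₀ + D
  · obtain ⟨u, hu, hur⟩ := hrA
    have hc := Finset.card_erase_add_one hu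
    have := ihm (m - 1) (by omega) (A.erase u) B ((Finset.erase_subset _ _).trans hAL) hBL (by omega)
      (fun x hx => hA x (Finset.mem_of_mem_erase hx)) hB
    rw [incidences_erase_add hu, ← hc]
    linarith
  by_cases hrB : ∃ v ∈ B, (A.filter (Incident v)).card ≤ M₀ + D
  · obtain ⟨v, hv, hvr⟩ := hrB
    have hc := Finset.card_erase_add_one hv
    have := ihm (m - 1) (by omega) A (B.erase v) hAL ((Finset.erase_subset _ _).trans hBL) (by omega)
      hA (fun x hx => hB x (Finset.mem_of_mem_erase hx))
    rw [incidences_comm, incidences_erase_add hv, incidences_comm, ← hc]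
    linarith
  push Not at hrA hrB
  by_cases hmin : ∃ F' : MvPolynomial (Fin 3) K, F' ≠ 0 ∧ F'.totalDegree < D ∧
      (∀ u ∈ A, aeval (lineX u) F' = 0) ∧ ∀ v ∈ B, aeval (lineZ v) F' = 0
  · obtain ⟨F', hF'0, hF'D, hA', hB'⟩ := hmin
    refine (ihD _ hF'D m F' hF'0 rfl A B hAL hBL hm hA' hB').trans ?_
    gcongr
  push Not at hmin
  rcases A.eq_empty_or_nonempty with rfl | ⟨u₀, hu₀⟩
  · simp [incidences]
  obtain ⟨v₀, hv₀⟩ : (B.filter (Incident u₀)).Nonempty :=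
    Finset.card_pos.mp (lt_of_le_of_lt (Nat.zero_le _) (hrA u₀ hu₀))
  have hv₀B := (Finset.mem_filter.mp hv₀).1
  have hAcard : M₀ + D < A.card := (hrB v₀ hv₀B).trans_le (Finset.card_filter_le _ _)
  have hnu : ¬ IsUnit F := fun hu => (hA u₀ hu₀ ▸ hu.map (aeval (lineX u₀))).ne_zero rfl
  by_cases hirr : Irreducible F
  · exfalso
    set N := max A.card B.card with hN
    have hNn : N ≤ n := max_le ((Finset.card_le_card hAL).trans hn₁) ((Finset.card_le_card hBL).trans hn₂)
    have hsn : N.sqrt ≤ n.sqrt := Nat.sqrt_le_sqrt hNn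
    have hNA : A.card ≤ N := le_max_left _ _
    obtain ⟨e, he, hNe, hNe', he1⟩ := exists_scale (N := N) (by omega)
    obtain ⟨F', hF'0, hF'd, hA', hB'⟩ := exists_low_degree_vanishing (hi₁.mono hAL) (hi₂.mono hBL)
      (e := e) (M := M₀ + D) (by omega) hNe' he (fun u hu => (hrA u hu).le)
      fun v hv => (hrB v hv).le
    have hDe : D ≤ 3 * e := by
      by_contra hlt
      obtain ⟨v, hv, hvne⟩ := hmin F' hF'0 (by omega) hA'
      exact hvne (hB' v hv)
    have hsp : n.sqrt < p := by
      rw [Nat.sqrt_lt']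
      exact hnp
    have h12 : 12 * F.totalDegree ^ 2 < N := by
      rw [hFD]
      have he0 : 0 < e ^ 2 := pow_pos (by omega) 2
      have : D ^ 2 ≤ (3 * e) ^ 2 := Nat.pow_le_pow_left hDe 2
      rw [mul_pow] at this
      omega
    obtain ⟨α, ζ, β, κ, h⟩ := exists_affine_of_indistinguishable hirr (p := p) (by omega)
      (hi₁.mono hAL) (hi₂.mono hBL) hA hB
      (fun G hG hGA v hv => aeval_lineZ_eq_zero_of_rich (hi₁.mono hAL)
        (lt_of_le_of_lt (by omega) (hrB v hv)) hGA)
      (fun G hG hGB u hu => aeval_lineX_eq_zero_of_rich (hi₂.mono hBL)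
        (lt_of_le_of_lt (by omega) (hrA u hu)) hGB)
      (by omega) (lt_max_iff.mp h12)
    have : A.card ≤ k := (Finset.card_le_card fun u hu =>
      Finset.mem_filter.mpr ⟨hAL hu, h u hu⟩).trans (hk α ζ β κ)
    omega
  · rw [irreducible_iff] at hirr
    push Not at hirr
    obtain ⟨F₁, F₂, hF, hu₁, hu₂⟩ := hirr hnu
    have hF₁0 : F₁ ≠ 0 := fun h => hF0 (by rw [hF, h, zero_mul])
    have hF₂0 : F₂ ≠ 0 := fun h => hF0 (by rw [hF, h, mul_zero])
    have hd : F₁.totalDegree + F₂.totalDegree = D := by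
      rw [← hFD, hF, totalDegree_mul_of_isDomain hF₁0 hF₂0]
    have hd₁ := totalDegree_pos_of_not_isUnit hF₁0 hu₁
    have hd₂ := totalDegree_pos_of_not_isUnit hF₂0 hu₂
    classical
    set A₁ := A.filter fun u => aeval (lineX u) F₁ = 0 with hA₁
    set A₂ := A.filter fun u => ¬ aeval (lineX u) F₁ = 0 with hA₂
    set B₁ := B.filter fun u => aeval (lineZ u) F₁ = 0 with hB₁
    set B₂ := B.filter fun u => ¬ aeval (lineZ u) F₁ = 0 with hB₂
    have hAc : A₁.card + A₂.card = A.card := Finset.card_filter_add_card_filter_not _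
    have hBc : B₁.card + B₂.card = B.card := Finset.card_filter_add_card_filter_not _
    have hA₁L : A₁ ⊆ L₁ := (Finset.filter_subset _ _).trans hAL
    have hA₂L : A₂ ⊆ L₁ := (Finset.filter_subset _ _).trans hAL
    have hB₁L : B₁ ⊆ L₂ := (Finset.filter_subset _ _).trans hBL
    have hB₂L : B₂ ⊆ L₂ := (Finset.filter_subset _ _).trans hBL
    have hA₁F : ∀ u ∈ A₁, aeval (lineX u) F₁ = 0 := fun u hu => (Finset.mem_filter.mp hu).2
    have hB₁F : ∀ u ∈ B₁, aeval (lineZ u) F₁ = 0 := fun u hu => (Finset.mem_filter.mp hu).2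
    have hA₂F : ∀ u ∈ A₂, aeval (lineX u) F₂ = 0 := by
      intro u hu
      have h := Finset.mem_filter.mp hu
      have := hA u h.1
      rw [hF, map_mul] at this
      exact (mul_eq_zero.mp this).resolve_left h.2
    have hB₂F : ∀ u ∈ B₂, aeval (lineZ u) F₂ = 0 := by
      intro u hu
      have h := Finset.mem_filter.mp hu
      have := hB u h.1
      rw [hF, map_mul] at this
      exact (mul_eq_zero.mp this).resolve_left h.2
    have h11 := ihD F₁.totalDegree (by omega) _ F₁ hF₁0 rfl A₁ B₁ hA₁L hB₁L rfl hA₁F hB₁F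
    have h22 := ihD F₂.totalDegree (by omega) _ F₂ hF₂0 rfl A₂ B₂ hA₂L hB₂L rfl hA₂F hB₂F
    have h21 : incidences A₂ B₁ ≤ F₁.totalDegree * A₂.card := by
      refine incidences_le_left fun u hu => ?_
      by_contra! hlt
      exact (Finset.mem_filter.mp hu).2 (aeval_lineX_eq_zero_of_rich (hi₂.mono hB₁L) hlt hB₁F)
    have h12 : incidences A₁ B₂ ≤ F₁.totalDegree * B₂.card := by
      refine incidences_le_right fun u hu => ?_
      by_contra! hlt
      exact (Finset.mem_filter.mp hu).2 (aeval_lineZ_eq_zero_of_rich (hi₁.mono hA₁L) hlt hA₁F)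
    have hsplit : incidences A B = incidences A₁ B₁ + incidences A₁ B₂ + (incidences A₂ B₁ + incidences A₂ B₂) := by
      rw [incidences_eq_add_left A B fun u => aeval (lineX u) F₁ = 0,
        incidences_eq_add_right _ B fun u => aeval (lineZ u) F₁ = 0,
        incidences_eq_add_right (A.filter fun u => ¬ aeval (lineX u) F₁ = 0) B
          fun u => aeval (lineZ u) F₁ = 0]
    rw [hsplit, ← hAc, ← hBc, ← hd]
    nlinarith [Nat.zero_le (F₂.totalDegree * A₁.card), Nat.zero_le (F₂.totalDegree * B₁.card),
      Nat.zero_le (F₁.totalDegree * B₂.card), Nat.zero_le (F₁.totalDegree * A₂.card)]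

theorem incidences_le [Infinite K] {p : ℕ} [CharP K p] {L₁ L₂ : Finset (K × K × K)}
    (hi₁ : Set.InjOn (fun v : K × K × K => v.2.2) L₁) (hi₂ : Set.InjOn (fun v : K × K × K => v.2.2) L₂)
    {n k : ℕ} (hn₁ : L₁.card ≤ n) (hn₂ : L₂.card ≤ n) (hnp : n < p ^ 2)
    (hk : ∀ α ζ β κ : K,
      (L₁.filter fun u => u.1 = α + ζ * u.2.2 ∧ u.2.1 = β + κ * u.2.2).card ≤ k) :
    incidences L₁ L₂ ≤ 2 * n * (409 * (n.sqrt + 1) + k + 121 ^ 3) := by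
  obtain ⟨Y, hY⟩ := Infinite.exists_subset_card_eq K (9 * (n.sqrt + 1) + 1)
  set S : Finset (Fin 3 → K) :=
    (L₁ ×ˢ Y).image (fun x => ![x.1.1 + x.1.2.1 * x.2, x.2, x.1.2.2]) ∪
    (L₂ ×ˢ Y).image (fun x => ![x.1.1 + x.1.2.1 * x.2, x.1.2.2, x.2]) with hS
  have hScard : S.card ≤ 2 * n * (9 * (n.sqrt + 1) + 1) := by
    refine (Finset.card_union_le _ _).trans ?_
    have h₁ := (Finset.card_image_le (s := L₁ ×ˢ Y)
      (f := fun x => ![x.1.1 + x.1.2.1 * x.2, x.2, x.1.2.2])).trans_eq (Finset.card_product _ _)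
    have h₂ := (Finset.card_image_le (s := L₂ ×ˢ Y)
      (f := fun x => ![x.1.1 + x.1.2.1 * x.2, x.1.2.2, x.2])).trans_eq (Finset.card_product _ _)
    rw [hY] at h₁ h₂
    have h₃ := Nat.mul_le_mul_right (9 * (n.sqrt + 1) + 1) hn₁
    have h₄ := Nat.mul_le_mul_right (9 * (n.sqrt + 1) + 1) hn₂
    linarith
  have hlt : S.card < (3 * (n.sqrt + 1) + 1) ^ 3 := by
    refine hScard.trans_lt ?_
    have h : n ≤ (n.sqrt + 1) * (n.sqrt + 1) := (Nat.lt_succ_sqrt n).le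
    generalize n.sqrt = s at *
    calc 2 * n * (9 * (s + 1) + 1) ≤ 2 * ((s + 1) * (s + 1)) * (9 * (s + 1) + 1) := by gcongr
      _ < _ := by nlinarith [Nat.zero_le (s ^ 3), Nat.zero_le (s ^ 2)]
  obtain ⟨F, hF0, hFd, hF⟩ := exists_mvPolynomial_vanishing (3 * (n.sqrt + 1)) S hlt
  have h := incidences_le_of_vanishing hi₁ hi₂ hn₁ hn₂ hnp hk _ _ F hF0 rfl L₁ L₂ subset_rfl subset_rfl
    rfl (fun u hu => aeval_lineX_eq_zero_of_card Y (by omega) fun t ht => hF _ <|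
      Finset.mem_union_left _ <| Finset.mem_image.mpr ⟨(u, t), Finset.mem_product.mpr ⟨hu, ht⟩, rfl⟩)
    (fun u hu => aeval_lineZ_eq_zero_of_card Y (by omega) fun t ht => hF _ <|
      Finset.mem_union_right _ <| Finset.mem_image.mpr ⟨(u, t), Finset.mem_product.mpr ⟨hu, ht⟩, rfl⟩)
  refine h.trans ?_
  rw [mul_comm (2 * n)]
  exact Nat.mul_le_mul (by omega) (by omega)

end IncidenceBound

section EnergyLines

open Polynomial

variable {F K : Type*} [Field F] [Field K] [Algebra F K]

/-- The first family of lines attached to the equation `a + g b = c + h d`, encoding `(a, g, d)`. -/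
noncomputable def energyLineX (θ : K) (x : F × F × F) : K × K × K :=
  let W := 1 + θ * algebraMap F K x.1
  (algebraMap F K x.1 / W, algebraMap F K x.2.1 / W,
    (algebraMap F K x.2.2 + θ ^ 2 * algebraMap F K x.1 + θ ^ 5 * algebraMap F K x.2.1) / W)

/-- The second family of lines attached to the equation `a + g b = c + h d`, encoding `(b, c, h)`. -/
noncomputable def energyLineZ (θ : K) (y : F × F × F) : K × K × K :=
  let V := 1 + θ ^ 2 * algebraMap F K y.2.2 + θ * algebraMap F K y.2.1
  (algebraMap F K y.2.1 / V, algebraMap F K y.2.2 / V,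
    (algebraMap F K y.1 + θ ^ 5 * algebraMap F K y.2.2) / V)

theorem one_add_mul_ne_zero {θ : K} (hθ : Transcendental F θ) (a : F) :
    1 + θ * algebraMap F K a ≠ 0 := by
  intro h
  have h0 : (1 + X * C a : F[X]) = 0 := transcendental_iff_injective.mp hθ (by
    simpa only [map_add, map_one, map_mul, map_pow, aeval_C, aeval_X, map_zero] using h)
  simpa using congrArg (fun P => P.coeff 0) h0

theorem one_add_sq_mul_add_mul_ne_zero {θ : K} (hθ : Transcendental F θ) (g c : F) :
    1 + θ ^ 2 * algebraMap F K g + θ * algebraMap F K c ≠ 0 := by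
  intro h
  have h0 : (1 + X ^ 2 * C g + X * C c : F[X]) = 0 :=
    transcendental_iff_injective.mp hθ (by
    simpa only [map_add, map_one, map_mul, map_pow, aeval_C, aeval_X, map_zero] using h)
  simpa using congrArg (fun P => P.coeff 0) h0

theorem incident_energyLine {θ : K} (hθ : Transcendental F θ) (x y : F × F × F)
    (h : x.1 + x.2.1 * y.1 = y.2.1 + y.2.2 * x.2.2) :
    Incident (energyLineX θ x) (energyLineZ θ y) := by
  have hW := one_add_mul_ne_zero hθ x.1
  have hV := one_add_sq_mul_add_mul_ne_zero hθ y.2.2 y.2.1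
  have h' := congrArg (algebraMap F K) h
  simp only [map_add, map_mul] at h'
  simp only [Incident, energyLineX, energyLineZ]
  generalize algebraMap F K x.1 = a at *
  generalize algebraMap F K y.2.1 = c at *
  generalize algebraMap F K y.2.2 = g' at *
  generalize hWd : 1 + θ * a = W at *
  generalize hVd : 1 + θ ^ 2 * g' + θ * c = V at *
  field_simp
  rw [← hWd, ← hVd]
  linear_combination h'

theorem eq_of_energyLineX {θ : K} (hθ : Transcendental F θ) {x y : F × F × F}
    (h : (energyLineX θ x).2.2 = (energyLineX θ y).2.2) : x = y := by
  obtain ⟨a, g, d⟩ := x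
  obtain ⟨a', g', d'⟩ := y
  simp only [energyLineX] at h
  rw [div_eq_div_iff (one_add_mul_ne_zero hθ a) (one_add_mul_ne_zero hθ a')] at h
  have hP : (C d + C (d * a') * X ^ 1 + C a * X ^ 2 + C (a * a') * X ^ 3 + C g * X ^ 5 +
      C (g * a') * X ^ 6 : F[X]) = C d' + C (d' * a) * X ^ 1 + C a' * X ^ 2 + C (a' * a) * X ^ 3 +
      C g' * X ^ 5 + C (g' * a) * X ^ 6 := by
    apply transcendental_iff_injective.mp hθ
    simp only [map_add, map_mul, map_pow, aeval_C, aeval_X]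
    linear_combination h
  have h0 := congrArg (fun P => P.coeff 0) hP
  have h2 := congrArg (fun P => P.coeff 2) hP
  have h5 := congrArg (fun P => P.coeff 5) hP
  simp only [coeff_add, coeff_C_mul_X_pow, coeff_C] at h0 h2 h5
  norm_num at h0 h2 h5
  rw [h0, h2, h5]

theorem eq_of_energyLineZ {θ : K} (hθ : Transcendental F θ) {x y : F × F × F} (hx : x.1 ≠ 0)
    (h : (energyLineZ θ x).2.2 = (energyLineZ θ y).2.2) : x = y := by
  obtain ⟨b, c, g⟩ := x
  obtain ⟨b', c', g'⟩ := y
  simp only [energyLineZ] at h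
  rw [div_eq_div_iff (one_add_sq_mul_add_mul_ne_zero hθ g c)
    (one_add_sq_mul_add_mul_ne_zero hθ g' c')] at h
  have hP : (C b + C (b * c') * X ^ 1 + C (b * g') * X ^ 2 + C g * X ^ 5 +
      C (g * c') * X ^ 6 + C (g * g') * X ^ 7 : F[X]) = C b' + C (b' * c) * X ^ 1 +
      C (b' * g) * X ^ 2 + C g' * X ^ 5 + C (g' * c) * X ^ 6 + C (g' * g) * X ^ 7 := by
    apply transcendental_iff_injective.mp hθ
    simp only [map_add, map_mul, map_pow, aeval_C, aeval_X]
    linear_combination h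
  have h0 := congrArg (fun P => P.coeff 0) hP
  have h1 := congrArg (fun P => P.coeff 1) hP
  have h5 := congrArg (fun P => P.coeff 5) hP
  simp only [coeff_add, coeff_C_mul_X_pow, coeff_C] at h0 h1 h5
  norm_num at h0 h1 h5
  subst h0 h5
  have h1' : c' = c := mul_left_cancel₀ hx h1
  rw [h1']

variable [DecidableEq K]

theorem card_collinear_energyLineX_le {θ : K} (hθ : Transcendental F θ) {T Γ : Finset F}
    (hΓT : Γ.card ≤ T.card) (α ζ β κ : K) :
    (((T ×ˢ Γ ×ˢ T).image (energyLineX θ)).filter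
      fun u => u.1 = α + ζ * u.2.2 ∧ u.2.1 = β + κ * u.2.2).card ≤ T.card := by
  rw [Finset.filter_image]
  refine Finset.card_image_le.trans ?_
  have hmem : ∀ x ∈ (T ×ˢ Γ ×ˢ T).filter fun x => (energyLineX θ x).1 = α + ζ * (energyLineX θ x).2.2 ∧
      (energyLineX θ x).2.1 = β + κ * (energyLineX θ x).2.2, (x.1 ∈ T ∧ x.2.1 ∈ Γ ∧ x.2.2 ∈ T) ∧
      (energyLineX θ x).1 = α + ζ * (energyLineX θ x).2.2 ∧
      (energyLineX θ x).2.1 = β + κ * (energyLineX θ x).2.2 := by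
    intro x hx
    simpa only [Finset.mem_filter, Finset.mem_product] using hx
  by_cases hζ : ζ = 0
  · have hfst : ∀ x y : F × F × F, (energyLineX θ x).1 = α + ζ * (energyLineX θ x).2.2 →
        (energyLineX θ y).1 = α + ζ * (energyLineX θ y).2.2 → x.1 = y.1 := by
      intro x y hx hy
      apply (algebraMap F K).injective
      have h : (energyLineX θ x).1 = (energyLineX θ y).1 := by
        rw [hx, hy, hζ, zero_mul, zero_mul]
      simp only [energyLineX] at h
      rw [div_eq_div_iff (one_add_mul_ne_zero hθ _) (one_add_mul_ne_zero hθ _)] at h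
      linear_combination h
    by_cases hκ : κ = 0
    · refine Finset.card_le_card_of_injOn (fun x => x.2.2) (fun x hx => (hmem x hx).1.2.2) ?_
      intro x hx y hy hxy
      have hx' := (hmem x hx).2
      have hy' := (hmem y hy).2
      have h1 := hfst x y hx'.1 hy'.1
      have h2 : (energyLineX θ x).2.1 = (energyLineX θ y).2.1 := by
        rw [hx'.2, hy'.2, hκ, zero_mul, zero_mul]
      simp only [energyLineX, h1] at h2
      rw [div_left_inj' (one_add_mul_ne_zero hθ _)] at h2
      exact Prod.ext h1 (Prod.ext ((algebraMap F K).injective h2) hxy)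
    · refine (Finset.card_le_card_of_injOn (fun x => x.2.1) (fun x hx => (hmem x hx).1.2.1) ?_).trans hΓT
      intro x hx y hy hxy
      have hx' := (hmem x hx).2
      have hy' := (hmem y hy).2
      have h1 := hfst x y hx'.1 hy'.1
      have h2 : (energyLineX θ x).2.1 = (energyLineX θ y).2.1 := by
        simp only at hxy
        simp only [energyLineX, h1, hxy]
      rw [hx'.2, hy'.2] at h2
      exact eq_of_energyLineX hθ (mul_left_cancel₀ hκ (add_left_cancel h2))
  · refine Finset.card_le_card_of_injOn (fun x => x.1) (fun x hx => (hmem x hx).1.1) ?_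
    intro x hx y hy hxy
    have hx' := (hmem x hx).2
    have hy' := (hmem y hy).2
    have h1 : (energyLineX θ x).1 = (energyLineX θ y).1 := by
      simp only at hxy
      simp only [energyLineX, hxy]
    rw [hx'.1, hy'.1] at h1
    exact eq_of_energyLineX hθ (mul_left_cancel₀ hζ (add_left_cancel h1))

theorem incidences_eq_card (A B : Finset (K × K × K)) :
    incidences A B = ((A ×ˢ B).filter fun x => Incident x.1 x.2).card := by
  rw [incidences, Finset.card_filter, Finset.sum_product]
  exact Finset.sum_congr rfl fun u _ => Finset.card_filter _ _

theorem card_sq_mul_energy_le_incidences [DecidableEq F] {θ : K} (hθ : Transcendental F θ) {T Γ : Finset F}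
    (hΓ : IsMulSubgroup Γ) (hT : (0 : F) ∉ T) (hTΓ : ∀ x ∈ T, ∀ γ ∈ Γ, x * γ ∈ T) :
    Γ.card ^ 2 * EplusTwo T T ≤ incidences ((T ×ˢ Γ ×ˢ T).image (energyLineX θ))
      ((T ×ˢ T ×ˢ Γ).image (energyLineZ θ)) := by
  have h0 : ∀ g ∈ Γ, g ≠ 0 := fun g hg h => hΓ.1 (h ▸ hg)
  rw [incidences_eq_card, EplusTwo, pow_two, mul_assoc, ← Finset.card_product, ← Finset.card_product]
  refine Finset.card_le_card_of_injOn (fun z => (energyLineX θ (z.2.2.1, z.1, z.2.2.2.2.2 * z.2.1⁻¹),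
    energyLineZ θ (z.2.2.2.2.1 * z.1⁻¹, z.2.2.2.1, z.2.1))) ?_ ?_
  · rintro ⟨g, g', a, c, b, d⟩ hz
    simp only [Finset.coe_product, Finset.coe_filter, Finset.mem_product, Set.mem_prod,
      Finset.mem_coe, Set.mem_ofPred_eq] at hz
    obtain ⟨hg, hg', ⟨ha, hc, hb, hd⟩, h⟩ := hz
    rw [Finset.mem_coe, Finset.mem_filter, Finset.mem_product]
    refine ⟨⟨Finset.mem_image_of_mem _ ?_, Finset.mem_image_of_mem _ ?_⟩, incident_energyLine hθ _ _ ?_⟩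
    · simp only [Finset.mem_product]
      exact ⟨ha, hg, hTΓ _ hd _ (hΓ.2.2.2 _ hg')⟩
    · simp only [Finset.mem_product]
      exact ⟨hTΓ _ hb _ (hΓ.2.2.2 _ hg), hc, hg'⟩
    · have := h0 g hg
      have := h0 g' hg'
      field_simp
      exact h
  · rintro ⟨g, g', a, c, b, d⟩ hz ⟨g₂, g₂', a₂, c₂, b₂, d₂⟩ hz₂ h
    simp only [Finset.coe_product, Finset.coe_filter, Finset.mem_product, Set.mem_prod,
      Finset.mem_coe, Set.mem_ofPred_eq] at hz hz₂
    obtain ⟨hg, hg', ⟨ha, hc, hb, hd⟩, -⟩ := hz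
    simp only [Prod.mk.injEq] at h
    have h1 := eq_of_energyLineX hθ (congrArg (fun u => u.2.2) h.1)
    have hb0 : b * g⁻¹ ≠ 0 := mul_ne_zero (fun h => hT (h ▸ hb)) (inv_ne_zero (h0 g hg))
    have h2 := eq_of_energyLineZ hθ hb0 (congrArg (fun u => u.2.2) h.2)
    simp only [Prod.mk.injEq] at h1 h2
    obtain ⟨rfl, rfl, h3⟩ := h1
    obtain ⟨h4, rfl, rfl⟩ := h2
    rw [mul_left_inj' (inv_ne_zero (h0 _ hg'))] at h3
    rw [mul_left_inj' (inv_ne_zero (h0 _ hg))] at h4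
    rw [h3, h4]

end EnergyLines

section EnergyBound

theorem card_sq_mul_energy_le {p : ℕ} [Fact p.Prime] {T Γ : Finset (ZMod p)} (hΓ : IsMulSubgroup Γ)
    (hT : (0 : ZMod p) ∉ T) (hTΓ : ∀ x ∈ T, ∀ γ ∈ Γ, x * γ ∈ T) (hcard : Γ.card ≤ T.card)
    (hp : T.card ^ 2 * Γ.card < p ^ 2) :
    Γ.card ^ 2 * EplusTwo T T ≤ 2 * (T.card ^ 2 * Γ.card) *
      (409 * ((T.card ^ 2 * Γ.card).sqrt + 1) + T.card + 121 ^ 3) := by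
  classical
  let K := FractionRing (Polynomial (ZMod p))
  have : CharP K p := charP_of_injective_algebraMap (algebraMap (ZMod p) K).injective p
  set θ : K := algebraMap (Polynomial (ZMod p)) K Polynomial.X with hθdef
  have hθ : Transcendental (ZMod p) θ :=
    (transcendental_algebraMap_iff (IsFractionRing.injective (Polynomial (ZMod p)) K)).mpr
      (Polynomial.transcendental_X (ZMod p))
  have : Infinite K := Infinite.of_injective _ (IsFractionRing.injective (Polynomial (ZMod p)) K)
  refine (card_sq_mul_energy_le_incidences hθ hΓ hT hTΓ).trans
    (incidences_le (p := p) ?_ ?_ ?_ ?_ hp (card_collinear_energyLineX_le hθ hcard))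
  · rintro _ hu _ hv h
    obtain ⟨x, -, rfl⟩ := Finset.mem_image.mp (Finset.mem_coe.mp hu)
    obtain ⟨y, -, rfl⟩ := Finset.mem_image.mp (Finset.mem_coe.mp hv)
    rw [eq_of_energyLineX hθ h]
  · rintro _ hu _ hv h
    obtain ⟨x, hx, rfl⟩ := Finset.mem_image.mp (Finset.mem_coe.mp hu)
    obtain ⟨y, -, rfl⟩ := Finset.mem_image.mp (Finset.mem_coe.mp hv)
    have hx0 : x.1 ≠ 0 := fun h0 => hT (h0 ▸ (Finset.mem_product.mp hx).1)
    rw [eq_of_energyLineZ hθ hx0 h]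
  · refine Finset.card_image_le.trans (le_of_eq ?_)
    rw [Finset.card_product, Finset.card_product]
    ring
  · refine Finset.card_image_le.trans (le_of_eq ?_)
    rw [Finset.card_product, Finset.card_product]
    ring

/-- Energy bound `E⁺(T, T) ≪ |T|³ |Γ|^{-1/2}` for `Γ`-invariant sets with `|T|² |Γ| < p²`. -/
theorem energy_mul_sqrt_le {p : ℕ} [Fact p.Prime] {T Γ : Finset (ZMod p)} (hΓ : IsMulSubgroup Γ)
    (hT : (0 : ZMod p) ∉ T) (hTΓ : ∀ x ∈ T, ∀ γ ∈ Γ, x * γ ∈ T) (hcard : Γ.card ≤ T.card)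
    (hp : T.card ^ 2 * Γ.card < p ^ 2) :
    (EplusTwo T T : ℝ) * √Γ.card ≤ 4000000 * (T.card : ℝ) ^ 3 := by
  have h := card_sq_mul_energy_le hΓ hT hTΓ hcard hp
  have hΓ1 : (1 : ℝ) ≤ Γ.card := by
    exact_mod_cast Finset.card_pos.mpr ⟨1, hΓ.2.1⟩
  have hT1 : (1 : ℝ) ≤ T.card := hΓ1.trans (by exact_mod_cast hcard)
  have hr : (Γ.card : ℝ) ^ 2 * EplusTwo T T ≤ 2 * ((T.card : ℝ) ^ 2 * Γ.card) *
      (409 * (((T.card ^ 2 * Γ.card).sqrt : ℝ) + 1) + T.card + 121 ^ 3) := by exact_mod_cast h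
  have hs : ((T.card ^ 2 * Γ.card).sqrt : ℝ) ≤ T.card * √Γ.card := by
    have := Real.nat_sqrt_le_real_sqrt (a := T.card ^ 2 * Γ.card)
    rwa [Nat.cast_mul, Nat.cast_pow, Real.sqrt_mul (by positivity), Real.sqrt_sq (by positivity)] at this
  have hg1 : 1 ≤ √(Γ.card : ℝ) := by rwa [Real.one_le_sqrt]
  have hsq : √(Γ.card : ℝ) ^ 2 = Γ.card := Real.sq_sqrt (by positivity)
  generalize √(Γ.card : ℝ) = g at *
  generalize (EplusTwo T T : ℝ) = E at *
  generalize (T.card : ℝ) = n at *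
  generalize ((T.card ^ 2 * Γ.card).sqrt : ℝ) = s at *
  rw [← hsq] at hr
  have hng : 1 ≤ n * g := one_le_mul_of_one_le_of_one_le hT1 hg1
  have hn : n ≤ n * g := le_mul_of_one_le_right (by linarith) hg1
  have hg0 : 0 < g ^ 3 := by positivity
  refine le_of_mul_le_mul_right ?_ hg0
  calc E * g * g ^ 3 = (g ^ 2) ^ 2 * E := by ring
    _ ≤ 2 * (n ^ 2 * g ^ 2) * (409 * (s + 1) + n + 121 ^ 3) := hr
    _ ≤ 2 * (n ^ 2 * g ^ 2) * (2000000 * (n * g)) := by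
        refine mul_le_mul_of_nonneg_left ?_ (by positivity)
        linarith
    _ = 4000000 * n ^ 3 * g ^ 3 := by ring

end EnergyBound

section CharacterSums

open ComplexConjugate

variable {p : ℕ} [Fact p.Prime]

/-- The exponential sum of a set `A ⊆ F_p` at the frequency `x`. -/
noncomputable def charSum (A : Finset (ZMod p)) (x : ZMod p) : ℂ := ∑ a ∈ A, ZMod.stdAddChar (a * x)

theorem norm_charSum_le (A : Finset (ZMod p)) (x : ZMod p) : ‖charSum A x‖ ≤ A.card := by
  refine (norm_sum_le _ _).trans ?_
  simp

theorem ofReal_norm_sq_sum (T : Finset (ZMod p)) (c : ZMod p → ℂ) (γ : ZMod p) :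
    ((‖∑ s ∈ T, c s * ZMod.stdAddChar (γ * s)‖ ^ 2 : ℝ) : ℂ) =
      ∑ s ∈ T, ∑ s' ∈ T, c s * conj (c s') * ZMod.stdAddChar (γ * (s - s')) := by
  rw [Complex.ofReal_pow, ← Complex.mul_conj', map_sum, Finset.sum_mul_sum]
  refine Finset.sum_congr rfl fun s _ => Finset.sum_congr rfl fun s' _ => ?_
  rw [map_mul (starRingEnd ℂ), ← AddChar.map_neg_eq_conj, mul_sub, sub_eq_add_neg, AddChar.map_add_eq_mul]
  ring

theorem ofReal_norm_charSum_sq (A : Finset (ZMod p)) (x : ZMod p) :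
    ((‖charSum A x‖ ^ 2 : ℝ) : ℂ) = ∑ a ∈ A, ∑ b ∈ A, ZMod.stdAddChar (x * (a - b)) := by
  have h := ofReal_norm_sq_sum A (fun _ => 1) x
  simp only [map_one, one_mul] at h
  rw [← h, charSum]
  simp_rw [mul_comm x]

theorem sum_stdAddChar_mul (b : ZMod p) :
    ∑ x : ZMod p, (ZMod.stdAddChar (x * b) : ℂ) = if b = 0 then (p : ℂ) else 0 := by
  rw [AddChar.sum_mulShift b (ZMod.isPrimitive_stdAddChar p), ZMod.card]
  split_ifs <;> simp

theorem sum_norm_charSum_sq (A : Finset (ZMod p)) : ∑ x, ‖charSum A x‖ ^ 2 = (p : ℝ) * A.card := by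
  have h : ((∑ x, ‖charSum A x‖ ^ 2 : ℝ) : ℂ) = ((p * A.card : ℝ) : ℂ) := by
    rw [Complex.ofReal_sum]
    simp_rw [ofReal_norm_charSum_sq]
    rw [Finset.sum_comm]
    simp_rw [Finset.sum_comm (s := Finset.univ), sum_stdAddChar_mul, sub_eq_zero]
    simp [mul_comm]
  exact_mod_cast h

theorem charSum_mul_of_mem {Γ : Finset (ZMod p)} (hΓ : IsMulSubgroup Γ) {γ : ZMod p} (hγ : γ ∈ Γ)
    (x : ZMod p) : charSum Γ (x * γ) = charSum Γ x := by
  have hγ0 : γ ≠ 0 := fun h => hΓ.1 (h ▸ hγ)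
  refine Finset.sum_bij' (fun a _ => a * γ) (fun a _ => a * γ⁻¹) (fun a ha => hΓ.2.2.1 a ha γ hγ)
    (fun a ha => hΓ.2.2.1 a ha _ (hΓ.2.2.2 γ hγ)) ?_ ?_ ?_
  · intro a _
    exact mul_inv_cancel_right₀ hγ0 a
  · intro a _
    exact inv_mul_cancel_right₀ hγ0 a
  · intro a _
    rw [mul_assoc, mul_comm γ]

theorem exists_norm_eq_one_mul_eq_norm (z : ℂ) : ∃ c : ℂ, ‖c‖ = 1 ∧ c * z = ‖z‖ := by
  by_cases hz : z = 0
  · exact ⟨1, by simp, by simp [hz]⟩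
  · have hz' : (‖z‖ : ℂ) ≠ 0 := by simpa using hz
    refine ⟨conj z / ‖z‖, ?_, ?_⟩
    · rw [norm_div, Complex.norm_real, norm_norm, RCLike.norm_conj, div_self (norm_ne_zero_iff.mpr hz)]
    · rw [div_mul_eq_mul_div, Complex.conj_mul', sq, mul_div_assoc, div_self hz', mul_one]

theorem sq_mul_card_le_sum_norm_charSum_sub {Γ T : Finset (ZMod p)} {θ : ℝ} (hθ : 0 ≤ θ)
    (hΓ : 0 < Γ.card) (hT : ∀ s ∈ T, θ * Γ.card ≤ ‖charSum Γ s‖) :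
    θ ^ 2 * (T.card : ℝ) ^ 2 * Γ.card ≤ ∑ s ∈ T, ∑ s' ∈ T, ‖charSum Γ (s - s')‖ := by
  choose c hc1 hc using fun s => exists_norm_eq_one_mul_eq_norm (charSum Γ s)
  have hsum : ((∑ s ∈ T, ‖charSum Γ s‖ : ℝ) : ℂ) =
      ∑ γ ∈ Γ, ∑ s ∈ T, c s * ZMod.stdAddChar (γ * s) := by
    rw [Complex.ofReal_sum, Finset.sum_comm]
    refine Finset.sum_congr rfl fun s _ => ?_
    rw [← hc, charSum, Finset.mul_sum]
  have h1 : T.card * (θ * Γ.card) ≤ ∑ s ∈ T, ‖charSum Γ s‖ := by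
    rw [← nsmul_eq_mul]
    exact Finset.card_nsmul_le_sum _ _ _ hT
  have h2 : ∑ s ∈ T, ‖charSum Γ s‖ ≤ ∑ γ ∈ Γ, ‖∑ s ∈ T, c s * ZMod.stdAddChar (γ * s)‖ := by
    refine (Real.le_norm_self _).trans ?_
    rw [← Complex.norm_real, hsum]
    exact norm_sum_le _ _
  have h3 : ∑ γ ∈ Γ, ‖∑ s ∈ T, c s * ZMod.stdAddChar (γ * s)‖ ^ 2 ≤
      ∑ s ∈ T, ∑ s' ∈ T, ‖charSum Γ (s - s')‖ := by
    have h : ((∑ γ ∈ Γ, ‖∑ s ∈ T, c s * ZMod.stdAddChar (γ * s)‖ ^ 2 : ℝ) : ℂ) =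
        ∑ s ∈ T, ∑ s' ∈ T, c s * conj (c s') * charSum Γ (s - s') := by
      rw [Complex.ofReal_sum]
      simp_rw [ofReal_norm_sq_sum]
      rw [Finset.sum_comm]
      refine Finset.sum_congr rfl fun s _ => ?_
      rw [Finset.sum_comm]
      refine Finset.sum_congr rfl fun s' _ => ?_
      rw [charSum, Finset.mul_sum]
    refine (Real.le_norm_self _).trans ?_
    rw [← Complex.norm_real, h]
    refine (norm_sum_le _ _).trans (Finset.sum_le_sum fun s _ => ?_)
    refine (norm_sum_le _ _).trans (Finset.sum_le_sum fun s' _ => ?_)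
    rw [norm_mul, norm_mul, RCLike.norm_conj, hc1, hc1, one_mul, one_mul]
  have h4 := sq_sum_le_card_mul_sum_sq (s := Γ)
    (f := fun γ => ‖∑ s ∈ T, c s * (ZMod.stdAddChar (γ * s) : ℂ)‖)
  have hΓ' : (0 : ℝ) < Γ.card := by exact_mod_cast hΓ
  refine le_of_mul_le_mul_left ?_ hΓ'
  calc Γ.card * (θ ^ 2 * (T.card : ℝ) ^ 2 * Γ.card) = (T.card * (θ * Γ.card)) ^ 2 := by ring
    _ ≤ (∑ γ ∈ Γ, ‖∑ s ∈ T, c s * ZMod.stdAddChar (γ * s)‖) ^ 2 :=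
        pow_le_pow_left₀ (by positivity) (h1.trans h2) 2
    _ ≤ _ := h4
    _ ≤ _ := mul_le_mul_of_nonneg_left h3 hΓ'.le

end CharacterSums

section Differences

variable {G : Type*} [AddCommGroup G] [DecidableEq G]

theorem sq_card_filter_sub_mem_le (T D : Finset G) :
    ((T ×ˢ T).filter fun z => z.1 - z.2 ∈ D).card ^ 2 ≤ D.card * EplusTwo T T := by
  have h1 : ((T ×ˢ T).filter fun z => z.1 - z.2 ∈ D).card =
      ∑ x ∈ D, ((T ×ˢ T).filter fun z => z.1 - z.2 = x).card := by
    have hmaps : Set.MapsTo (fun z : G × G => z.1 - z.2)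
        ((T ×ˢ T).filter fun z => z.1 - z.2 ∈ D : Finset (G × G)) D :=
      fun z hz => (Finset.mem_filter.mp hz).2
    rw [Finset.card_eq_sum_card_fiberwise hmaps]
    refine Finset.sum_congr rfl fun x hx => congrArg _ ?_
    rw [Finset.filter_filter]
    refine Finset.filter_congr fun z _ => ⟨fun h => h.2, fun h => ⟨h ▸ hx, h⟩⟩
  have h2 : ∑ x ∈ D, ((T ×ˢ T).filter fun z => z.1 - z.2 = x).card ^ 2 ≤ EplusTwo T T := by
    have : ∑ x ∈ D, ((T ×ˢ T).filter fun z => z.1 - z.2 = x).card ^ 2 =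
        (D.sigma fun x => ((T ×ˢ T).filter fun z => z.1 - z.2 = x) ×ˢ
          ((T ×ˢ T).filter fun z => z.1 - z.2 = x)).card := by
      rw [Finset.card_sigma]
      refine Finset.sum_congr rfl fun x _ => ?_
      rw [Finset.card_product, sq]
    rw [this, EplusTwo]
    refine Finset.card_le_card_of_injOn (fun y => (y.2.1.1, y.2.2.1, y.2.2.2, y.2.1.2)) ?_ ?_
    · rintro ⟨x, ⟨s, s'⟩, ⟨u, u'⟩⟩ h
      simp only [Finset.mem_coe, Finset.mem_sigma, Finset.mem_product, Finset.mem_filter] at h ⊢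
      obtain ⟨-, ⟨⟨hs, hs'⟩, h1⟩, ⟨hu, hu'⟩, h2⟩ := h
      refine ⟨⟨hs, hu, hu', hs'⟩, ?_⟩
      rw [← h2, sub_eq_sub_iff_add_eq_add] at h1
      exact h1
    · rintro ⟨x, ⟨s, s'⟩, ⟨u, u'⟩⟩ h ⟨y, ⟨t, t'⟩, ⟨v, v'⟩⟩ h₂ heq
      simp only [Finset.mem_coe, Finset.mem_sigma, Finset.mem_product, Finset.mem_filter] at h h₂
      simp only [Prod.mk.injEq] at heq
      obtain ⟨rfl, rfl, rfl, rfl⟩ := heq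
      have : x = y := h.2.1.2.symm.trans h₂.2.1.2
      rw [this]
  rw [h1]
  exact sq_sum_le_card_mul_sum_sq.trans (Nat.mul_le_mul_left _ h2)

end Differences

section LargeSpectrum

variable {p : ℕ} [Fact p.Prime]

/-- The nonzero frequencies at which the exponential sum over `Γ` is at least `θ |Γ|`. -/
noncomputable def largeSpectrum (Γ : Finset (ZMod p)) (θ : ℝ) : Finset (ZMod p) :=
  open Classical in Finset.univ.filter fun x => x ≠ 0 ∧ θ * Γ.card ≤ ‖charSum Γ x‖

theorem mem_largeSpectrum {Γ : Finset (ZMod p)} {θ : ℝ} {x : ZMod p} :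
    x ∈ largeSpectrum Γ θ ↔ x ≠ 0 ∧ θ * Γ.card ≤ ‖charSum Γ x‖ := by
  simp [largeSpectrum]

theorem mul_mem_largeSpectrum {Γ : Finset (ZMod p)} (hΓ : IsMulSubgroup Γ) {θ : ℝ} {x γ : ZMod p}
    (hx : x ∈ largeSpectrum Γ θ) (hγ : γ ∈ Γ) : x * γ ∈ largeSpectrum Γ θ := by
  rw [mem_largeSpectrum] at hx ⊢
  rw [charSum_mul_of_mem hΓ hγ]
  exact ⟨mul_ne_zero hx.1 fun h => hΓ.1 (h ▸ hγ), hx.2⟩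

theorem card_le_card_of_mul_mem {F : Type*} [Field F] {Γ T : Finset F} {x : F} (hx : x ≠ 0)
    (h : ∀ γ ∈ Γ, x * γ ∈ T) : Γ.card ≤ T.card :=
  Finset.card_le_card_of_injOn (fun γ => x * γ) h fun _ _ _ _ h => mul_left_cancel₀ hx h

theorem card_largeSpectrum_mul_le {Γ : Finset (ZMod p)} (hΓ : 0 < Γ.card) {θ : ℝ} (hθ : 0 ≤ θ) :
    (largeSpectrum Γ θ).card * θ ^ 2 * Γ.card ≤ p := by
  have hΓ' : (0 : ℝ) < Γ.card := by exact_mod_cast hΓ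
  refine le_of_mul_le_mul_right ?_ hΓ'
  rw [← sum_norm_charSum_sq]
  calc (largeSpectrum Γ θ).card * θ ^ 2 * Γ.card * Γ.card
      = (largeSpectrum Γ θ).card • (θ * Γ.card) ^ 2 := by rw [nsmul_eq_mul]; ring
    _ ≤ ∑ x ∈ largeSpectrum Γ θ, ‖charSum Γ x‖ ^ 2 := Finset.card_nsmul_le_sum _ _ _ fun x hx =>
        pow_le_pow_left₀ (by positivity) (mem_largeSpectrum.mp hx).2 2
    _ ≤ _ := Finset.sum_le_sum_of_subset_of_nonneg (Finset.subset_univ _) fun _ _ _ => by positivity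

theorem le_card_largeSpectrum_mul_energy {Γ : Finset (ZMod p)} (hΓ : 0 < Γ.card) {θ : ℝ} (hθ : 0 < θ)
    (hT : 4 ≤ (largeSpectrum Γ θ).card * θ ^ 2) :
    θ ^ 4 * ((largeSpectrum Γ θ).card : ℝ) ^ 4 ≤
      4 * ((largeSpectrum Γ (θ ^ 2 / 4)).card * EplusTwo (largeSpectrum Γ θ) (largeSpectrum Γ θ)) := by
  set T := largeSpectrum Γ θ with hTdef
  set D := largeSpectrum Γ (θ ^ 2 / 4) with hD
  have hΓ' : (0 : ℝ) < Γ.card := by exact_mod_cast hΓ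
  set N := ((T ×ˢ T).filter fun z => z.1 - z.2 ∈ D).card with hN
  have h1 := sq_mul_card_le_sum_norm_charSum_sub hθ.le hΓ (T := T) fun s hs => (mem_largeSpectrum.mp hs).2
  have hpt : ∀ z ∈ T ×ˢ T, ‖charSum Γ (z.1 - z.2)‖ ≤ (if z.1 - z.2 ∈ D then (Γ.card : ℝ) else 0) +
      (if z.1 = z.2 then (Γ.card : ℝ) else 0) + θ ^ 2 / 4 * Γ.card := by
    intro z _
    have hle := norm_charSum_le Γ (z.1 - z.2)
    have hpos : 0 ≤ θ ^ 2 / 4 * (Γ.card : ℝ) := by positivity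
    split_ifs with h h' h'
    · linarith
    · linarith
    · linarith
    · rw [hD, mem_largeSpectrum] at h
      push Not at h
      have := h (sub_ne_zero.mpr h')
      linarith
  have h2 : ∑ s ∈ T, ∑ s' ∈ T, ‖charSum Γ (s - s')‖ ≤
      N * Γ.card + T.card * Γ.card + (T.card : ℝ) ^ 2 * (θ ^ 2 / 4 * Γ.card) := by
    rw [← Finset.sum_product' T T fun s s' => ‖charSum Γ (s - s')‖]
    refine (Finset.sum_le_sum hpt).trans (le_of_eq ?_)
    rw [Finset.sum_add_distrib, Finset.sum_add_distrib, ← Finset.sum_filter, Finset.sum_const,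
      ← Finset.sum_filter, Finset.sum_const, Finset.sum_const, Finset.card_product, nsmul_eq_mul,
      nsmul_eq_mul, nsmul_eq_mul]
    congr 2
    · congr 2
      refine (Finset.card_bij (fun a _ => (a, a)) ?_ ?_ ?_).symm
      · intro a ha
        simpa using ha
      · intro a _ b _ h
        exact (Prod.mk.injEq _ _ _ _ ▸ h).1
      · rintro ⟨a, b⟩ h
        simp only [Finset.mem_filter, Finset.mem_product] at h
        obtain ⟨⟨ha, -⟩, rfl⟩ := h
        exact ⟨a, ha, rfl⟩
    · push_cast
      ring
  have h3 : θ ^ 2 * (T.card : ℝ) ^ 2 ≤ N + T.card + (T.card : ℝ) ^ 2 * (θ ^ 2 / 4) := by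
    refine le_of_mul_le_mul_right ?_ hΓ'
    linarith
  have h4 : θ ^ 2 * (T.card : ℝ) ^ 2 ≤ 2 * N := by
    have : (T.card : ℝ) * 4 ≤ T.card * (T.card * θ ^ 2) :=
      mul_le_mul_of_nonneg_left hT (Nat.cast_nonneg _)
    linarith
  have h5 : (N : ℝ) ^ 2 ≤ D.card * EplusTwo T T := by exact_mod_cast sq_card_filter_sub_mem_le T D
  calc θ ^ 4 * (T.card : ℝ) ^ 4 = (θ ^ 2 * (T.card : ℝ) ^ 2) ^ 2 := by ring
    _ ≤ (2 * (N : ℝ)) ^ 2 := pow_le_pow_left₀ (by positivity) h4 2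
    _ = 4 * (N : ℝ) ^ 2 := by ring
    _ ≤ _ := by linarith

end LargeSpectrum

section SubgroupSums

variable {p : ℕ} [Fact p.Prime]

theorem card_largeSpectrum_step {Γ : Finset (ZMod p)} (hΓ : IsMulSubgroup Γ) {θ : ℝ} (hθ0 : 0 < θ)
    (hθ1 : θ ≤ 1) (hcard : Γ.card ≤ (largeSpectrum Γ θ).card) (h16 : 16 ≤ Γ.card * θ ^ 4) :
    θ ^ 4 * (largeSpectrum Γ θ).card * √Γ.card ≤ 16000000 * (largeSpectrum Γ (θ ^ 2 / 4)).card := by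
  have hΓ0 : 0 < Γ.card := Finset.card_pos.mpr ⟨1, hΓ.2.1⟩
  have hp := card_largeSpectrum_mul_le hΓ0 hθ0.le
  set T := largeSpectrum Γ θ with hT
  have ht : (0 : ℝ) < Γ.card := by exact_mod_cast hΓ0
  have htT : (Γ.card : ℝ) ≤ T.card := by exact_mod_cast hcard
  have hT0 : (0 : ℝ) < T.card := ht.trans_le htT
  have h4 : 4 ≤ (T.card : ℝ) * θ ^ 2 := by
    have h1 : θ ^ 4 ≤ θ ^ 2 := pow_le_pow_of_le_one hθ0.le hθ1 (by norm_num)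
    have h2 : (Γ.card : ℝ) * θ ^ 4 ≤ T.card * θ ^ 2 := by gcongr
    linarith
  have hlt : T.card ^ 2 * Γ.card < p ^ 2 := by
    have h1 : ((T.card : ℝ) * θ ^ 2 * Γ.card) ^ 2 ≤ (p : ℝ) ^ 2 := pow_le_pow_left₀ (by positivity) hp 2
    have h2 : (T.card : ℝ) ^ 2 * Γ.card * 16 ≤ (T.card : ℝ) ^ 2 * Γ.card * (Γ.card * θ ^ 4) := by gcongr
    have h3 : 0 < (T.card : ℝ) ^ 2 * Γ.card := by positivity
    have h5 : (T.card : ℝ) ^ 2 * Γ.card < (p : ℝ) ^ 2 := by linarith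
    exact_mod_cast h5
  have hE := energy_mul_sqrt_le hΓ (fun h => (mem_largeSpectrum.mp h).1 rfl)
    (fun x hx γ hγ => mul_mem_largeSpectrum hΓ hx hγ) hcard hlt
  have hD := le_card_largeSpectrum_mul_energy hΓ0 hθ0 h4
  refine le_of_mul_le_mul_right ?_ (pow_pos hT0 3)
  calc θ ^ 4 * T.card * √Γ.card * (T.card : ℝ) ^ 3 = θ ^ 4 * (T.card : ℝ) ^ 4 * √Γ.card := by ring
    _ ≤ 4 * ((largeSpectrum Γ (θ ^ 2 / 4)).card * EplusTwo T T) * √Γ.card := by gcongr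
    _ = 4 * (largeSpectrum Γ (θ ^ 2 / 4)).card * (EplusTwo T T * √Γ.card) := by ring
    _ ≤ 4 * (largeSpectrum Γ (θ ^ 2 / 4)).card * (4000000 * (T.card : ℝ) ^ 3) := by gcongr
    _ = _ := by ring

theorem norm_charSum_pow_mul_card_le {Γ : Finset (ZMod p)} (hΓ : IsMulSubgroup Γ) {J : ℕ}
    (hJ : (p : ℝ) ≤ Γ.card * √Γ.card ^ J) {x : ZMod p} (hx : x ≠ 0) :
    (‖charSum Γ x‖ / (4 * Γ.card)) ^ (6 * 2 ^ J) * Γ.card ≤ 62500 ^ J := by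
  have hΓ0 : 0 < Γ.card := Finset.card_pos.mpr ⟨1, hΓ.2.1⟩
  have ht : (0 : ℝ) < Γ.card := by exact_mod_cast hΓ0
  set η := ‖charSum Γ x‖ / (4 * Γ.card) with hη
  have hη0 : 0 ≤ η := by positivity
  have hη4 : η ≤ 1 / 4 := by
    rw [hη, div_le_div_iff₀ (by positivity) (by norm_num)]
    linarith [norm_charSum_le Γ x]
  have hηx : 4 * η * Γ.card = ‖charSum Γ x‖ := by
    rw [hη]
    field_simp
  have hη1 : η ≤ 1 := hη4.trans (by norm_num)
  have hC : (1 : ℝ) ≤ 62500 ^ J := one_le_pow₀ (by norm_num)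
  rcases hη0.eq_or_lt with h0 | hpos
  · rw [← h0, zero_pow (by positivity), zero_mul]
    positivity
  by_cases hgood : ∀ j < J, 16 ≤ Γ.card * (4 * η ^ 2 ^ j) ^ 4
  · have hpow : ∀ j, η ^ 2 ^ j ≤ η := fun j => by
      simpa using pow_le_pow_of_le_one hη0 hη1 (Nat.one_le_two_pow (n := j))
    have hcard : ∀ j, Γ.card ≤ (largeSpectrum Γ (4 * η ^ 2 ^ j)).card := by
      intro j
      have hxj : x ∈ largeSpectrum Γ (4 * η ^ 2 ^ j) := by
        refine mem_largeSpectrum.mpr ⟨hx, ?_⟩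
        rw [← hηx]
        gcongr
        exact hpow j
      exact card_le_card_of_mul_mem hx fun γ hγ => mul_mem_largeSpectrum hΓ hxj hγ
    have hind : ∀ j ≤ J, Γ.card * √Γ.card ^ j * η ^ (4 * 2 ^ j) ≤
        62500 ^ j * (largeSpectrum Γ (4 * η ^ 2 ^ j)).card := by
      intro j
      induction j with
      | zero =>
        intro _
        rw [pow_zero (√(Γ.card : ℝ)), pow_zero (62500 : ℝ), mul_one, one_mul]
        have h1 : η ^ (4 * 2 ^ 0) ≤ 1 := pow_le_one₀ hη0 hη1
        have h2 : (Γ.card : ℝ) ≤ (largeSpectrum Γ (4 * η ^ 2 ^ 0)).card := by exact_mod_cast hcard 0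
        exact (mul_le_of_le_one_right ht.le h1).trans h2
      | succ j ih =>
        intro hj
        have ih := ih (by omega)
        have hstep := card_largeSpectrum_step hΓ (θ := 4 * η ^ 2 ^ j) (by positivity)
          (by linarith [hpow j]) (hcard j) (hgood j (by omega))
        have hθ : (4 * η ^ 2 ^ j) ^ 2 / 4 = 4 * η ^ 2 ^ (j + 1) := by
          rw [pow_succ 2 j, pow_mul]
          ring
        rw [hθ] at hstep
        calc Γ.card * √Γ.card ^ (j + 1) * η ^ (4 * 2 ^ (j + 1))
            = (Γ.card * √Γ.card ^ j * η ^ (4 * 2 ^ j)) * (η ^ (4 * 2 ^ j) * √Γ.card) := by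
              rw [pow_succ 2 j, show 4 * (2 ^ j * 2) = 4 * 2 ^ j + 4 * 2 ^ j by ring, pow_add]
              ring
          _ ≤ 62500 ^ j * (largeSpectrum Γ (4 * η ^ 2 ^ j)).card * (η ^ (4 * 2 ^ j) * √Γ.card) := by
              gcongr
          _ = 62500 ^ j / 256 * ((4 * η ^ 2 ^ j) ^ 4 * (largeSpectrum Γ (4 * η ^ 2 ^ j)).card *
                √Γ.card) := by
              rw [mul_pow, ← pow_mul, mul_comm (2 ^ j) 4]
              ring
          _ ≤ 62500 ^ j / 256 * (16000000 * (largeSpectrum Γ (4 * η ^ 2 ^ (j + 1))).card) := by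
              gcongr
          _ = _ := by ring
    have h1 := hind J le_rfl
    have h2 := card_largeSpectrum_mul_le hΓ0 (θ := 4 * η ^ 2 ^ J) (by positivity)
    have hp0 : (0 : ℝ) < p := by exact_mod_cast (Fact.out : p.Prime).pos
    refine le_of_mul_le_mul_right ?_ hp0
    have hpw : η ^ (6 * 2 ^ J) = η ^ (4 * 2 ^ J) * (η ^ 2 ^ J) ^ 2 := by
      rw [← pow_mul, ← pow_add]
      congr 1
      ring
    calc η ^ (6 * 2 ^ J) * Γ.card * p ≤ η ^ (6 * 2 ^ J) * Γ.card * (Γ.card * √Γ.card ^ J) := by gcongr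
      _ = Γ.card * √Γ.card ^ J * η ^ (4 * 2 ^ J) * ((η ^ 2 ^ J) ^ 2 * Γ.card) := by rw [hpw]; ring
      _ ≤ 62500 ^ J * (largeSpectrum Γ (4 * η ^ 2 ^ J)).card * ((η ^ 2 ^ J) ^ 2 * Γ.card) := by gcongr
      _ ≤ 62500 ^ J * (largeSpectrum Γ (4 * η ^ 2 ^ J)).card * ((4 * η ^ 2 ^ J) ^ 2 * Γ.card) := by
          gcongr
          linarith [pow_pos hpos (2 ^ J)]
      _ = 62500 ^ J * ((largeSpectrum Γ (4 * η ^ 2 ^ J)).card * (4 * η ^ 2 ^ J) ^ 2 * Γ.card) := by ring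
      _ ≤ 62500 ^ J * p := by gcongr
  · push Not at hgood
    obtain ⟨j, hj, hlt⟩ := hgood
    have hle : η ^ (6 * 2 ^ J) ≤ η ^ (4 * 2 ^ j) :=
      pow_le_pow_of_le_one hη0 hη1 (Nat.mul_le_mul (by norm_num) (Nat.pow_le_pow_right (by norm_num) hj.le))
    rw [mul_pow, ← pow_mul, mul_comm (2 ^ j) 4] at hlt
    have := mul_le_mul_of_nonneg_right hle ht.le
    linarith

/-- Power-saving bound for exponential sums over a multiplicative subgroup of size at least `p^δ`. -/
theorem norm_charSum_le_rpow {δ : ℝ} (hδ : 0 < δ) {Γ : Finset (ZMod p)} (hΓ : IsMulSubgroup Γ)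
    (hcard : (p : ℝ) ^ δ ≤ Γ.card) {x : ZMod p} (hx : x ≠ 0) :
    ‖charSum Γ x‖ ≤ 4 * 62500 ^ ⌈2 / δ - 2⌉₊ * Γ.card *
      (p : ℝ) ^ (-(δ / (2 : ℝ) ^ ((7 : ℝ) + 2 / δ))) := by
  set J := ⌈2 / δ - 2⌉₊ with hJdef
  have hΓ0 : 0 < Γ.card := Finset.card_pos.mpr ⟨1, hΓ.2.1⟩
  have ht : (0 : ℝ) < Γ.card := by exact_mod_cast hΓ0
  have hp1 : (1 : ℝ) ≤ p := by exact_mod_cast (Fact.out : p.Prime).one_lt.le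
  have hp0 : (0 : ℝ) < p := by linarith
  have ht1 : (1 : ℝ) ≤ Γ.card := by exact_mod_cast hΓ0
  have hJle : 2 / δ - 2 ≤ J := Nat.le_ceil _
  have hJlt : (J : ℝ) ≤ 2 / δ := by
    have h2 : 0 < 2 / δ := by positivity
    rcases le_total (2 / δ - 2) 0 with h | h
    · rw [hJdef, Nat.ceil_eq_zero.mpr h, Nat.cast_zero]
      exact h2.le
    · linarith [Nat.ceil_lt_add_one h]
  have hJ : (p : ℝ) ≤ Γ.card * √Γ.card ^ J := by
    have h1 : (Γ.card : ℝ) * √Γ.card ^ J = (Γ.card : ℝ) ^ (1 + (J : ℝ) / 2) := by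
      rw [Real.rpow_add ht, Real.rpow_one, Real.sqrt_eq_rpow, ← Real.rpow_natCast, ← Real.rpow_mul ht.le]
      congr 2
      ring
    rw [h1]
    calc (p : ℝ) = (p : ℝ) ^ (1 : ℝ) := (Real.rpow_one _).symm
      _ ≤ (p : ℝ) ^ (δ * (1 + (J : ℝ) / 2)) := by
          refine Real.rpow_le_rpow_of_exponent_le hp1 ?_
          have : δ * (2 / δ - 2) ≤ δ * J := mul_le_mul_of_nonneg_left hJle hδ.le
          have h3 : δ * (2 / δ - 2) = 2 - 2 * δ := by field_simp
          linarith
      _ = ((p : ℝ) ^ δ) ^ (1 + (J : ℝ) / 2) := Real.rpow_mul hp0.le _ _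
      _ ≤ _ := Real.rpow_le_rpow (by positivity) hcard (by positivity)
  have hmain := norm_charSum_pow_mul_card_le hΓ hJ hx
  set η := ‖charSum Γ x‖ / (4 * Γ.card) with hη
  have hη0 : 0 ≤ η := by positivity
  set ε := δ / (2 : ℝ) ^ ((7 : ℝ) + 2 / δ) with hε
  have hC : (1 : ℝ) ≤ 62500 ^ J := one_le_pow₀ (by norm_num)
  have hN : ((6 * 2 ^ J : ℕ) : ℝ) ≤ (2 : ℝ) ^ ((7 : ℝ) + 2 / δ) := by
    push_cast
    rw [Real.rpow_add (by norm_num), ← Real.rpow_natCast 2 J]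
    refine mul_le_mul ?_ (Real.rpow_le_rpow_of_exponent_le (by norm_num) hJlt) (by positivity)
      (by positivity)
    norm_num
  have hkey : η ≤ 62500 ^ J * (p : ℝ) ^ (-ε) := by
    have hne : 6 * 2 ^ J ≠ 0 := mul_ne_zero (by norm_num) (pow_ne_zero _ (by norm_num))
    refine le_of_pow_le_pow_left₀ hne (by positivity) ?_
    rw [mul_pow, ← Real.rpow_natCast ((p : ℝ) ^ (-ε)), ← Real.rpow_mul hp0.le]
    have hexp : ε * ((6 * 2 ^ J : ℕ) : ℝ) ≤ δ := by
      rw [hε, div_mul_eq_mul_div, div_le_iff₀ (by positivity)]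
      exact mul_le_mul_of_nonneg_left hN hδ.le
    have h1 : η ^ (6 * 2 ^ J) ≤ 62500 ^ J * (p : ℝ) ^ (-δ) := by
      rw [Real.rpow_neg hp0.le, ← div_eq_mul_inv, le_div_iff₀ (by positivity)]
      exact (mul_le_mul_of_nonneg_left hcard (by positivity)).trans hmain
    refine h1.trans (mul_le_mul (le_self_pow₀ hC hne) ?_ (by positivity) (by positivity))
    refine Real.rpow_le_rpow_of_exponent_le hp1 ?_
    linarith
  have hηx : ‖charSum Γ x‖ = η * (4 * Γ.card) := by
    rw [hη, div_mul_cancel₀ _ (by positivity)]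
  rw [hηx]
  calc η * (4 * Γ.card) ≤ 62500 ^ J * (p : ℝ) ^ (-ε) * (4 * Γ.card) := mul_le_mul_of_nonneg_right hkey (mul_nonneg zero_le_four ht.le)
    _ = _ := by ring

end SubgroupSums

section Representations

variable {p : ℕ} [Fact p.Prime]

theorem card_mul_representations_le {Γ Q : Finset (ZMod p)} (hΓ : IsMulSubgroup Γ)
    (hQ : ∀ q ∈ Q, ∀ γ ∈ Γ, q * γ ∈ Q) {B : ℝ} (hB : ∀ y : ZMod p, y ≠ 0 → ‖charSum Γ y‖ ≤ B)
    (hB0 : 0 ≤ B) {x : ZMod p} (hx : x ≠ 0) :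
    (p : ℝ) * (Γ.card * ((Q ×ˢ Q).filter fun z => z.1 - z.2 = x).card) ≤
      (Q.card : ℝ) ^ 2 * Γ.card + B * (p * Q.card) := by
  have hcount : (Γ.card : ℝ) * ((Q ×ˢ Q).filter fun z => z.1 - z.2 = x).card ≤
      ∑ γ ∈ Γ, (((Q ×ˢ Q).filter fun z => z.1 - z.2 = γ * x).card : ℝ) := by
    rw [← nsmul_eq_mul]
    refine Finset.card_nsmul_le_sum _ _ _ fun γ hγ => ?_
    have hγ0 : γ ≠ 0 := fun h => hΓ.1 (h ▸ hγ)
    refine Nat.cast_le.mpr (Finset.card_le_card_of_injOn (fun z => (z.1 * γ, z.2 * γ)) ?_ ?_)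
    · rintro ⟨a, b⟩ h
      simp only [Finset.mem_coe, Finset.mem_filter, Finset.mem_product] at h ⊢
      refine ⟨⟨hQ _ h.1.1 _ hγ, hQ _ h.1.2 _ hγ⟩, ?_⟩
      rw [← h.2]
      ring
    · rintro ⟨a, b⟩ _ ⟨c, d⟩ _ h
      simp only [Prod.mk.injEq, mul_left_inj' hγ0] at h
      exact Prod.ext h.1 h.2
  have hfourier : ((p * ∑ γ ∈ Γ, (((Q ×ˢ Q).filter fun z => z.1 - z.2 = γ * x).card : ℝ) : ℝ) : ℂ) =
      ∑ ξ : ZMod p, ((‖charSum Q ξ‖ ^ 2 : ℝ) : ℂ) * charSum Γ (-(ξ * x)) := by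
    have h1 : ∀ ξ : ZMod p, ((‖charSum Q ξ‖ ^ 2 : ℝ) : ℂ) * charSum Γ (-(ξ * x)) =
        ∑ γ ∈ Γ, ∑ z ∈ Q ×ˢ Q, ZMod.stdAddChar (ξ * (z.1 - z.2 - γ * x)) := by
      intro ξ
      rw [ofReal_norm_charSum_sq, charSum, ← Finset.sum_product' Q Q
        fun a b => (ZMod.stdAddChar (ξ * (a - b)) : ℂ), Finset.sum_mul_sum, Finset.sum_comm]
      refine Finset.sum_congr rfl fun γ _ => Finset.sum_congr rfl fun z _ => ?_
      rw [← AddChar.map_add_eq_mul]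
      congr 1
      ring
    simp_rw [h1]
    rw [Finset.sum_comm]
    push_cast
    rw [Finset.mul_sum]
    refine Finset.sum_congr rfl fun γ _ => ?_
    rw [Finset.sum_comm]
    simp_rw [sum_stdAddChar_mul, sub_eq_zero (b := γ * x)]
    rw [← Finset.sum_filter, Finset.sum_const, nsmul_eq_mul, mul_comm]
  have hnorm : (p : ℝ) * ∑ γ ∈ Γ, (((Q ×ˢ Q).filter fun z => z.1 - z.2 = γ * x).card : ℝ) ≤
      ∑ ξ : ZMod p, ‖charSum Q ξ‖ ^ 2 * ‖charSum Γ (-(ξ * x))‖ := by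
    refine (Real.le_norm_self _).trans ?_
    rw [← Complex.norm_real, hfourier]
    refine (norm_sum_le _ _).trans (le_of_eq (Finset.sum_congr rfl fun ξ _ => ?_))
    rw [norm_mul, Complex.norm_real, Real.norm_of_nonneg (by positivity)]
  have hbound : ∑ ξ : ZMod p, ‖charSum Q ξ‖ ^ 2 * ‖charSum Γ (-(ξ * x))‖ ≤
      (Q.card : ℝ) ^ 2 * Γ.card + B * (p * Q.card) := by
    rw [← sum_norm_charSum_sq, Finset.mul_sum, ← Finset.add_sum_erase _ _ (Finset.mem_univ (0 : ZMod p))]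
    refine add_le_add ?_ ?_
    · exact mul_le_mul (pow_le_pow_left₀ (norm_nonneg _) (norm_charSum_le _ _) 2) (norm_charSum_le _ _)
        (norm_nonneg _) (by positivity)
    · refine (Finset.sum_le_sum fun ξ hξ => ?_).trans
        (Finset.sum_le_sum_of_subset_of_nonneg (Finset.subset_univ _) fun ξ _ _ => by positivity)
      rw [mul_comm]
      exact mul_le_mul_of_nonneg_right
        (hB _ (neg_ne_zero.mpr (mul_ne_zero (Finset.ne_of_mem_erase hξ) hx))) (by positivity)
  have hp0 : (0 : ℝ) ≤ p := Nat.cast_nonneg _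
  exact (mul_le_mul_of_nonneg_left hcount hp0).trans (hnorm.trans hbound)

end Representations

section EnergyComparison

variable {G : Type*} [AddCommGroup G] [DecidableEq G]

theorem energy_le_of_representations_le {A Q : Finset G} {R : ℝ}
    (hR : ∀ x : G, x ≠ 0 → (((Q ×ˢ Q).filter fun z => z.1 - z.2 = x).card : ℝ) ≤ R) (hR0 : 0 ≤ R) :
    (EplusTwo A Q : ℝ) ≤ A.card * Q.card + (A.card : ℝ) ^ 2 * R := by
  have h1 : EplusTwo A Q = ∑ w ∈ A ×ˢ A, ((Q ×ˢ Q).filter fun z => z.1 - z.2 = w.2 - w.1).card := by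
    rw [EplusTwo, Finset.card_filter, Finset.sum_product, Finset.sum_product]
    refine Finset.sum_congr rfl fun a _ => ?_
    rw [Finset.sum_product]
    refine Finset.sum_congr rfl fun b _ => ?_
    rw [Finset.card_filter]
    refine Finset.sum_congr rfl fun z _ => ?_
    congr 1
    simp only [eq_iff_iff]
    rw [sub_eq_sub_iff_add_eq_add, add_comm z.1 a, eq_comm]
  have h2 : ∀ w ∈ A ×ˢ A, (((Q ×ˢ Q).filter fun z => z.1 - z.2 = w.2 - w.1).card : ℝ) ≤
      (if w.1 = w.2 then (Q.card : ℝ) else 0) + R := by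
    intro w _
    split_ifs with h
    · have : ((Q ×ˢ Q).filter fun z => z.1 - z.2 = w.2 - w.1).card ≤ Q.card := by
        refine Finset.card_le_card_of_injOn (fun z => z.1)
          (fun z hz => (Finset.mem_product.mp (Finset.mem_filter.mp hz).1).1) ?_
        rintro ⟨a, b⟩ hz ⟨c, d⟩ hz' (rfl : a = c)
        have h3 := (Finset.mem_filter.mp hz).2
        have h4 := (Finset.mem_filter.mp hz').2
        rw [h, sub_self, sub_eq_zero] at h3 h4
        exact Prod.ext rfl (h3.symm.trans h4)
      have : (((Q ×ˢ Q).filter fun z => z.1 - z.2 = w.2 - w.1).card : ℝ) ≤ Q.card := by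
        exact_mod_cast this
      linarith
    · rw [zero_add]
      exact hR _ (sub_ne_zero.mpr (Ne.symm h))
  rw [h1, Nat.cast_sum]
  refine (Finset.sum_le_sum h2).trans (le_of_eq ?_)
  rw [Finset.sum_add_distrib, Finset.sum_const, Finset.card_product, nsmul_eq_mul, Finset.sum_product]
  simp only [Finset.sum_ite_eq]
  rw [Finset.sum_ite_mem, Finset.inter_self, Finset.sum_const, nsmul_eq_mul]
  push_cast
  ring

theorem card_sq_mul_card_sq_le (A Q : Finset G) :
    A.card ^ 2 * Q.card ^ 2 ≤ (A + Q).card * EplusTwo A Q := by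
  refine (Finset.le_card_add_mul_addEnergy A Q).trans (Nat.mul_le_mul_left _ (le_of_eq ?_))
  rw [EplusTwo]
  refine Finset.card_bij' (fun x _ => (x.1.1, x.1.2, x.2.1, x.2.2))
    (fun x _ => ((x.1, x.2.1), (x.2.2.1, x.2.2.2))) ?_ ?_ (fun _ _ => rfl) (fun _ _ => rfl)
  · intro x hx
    simpa only [Finset.mem_filter, Finset.mem_product, and_assoc] using hx
  · intro x hx
    simpa only [Finset.mem_filter, Finset.mem_product, and_assoc] using hx

end EnergyComparison

section Main

variable {p : ℕ} [Fact p.Prime]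

theorem representations_le_rpow {δ : ℝ} (hδ : 0 < δ) {Γ Q : Finset (ZMod p)} (hΓ : IsMulSubgroup Γ)
    (hcard : (p : ℝ) ^ δ ≤ Γ.card) (hQ : ∀ q ∈ Q, ∀ γ ∈ Γ, q * γ ∈ Q)
    (hsize : (Q.card : ℝ) ^ 2 * Γ.card ≤ (p : ℝ) ^ 2) {x : ZMod p} (hx : x ≠ 0) :
    (((Q ×ˢ Q).filter fun z => z.1 - z.2 = x).card : ℝ) ≤
      (1 + 4 * 62500 ^ ⌈2 / δ - 2⌉₊) *
        (Q.card * (p : ℝ) ^ (-(δ / (2 : ℝ) ^ ((7 : ℝ) + 2 / δ)))) := by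
  have hp0 : (0 : ℝ) < p := by exact_mod_cast (Fact.out : p.Prime).pos
  have hp1 : (1 : ℝ) ≤ p := by exact_mod_cast (Fact.out : p.Prime).one_le
  have ht : (0 : ℝ) < Γ.card := (Real.rpow_pos_of_pos hp0 δ).trans_le hcard
  have hrep := card_mul_representations_le (B := 4 * 62500 ^ ⌈2 / δ - 2⌉₊ * Γ.card *
    (p : ℝ) ^ (-(δ / (2 : ℝ) ^ ((7 : ℝ) + 2 / δ)))) hΓ hQ
    (fun y hy => norm_charSum_le_rpow hδ hΓ hcard hy) (by positivity) hx
  have hε : δ / (2 : ℝ) ^ ((7 : ℝ) + 2 / δ) ≤ δ / 2 := by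
    refine div_le_div_of_nonneg_left hδ.le (by norm_num) ?_
    have h2 : (0 : ℝ) < 2 / δ := by positivity
    calc (2 : ℝ) = 2 ^ (1 : ℝ) := (Real.rpow_one 2).symm
      _ ≤ _ := Real.rpow_le_rpow_of_exponent_le (by norm_num) (by linarith)
  have hQp : (Q.card : ℝ) ≤ p * (p : ℝ) ^ (-(δ / (2 : ℝ) ^ ((7 : ℝ) + 2 / δ))) := by
    have h1 : (Q.card : ℝ) ≤ p * (p : ℝ) ^ (-(δ / 2)) := by
      refine le_of_sq_le_sq ?_ (by positivity)
      have h2 : ((p : ℝ) ^ (-(δ / 2))) ^ 2 = ((p : ℝ) ^ δ)⁻¹ := by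
        rw [← Real.rpow_natCast, ← Real.rpow_mul hp0.le, ← Real.rpow_neg hp0.le]
        congr 1
        push_cast
        ring
      rw [mul_pow, h2, ← div_eq_mul_inv, le_div_iff₀ (by positivity)]
      exact (mul_le_mul_of_nonneg_left hcard (by positivity)).trans hsize
    refine h1.trans (mul_le_mul_of_nonneg_left ?_ hp0.le)
    exact Real.rpow_le_rpow_of_exponent_le hp1 (by linarith)
  generalize (p : ℝ) ^ (-(δ / (2 : ℝ) ^ ((7 : ℝ) + 2 / δ))) = u at *
  generalize 4 * (62500 : ℝ) ^ ⌈2 / δ - 2⌉₊ = K at *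
  refine le_of_mul_le_mul_left ?_ (mul_pos hp0 ht)
  have h3 : (Q.card : ℝ) * Γ.card * Q.card ≤ Q.card * Γ.card * (p * u) :=
    mul_le_mul_of_nonneg_left hQp (by positivity)
  linarith

/-- Lower bound for a sumset from an upper bound for the common energy. -/
theorem le_card_add_of_energy_le {A Q : Finset (ZMod p)} {C m : ℝ} (hC : 0 < C) (hA : A.Nonempty)
    (hQ : Q.Nonempty) (hE : EplusTwo A Q * m ≤ C * (A.card ^ 2 * Q.card)) (hm : 0 < m) :
    1 / C * Q.card * m ≤ (A + Q).card := by
  have ha : (0 : ℝ) < A.card := by exact_mod_cast hA.card_pos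
  have hq : (0 : ℝ) < Q.card := by exact_mod_cast hQ.card_pos
  have hCS : (A.card : ℝ) ^ 2 * (Q.card : ℝ) ^ 2 ≤ (A + Q).card * EplusTwo A Q := by
    exact_mod_cast card_sq_mul_card_sq_le A Q
  have h1 : (A.card : ℝ) ^ 2 * (Q.card : ℝ) ^ 2 * m ≤
      (A + Q).card * (C * (A.card ^ 2 * Q.card)) := by
    calc _ ≤ (A + Q).card * EplusTwo A Q * m := by gcongr
      _ = (A + Q).card * (EplusTwo A Q * m) := by ring
      _ ≤ _ := by gcongr
  rw [one_div, mul_assoc, inv_mul_le_iff₀ hC]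
  refine le_of_mul_le_mul_left ?_ (mul_pos (pow_pos ha 2) hq)
  linarith

end Main

/-- for every `δ > 0` there are `C = C(δ) > 0` and `c = c(δ) > 0` such that
for every prime `p`, every multiplicative subgroup `Γ ⊆ F_p^*` with `|Γ| ≥ p^δ`, every
`Q ⊆ F_p^*` with `QΓ = Q` and `|Q|²|Γ| ≤ p²`, and every `A ⊆ F_p`:
`E⁺(A,Q) ≤ C (|Q||A|² p^{−δ/2^{7+2/δ}} log|Q| + |A||Q|)` and
`|A+Q| ≥ c |Q| min{|A|, p^{δ/2^{7+2/δ}}/log|Q|}`. -/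
theorem stmt_10 :
    ∀ δ : ℝ, 0 < δ →
      ∃ C c : ℝ, 0 < C ∧ 0 < c ∧
        ∀ (p : ℕ) [Fact p.Prime],
          ∀ (Γ Q : Finset (ZMod p)), IsMulSubgroup Γ →
            (p : ℝ) ^ δ ≤ Γ.card →
            (0 : ZMod p) ∉ Q → Q * Γ = Q →
            ((Q.card : ℝ) ^ 2 * Γ.card ≤ (p : ℝ) ^ 2) →
            ∀ A : Finset (ZMod p),
              (EplusTwo A Q : ℝ) ≤
                C * ((Q.card : ℝ) * (A.card : ℝ) ^ 2 *
                      (p : ℝ) ^ (-(δ / (2 : ℝ) ^ ((7 : ℝ) + 2 / δ))) * Real.logb 2 Q.card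
                    + (A.card : ℝ) * Q.card) ∧
              c * (Q.card : ℝ) *
                  min (A.card : ℝ)
                    ((p : ℝ) ^ (δ / (2 : ℝ) ^ ((7 : ℝ) + 2 / δ)) / Real.logb 2 Q.card) ≤
                ((A + Q).card : ℝ) := by
  intro δ hδ
  have hC1 : (1 : ℝ) ≤ 1 + 4 * 62500 ^ ⌈2 / δ - 2⌉₊ := by
    linarith [pow_pos (show (0 : ℝ) < 62500 by norm_num) ⌈2 / δ - 2⌉₊]
  obtain ⟨C, hC⟩ : ∃ C : ℝ, C = 1 + 4 * 62500 ^ ⌈2 / δ - 2⌉₊ := ⟨_, rfl⟩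
  rw [← hC] at hC1
  refine ⟨C, 1 / (2 * C), by linarith, by positivity, ?_⟩
  intro p _ Γ Q hΓ hcard hQ0 hQΓ hsize A
  have hp1 : (1 : ℝ) < p := by exact_mod_cast (Fact.out : p.Prime).one_lt
  have hp0 : (0 : ℝ) < p := by linarith
  have hQ : ∀ q ∈ Q, ∀ γ ∈ Γ, q * γ ∈ Q := fun q hq γ hγ => by
    rw [← hQΓ]
    exact Finset.mul_mem_mul hq hγ
  have hrep : ∀ x : ZMod p, x ≠ 0 → (((Q ×ˢ Q).filter fun z => z.1 - z.2 = x).card : ℝ) ≤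
      C * (Q.card * (p : ℝ) ^ (-(δ / (2 : ℝ) ^ ((7 : ℝ) + 2 / δ)))) := fun x hx =>
    hC ▸ representations_le_rpow hδ hΓ hcard hQ hsize hx
  have hE := energy_le_of_representations_le (A := A) hrep (by positivity)
  rcases Q.eq_empty_or_nonempty with rfl | hne
  · simp [EplusTwo]
  have hL : 1 ≤ Real.logb 2 Q.card := by
    obtain ⟨q, hq⟩ := hne
    have hΓQ : (Γ.card : ℝ) ≤ Q.card := by
      exact_mod_cast card_le_card_of_mul_mem (ne_of_mem_of_not_mem hq hQ0) (hQ q hq)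
    have h1 : 1 < (Q.card : ℝ) := (Real.one_lt_rpow hp1 hδ).trans_le (hcard.trans hΓQ)
    have h2 : (2 : ℝ) ≤ Q.card := by exact_mod_cast (Nat.one_lt_cast.mp h1 : 1 < Q.card)
    rw [Real.le_logb_iff_rpow_le (by norm_num) (by linarith), Real.rpow_one]
    exact h2
  rw [Real.rpow_neg hp0.le] at hE ⊢
  have hu : 0 < (p : ℝ) ^ (δ / (2 : ℝ) ^ ((7 : ℝ) + 2 / δ)) := Real.rpow_pos_of_pos hp0 _
  generalize (p : ℝ) ^ (δ / (2 : ℝ) ^ ((7 : ℝ) + 2 / δ)) = u at *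
  generalize Real.logb 2 Q.card = L at *
  have hL0 : 0 < L := by linarith
  have henergy : (EplusTwo A Q : ℝ) ≤
      C * ((Q.card : ℝ) * (A.card : ℝ) ^ 2 * u⁻¹ * L + (A.card : ℝ) * Q.card) := by
    have h1 : (A.card : ℝ) * Q.card ≤ C * (A.card * Q.card) :=
      le_mul_of_one_le_left (by positivity) hC1
    have h2 : C * ((Q.card : ℝ) * (A.card : ℝ) ^ 2 * u⁻¹) ≤
        C * ((Q.card : ℝ) * (A.card : ℝ) ^ 2 * u⁻¹) * L :=
      le_mul_of_one_le_right (by positivity) hL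
    linarith
  refine ⟨henergy, ?_⟩
  rcases A.eq_empty_or_nonempty with rfl | hA
  · simp [min_eq_left (div_pos hu hL0).le]
  have ha : (0 : ℝ) < A.card := by exact_mod_cast hA.card_pos
  have hm : 0 < min (A.card : ℝ) (u / L) := lt_min ha (div_pos hu hL0)
  refine le_card_add_of_energy_le (by linarith) hA hne ?_ hm
  have h1 : u⁻¹ * L * min (A.card : ℝ) (u / L) ≤ 1 := by
    calc _ ≤ u⁻¹ * L * (u / L) := by gcongr; exact min_le_right _ _
      _ = 1 := by field_simp
  have h2 : min (A.card : ℝ) (u / L) ≤ A.card := min_le_left _ _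
  generalize min (A.card : ℝ) (u / L) = m at *
  calc EplusTwo A Q * m
      ≤ C * ((Q.card : ℝ) * (A.card : ℝ) ^ 2 * u⁻¹ * L + (A.card : ℝ) * Q.card) * m := by gcongr
    _ = C * (Q.card * A.card ^ 2 * (u⁻¹ * L * m) + A.card * Q.card * m) := by ring
    _ ≤ C * (Q.card * A.card ^ 2 * 1 + A.card * Q.card * A.card) := by gcongr
    _ = 2 * C * (A.card ^ 2 * Q.card) := by ring
end

section
/- There is an absolute constant C ≥ 1 such that the following holds. Let A, B ⊂ R be finite sets with |A|, |B| ≥ 2, and M ≥ 1 a real number with |AB| ≤ M|A|. Then for every integer k ≥ 2 one has T⁺_{2^k}(A) ≤ 16^{k²} C^{k−1} M^{(3/2)(2^k−1)} (log|A|)^{4(k−1)} · |A|^{2^{k+1}−1} · |B|^{−k/2}. -/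
open Finset Pointwise

/-- `T⁺_m(A) = #{(a1,…,am,a1',…,am') ∈ A^{2m} : a1+⋯+am = a1'+⋯+am'}`. -/
def Tplus {G : Type*} [AddCommMonoid G] [DecidableEq G] (m : ℕ) (A : Finset G) : ℕ :=
  (((Fintype.piFinset fun _ : Fin m => A) ×ˢ (Fintype.piFinset fun _ : Fin m => A)).filter
    fun x => ∑ i, x.1 i = ∑ i, x.2 i).card

section Collisions

variable {ι α β : Type*} [DecidableEq α] [DecidableEq β]

/-- The number of collisions of `f` on `S` is the sum of the squares of the fibre sizes. -/
theorem card_collisions_eq_sum_sq (S : Finset ι) (f : ι → α) (K : Finset α)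
    (hK : ∀ z ∈ S, f z ∈ K) :
    #{p ∈ S ×ˢ S | f p.1 = f p.2} = ∑ a ∈ K, #{z ∈ S | f z = a} ^ 2 := by
  rw [card_eq_sum_card_fiberwise (f := fun p : ι × ι => f p.1) (t := K)]
  · refine sum_congr rfl fun a _ => ?_
    rw [sq, ← card_product]
    congr 1
    ext ⟨x, y⟩
    simp only [mem_filter, mem_product]
    constructor
    · rintro ⟨⟨⟨h1, h2⟩, h3⟩, h4⟩
      exact ⟨⟨h1, h4⟩, h2, h3 ▸ h4⟩
    · rintro ⟨⟨h1, h2⟩, h3, h4⟩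
      exact ⟨⟨⟨h1, h3⟩, h2.trans h4.symm⟩, h2⟩
  · intro p hp
    simp only [coe_filter, mem_product, Set.mem_ofPred_eq] at hp
    exact hK _ hp.1.1

/-- Refining a colouring by another one with values in `K` divides the number of collisions
by at most `#K`. -/
theorem card_collisions_le_mul (S : Finset ι) (f : ι → α) (g : ι → β) (K : Finset β)
    (hK : ∀ z ∈ S, g z ∈ K) :
    #{p ∈ S ×ˢ S | f p.1 = f p.2} ≤
      #K * #{p ∈ S ×ˢ S | f p.1 = f p.2 ∧ g p.1 = g p.2} := by
  have h1 := card_collisions_eq_sum_sq S f (S.image f) fun z hz => mem_image_of_mem f hz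
  have h2 := card_collisions_eq_sum_sq S (fun z => (f z, g z)) (S.image f ×ˢ K)
    fun z hz => mem_product.2 ⟨mem_image_of_mem f hz, hK z hz⟩
  simp only [Prod.mk.injEq] at h2
  rw [h1, h2, sum_product, mul_sum]
  refine sum_le_sum fun a _ => ?_
  have h3 : #{z ∈ S | f z = a} = ∑ b ∈ K, #{z ∈ S | f z = a ∧ g z = b} := by
    rw [card_eq_sum_card_fiberwise (f := g) (t := K)]
    · simp only [filter_filter]
    · intro z hz
      exact hK z (mem_filter.1 hz).1
  rw [h3]
  simp only [Prod.mk.injEq]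
  exact sq_sum_le_card_mul_sum_sq (α := ℕ)

end Collisions

section Cells

variable {ι : Type*}

/-- The line can be cut into `s` intervals, each containing about the same number of the values
`σ u`, `u ∈ U`: few pairs of distinct values share an interval. -/
theorem exists_monotone_cells (U : Finset ι) (σ : ι → ℝ) {s : ℕ} (hs : 0 < s) :
    ∃ φ : ℝ → ℕ, Monotone φ ∧ (∀ u ∈ U, φ (σ u) < s) ∧
      s * #{p ∈ U ×ˢ U | σ p.1 ≠ σ p.2 ∧ φ (σ p.1) = φ (σ p.2)} ≤ 2 * #U ^ 2 := by
  classical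
  set F : ℝ → ℕ := fun x => #{u ∈ U | σ u < x} with hF
  have hFm : Monotone F := fun x y hxy =>
    card_le_card fun u hu => by
      simp only [mem_filter] at hu ⊢
      exact ⟨hu.1, hu.2.trans_le hxy⟩
  set φ : ℝ → ℕ := fun x => F x * s / #U with hφ
  have hlt : s * #{p ∈ U ×ˢ U | σ p.1 < σ p.2 ∧ φ (σ p.1) = φ (σ p.2)} ≤ #U ^ 2 := by
    rw [card_eq_sum_card_fiberwise (f := fun p : ι × ι => p.2) (t := U), mul_sum, sq,
      ← smul_eq_mul (#U), ← sum_const]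
    · refine sum_le_sum fun y hy => ?_
      have hn : 0 < #U := card_pos.2 ⟨y, hy⟩
      set W := U.filter fun u => σ u < σ y ∧ φ (σ u) = φ (σ y) with hW
      have hc : #{p ∈ {p ∈ U ×ˢ U | σ p.1 < σ p.2 ∧ φ (σ p.1) = φ (σ p.2)} | p.2 = y} ≤ #W := by
        refine card_le_card_of_injOn Prod.fst ?_ ?_
        · rintro ⟨a, b⟩ h
          simp only [coe_filter, mem_filter, mem_product, Set.mem_ofPred_eq] at h
          obtain ⟨⟨⟨h1, h2⟩, h3⟩, rfl⟩ := h
          simp only [hW, coe_filter, Set.mem_ofPred_eq]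
          exact ⟨h1, h3⟩
        · rintro ⟨a, b⟩ h ⟨a', b'⟩ h' haa
          simp only [coe_filter, mem_filter, Set.mem_ofPred_eq] at h h'
          simp only [Prod.mk.injEq]
          exact ⟨haa, h.2.trans h'.2.symm⟩
      refine (Nat.mul_le_mul_left s hc).trans ?_
      rcases W.eq_empty_or_nonempty with h0 | h0
      · simp [h0]
      obtain ⟨u₀, hu₀, hmin⟩ := exists_min_image W σ h0
      have hsum : #W + F (σ u₀) ≤ F (σ y) := by
        rw [hF, ← card_union_of_disjoint]
        · refine card_le_card fun u hu => ?_
          simp only [mem_union, mem_filter, hW] at hu ⊢ hu₀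
          rcases hu with hu | hu
          · exact ⟨hu.1, hu.2.1⟩
          · exact ⟨hu.1, hu.2.trans hu₀.2.1⟩
        · rw [disjoint_left]
          intro u hu hu'
          exact (hmin u hu).not_gt (mem_filter.1 hu').2
      have he : F (σ u₀) * s / #U = F (σ y) * s / #U := (mem_filter.1 hu₀).2.2
      have h1 : F (σ y) * s < #U * (F (σ y) * s / #U + 1) := Nat.lt_mul_div_succ _ hn
      have h2 : #U * (F (σ u₀) * s / #U) ≤ F (σ u₀) * s := Nat.mul_div_le _ _
      rw [he] at h2
      nlinarith
    · rintro ⟨a, b⟩ h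
      simp only [coe_filter, mem_product, Set.mem_ofPred_eq] at h
      exact h.1.2
  refine ⟨φ, fun x y hxy => Nat.div_le_div_right (Nat.mul_le_mul_right s (hFm hxy)),
    fun u hu => ?_, ?_⟩
  · rw [hφ, Nat.div_lt_iff_lt_mul (card_pos.2 ⟨u, hu⟩), mul_comm]
    refine Nat.mul_lt_mul_of_pos_left (card_lt_card ?_) hs
    exact ⟨filter_subset _ _, fun h => lt_irrefl _ (mem_filter.1 (h hu)).2⟩
  · have hsub : #{p ∈ U ×ˢ U | σ p.1 ≠ σ p.2 ∧ φ (σ p.1) = φ (σ p.2)} ≤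
        2 * #{p ∈ U ×ˢ U | σ p.1 < σ p.2 ∧ φ (σ p.1) = φ (σ p.2)} := by
      rw [two_mul]
      nth_rewrite 2 [← card_map (Equiv.prodComm ι ι).toEmbedding]
      refine (card_le_card ?_).trans (card_union_le _ _)
      rintro ⟨a, b⟩ h
      rw [mem_filter] at h
      rcases lt_or_gt_of_ne h.2.1 with hl | hl
      · exact mem_union_right _ (mem_filter.2 ⟨h.1, hl, h.2.2⟩)
      · exact mem_union_left _ (mem_map.2 ⟨(b, a), mem_filter.2
          ⟨mem_product.2 (mem_product.1 h.1).symm, hl, h.2.2.symm⟩, rfl⟩)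
    calc _ ≤ s * (2 * _) := Nat.mul_le_mul_left s hsub
      _ = 2 * (s * _) := by ring
      _ ≤ _ := Nat.mul_le_mul_left 2 hlt

end Cells

section Energy

variable {ι κ : Type*}

/-- If the values `σ u` (`u ∈ U`), dilated by any `b ∈ B`, are among the values `τ v` (`v ∈ V`),
then the additive energy of `σ` is small. This replaces the Szemerédi–Trotter theorem: the
incidences involved lie on a Cartesian product. -/
theorem card_mul_energy_le (U : Finset ι) (σ : ι → ℝ) (V : Finset κ) (τ : κ → ℝ) (B : Finset ℝ)
    (hB : (0 : ℝ) ∉ B) (θ : ℝ → ι → κ) (hθV : ∀ b ∈ B, ∀ u ∈ U, θ b u ∈ V)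
    (hθ : ∀ b ∈ B, Function.Injective (θ b)) (hτ : ∀ b ∈ B, ∀ u ∈ U, τ (θ b u) = b * σ u)
    {s : ℕ} (hs : 0 < s) :
    s * #B * #{p ∈ (U ×ˢ U) ×ˢ (U ×ˢ U) | σ p.1.2 - σ p.1.1 = σ p.2.2 - σ p.2.1} ≤
      3 * s ^ 2 * #B * #{p ∈ U ×ˢ U | σ p.1 = σ p.2} ^ 2 + 12 * #U ^ 2 * #V ^ 2 := by
  classical
  obtain ⟨φ, hφ, hφs, hφc⟩ := exists_monotone_cells U σ hs
  obtain ⟨ψ, hψ, hψs, hψc⟩ := exists_monotone_cells V τ hs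
  set E := #{p ∈ (U ×ˢ U) ×ˢ (U ×ˢ U) | σ p.1.2 - σ p.1.1 = σ p.2.2 - σ p.2.1} with hE
  set T := #{p ∈ U ×ˢ U | σ p.1 = σ p.2} with hT
  set P : Finset (ι × ι) := {p ∈ U ×ˢ U | σ p.1 ≠ σ p.2 ∧ φ (σ p.1) = φ (σ p.2)} with hP
  set Q : Finset (κ × κ) := {p ∈ V ×ˢ V | τ p.1 ≠ τ p.2 ∧ ψ (τ p.1) = ψ (τ p.2)} with hQ
  set R : ℝ → Finset ((ι × ι) × (ι × ι)) := fun b => {p ∈ (U ×ˢ U) ×ˢ (U ×ˢ U) |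
    σ p.1.2 - σ p.1.1 = σ p.2.2 - σ p.2.1 ∧ σ p.1.1 ≠ σ p.2.1 ∧
      φ (σ p.1.1) = φ (σ p.2.1) ∧ ψ (b * σ p.1.2) = ψ (b * σ p.2.2)} with hR
  have key : ∀ b ∈ B, E ≤ 3 * s * (T ^ 2 + #(R b)) := by
    intro b hb
    set g : ι × ι → ℤ := fun z => φ (σ z.1) + SignType.sign b * ψ (b * σ z.2) with hg
    have hgK : ∀ z ∈ U ×ˢ U, g z ∈ Ico (-s : ℤ) (2 * s) := by
      rintro ⟨x, y⟩ hz
      obtain ⟨hx, hy⟩ := mem_product.1 hz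
      have h1 := hφs x hx
      have h2 := hψs _ (hθV b hb y hy)
      rw [hτ b hb y hy] at h2
      simp only [hg, mem_Ico]
      rcases lt_trichotomy b 0 with h | h | h
      · simp only [sign_neg h, SignType.coe_neg_one]; omega
      · exact absurd (h ▸ hb) hB
      · simp only [sign_pos h, SignType.coe_one]; omega
    have h1 := card_collisions_le_mul (U ×ˢ U) (fun z => σ z.2 - σ z.1) g _ hgK
    have hc : #(Ico (-s : ℤ) (2 * s)) = 3 * s := by
      rw [Int.card_Ico]; omega
    rw [hc] at h1
    refine h1.trans (Nat.mul_le_mul_left _ ?_)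
    have hgeq : ∀ x₁ x₂ y₁ y₂ : ι, σ y₁ - σ x₁ = σ y₂ - σ x₂ → g (x₁, y₁) = g (x₂, y₂) →
        σ x₁ ≤ σ x₂ → φ (σ x₁) = φ (σ x₂) ∧ ψ (b * σ y₁) = ψ (b * σ y₂) := by
      intro x₁ x₂ y₁ y₂ hd hgg hx
      have hy : σ y₁ ≤ σ y₂ := by linarith
      have h1 := hφ hx
      simp only [hg] at hgg
      rcases lt_trichotomy b 0 with h | h | h
      · have h2 := hψ (mul_le_mul_of_nonpos_left hy h.le)
        simp only [sign_neg h, SignType.coe_neg_one] at hgg; omega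
      · exact absurd (h ▸ hb) hB
      · have h2 := hψ (mul_le_mul_of_nonneg_left hy h.le)
        simp only [sign_pos h, SignType.coe_one] at hgg; omega
    have hT2 : T ^ 2 = #{p ∈ (U ×ˢ U) ×ˢ (U ×ˢ U) | σ p.1.1 = σ p.2.1 ∧ σ p.1.2 = σ p.2.2} := by
      rw [sq, hT, ← card_product]
      refine card_equiv (Equiv.prodProdProdComm ι ι ι ι) ?_
      rintro ⟨⟨a, b⟩, c, d⟩
      simp only [mem_product, mem_filter, Equiv.prodProdProdComm_apply]
      tauto
    rw [hT2]
    refine (card_le_card ?_).trans (card_union_le _ _)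
    rintro ⟨⟨x₁, y₁⟩, x₂, y₂⟩ h
    simp only [mem_filter, mem_union, hR] at h ⊢
    obtain ⟨hm, hd, hgg⟩ := h
    by_cases hx : σ x₁ = σ x₂
    · exact Or.inl ⟨hm, hx, by linarith⟩
    · refine Or.inr ⟨hm, hd, hx, ?_⟩
      rcases le_total (σ x₁) (σ x₂) with hl | hl
      · exact hgeq _ _ _ _ hd hgg hl
      · exact (hgeq _ _ _ _ hd.symm hgg.symm hl).imp Eq.symm Eq.symm
  have hRsum : ∑ b ∈ B, #(R b) ≤ #P * #Q := by
    rw [← card_sigma, ← card_product]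
    refine card_le_card_of_injOn
      (fun q => ((q.2.1.1, q.2.2.1), (θ q.1 q.2.1.2, θ q.1 q.2.2.2))) ?_ ?_
    · rintro ⟨b, ⟨x₁, y₁⟩, x₂, y₂⟩ h
      simp only [coe_sigma, Set.mem_sigma_iff, mem_coe, hR, mem_filter, mem_product] at h
      obtain ⟨hb, ⟨⟨hx₁, hy₁⟩, hx₂, hy₂⟩, hd, hne, h1, h2⟩ := h
      simp only [coe_product, Set.mem_prod, mem_coe, hP, hQ, mem_filter,
        mem_product, hτ b hb _ hy₁, hτ b hb _ hy₂]
      refine ⟨⟨⟨hx₁, hx₂⟩, hne, h1⟩, ⟨hθV b hb _ hy₁, hθV b hb _ hy₂⟩, fun h => hne ?_, h2⟩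
      have hb0 : b ≠ 0 := fun h => hB (h ▸ hb)
      have := mul_left_cancel₀ hb0 h
      linarith
    · rintro ⟨b, ⟨x₁, y₁⟩, x₂, y₂⟩ h ⟨b', ⟨x₁', y₁'⟩, x₂', y₂'⟩ h' heq
      simp only [coe_sigma, Set.mem_sigma_iff, mem_coe, hR, mem_filter, mem_product] at h h'
      obtain ⟨hb, ⟨⟨hx₁, hy₁⟩, hx₂, hy₂⟩, hd, hne, h1, h2⟩ := h
      obtain ⟨hb', ⟨⟨-, hy₁'⟩, -, hy₂'⟩, hd', -, -, -⟩ := h'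
      simp only [Prod.mk.injEq] at heq
      obtain ⟨⟨rfl, rfl⟩, e1, e2⟩ := heq
      have t1 := congrArg τ e1
      have t2 := congrArg τ e2
      rw [hτ b hb _ hy₁, hτ b' hb' _ hy₁'] at t1
      rw [hτ b hb _ hy₂, hτ b' hb' _ hy₂'] at t2
      have hbb : b = b' := by
        have hz : (b - b') * (σ x₁ - σ x₂) = 0 := by
          have e : σ x₁ - σ x₂ = σ y₁ - σ y₂ := by linarith
          have e' : σ x₁ - σ x₂ = σ y₁' - σ y₂' := by linarith
          rw [sub_mul]
          nth_rewrite 1 [e]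
          rw [e']
          linarith
        rcases mul_eq_zero.1 hz with h | h
        · linarith
        · exact absurd (sub_eq_zero.1 h) hne
      subst hbb
      rw [hθ b hb e1, hθ b hb e2]
  have hsumE : #B * E ≤ 3 * s * (#B * T ^ 2 + #P * #Q) := by
    calc #B * E = ∑ b ∈ B, E := by simp
      _ ≤ ∑ b ∈ B, 3 * s * (T ^ 2 + #(R b)) := sum_le_sum key
      _ = 3 * s * (#B * T ^ 2 + ∑ b ∈ B, #(R b)) := by
        rw [← mul_sum, sum_add_distrib, sum_const, smul_eq_mul]
      _ ≤ _ := by gcongr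
  have hPQ := Nat.mul_le_mul hφc hψc
  calc s * #B * E = s * (#B * E) := by ring
    _ ≤ s * (3 * s * (#B * T ^ 2 + #P * #Q)) := by gcongr
    _ = 3 * s ^ 2 * #B * T ^ 2 + 3 * (s * #P * (s * #Q)) := by ring
    _ ≤ 3 * s ^ 2 * #B * T ^ 2 + 3 * (2 * #U ^ 2 * (2 * #V ^ 2)) := by gcongr
    _ = _ := by ring

end Energy

section Tplus

theorem Tplus_add_self (m : ℕ) (A : Finset ℝ) :
    Tplus (m + m) A =
      #{p ∈ ((Fintype.piFinset fun _ : Fin m => A) ×ˢ (Fintype.piFinset fun _ : Fin m => A)) ×ˢ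
          ((Fintype.piFinset fun _ : Fin m => A) ×ˢ (Fintype.piFinset fun _ : Fin m => A)) |
        ∑ i, p.1.2 i - ∑ i, p.1.1 i = ∑ i, p.2.2 i - ∑ i, p.2.1 i} := by
  rw [Tplus]
  symm
  refine card_bij (fun p _ => (Fin.append p.1.2 p.2.1, Fin.append p.2.2 p.1.1)) ?_ ?_ ?_
  · rintro ⟨⟨a, b⟩, c, d⟩ h
    simp only [mem_filter, mem_product, Fintype.mem_piFinset, Fin.sum_univ_add, Fin.append_left,
      Fin.append_right] at h ⊢
    obtain ⟨⟨⟨ha, hb⟩, hc, hd⟩, he⟩ := h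
    refine ⟨⟨fun i => ?_, fun i => ?_⟩, by linarith⟩
    · refine Fin.addCases (fun j => ?_) (fun j => ?_) i
      · simpa only [Fin.append_left] using hb j
      · simpa only [Fin.append_right] using hc j
    · refine Fin.addCases (fun j => ?_) (fun j => ?_) i
      · simpa only [Fin.append_left] using hd j
      · simpa only [Fin.append_right] using ha j
  · rintro ⟨⟨a, b⟩, c, d⟩ _ ⟨⟨a', b'⟩, c', d'⟩ _ h
    simp only [Prod.mk.injEq] at h ⊢
    have hl := fun i => congrFun h.1 (Fin.castAdd m i)
    have hr := fun i => congrFun h.1 (Fin.natAdd m i)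
    have hl' := fun i => congrFun h.2 (Fin.castAdd m i)
    have hr' := fun i => congrFun h.2 (Fin.natAdd m i)
    simp only [Fin.append_left, Fin.append_right] at hl hr hl' hr'
    exact ⟨⟨funext hr', funext hl⟩, funext hr, funext hl'⟩
  · rintro ⟨x, y⟩ h
    simp only [mem_filter, mem_product, Fintype.mem_piFinset, Fin.sum_univ_add] at h
    refine ⟨((fun i => y (Fin.natAdd m i), fun i => x (Fin.castAdd m i)),
      (fun i => x (Fin.natAdd m i), fun i => y (Fin.castAdd m i))), ?_, ?_⟩
    · simp only [mem_filter, mem_product, Fintype.mem_piFinset]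
      exact ⟨⟨⟨fun i => h.1.2 _, fun i => h.1.1 _⟩, fun i => h.1.1 _, fun i => h.1.2 _⟩,
        by linarith⟩
    · simp only [Fin.append_castAdd_natAdd]

theorem Tplus_succ_le (m : ℕ) (A : Finset ℝ) : Tplus (m + 1) A ≤ #A ^ (2 * m + 1) := by
  have hc : #((Fintype.piFinset fun _ : Fin m => A) ×ˢ (Fintype.piFinset fun _ : Fin (m + 1) => A))
      = #A ^ (2 * m + 1) := by
    simp only [card_product, Fintype.card_piFinset_const]
    ring
  rw [← hc, Tplus]
  refine card_le_card_of_injOn (fun p => (Fin.tail p.1, p.2)) ?_ ?_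
  · rintro ⟨x, y⟩ h
    simp only [coe_filter, mem_product, Fintype.mem_piFinset, Set.mem_ofPred_eq, coe_product,
      Set.mem_prod, mem_coe] at h ⊢
    exact ⟨fun i => h.1.1 _, h.1.2⟩
  · rintro ⟨x, y⟩ h ⟨x', y'⟩ h' he
    simp only [coe_filter, Set.mem_ofPred_eq, Fin.sum_univ_succ] at h h'
    simp only [Prod.mk.injEq] at he ⊢
    obtain ⟨ht, rfl⟩ := he
    refine ⟨?_, rfl⟩
    have ht' : ∀ i : Fin m, x i.succ = x' i.succ := fun i => congrFun ht i
    have h0 : x 0 = x' 0 := by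
      have := h.2.trans h'.2.symm
      simp only [ht'] at this
      linarith
    funext i
    exact Fin.cases h0 ht' i

theorem card_mul_Tplus_add_self_le (m : ℕ) (A B : Finset ℝ) (hB : (0 : ℝ) ∉ B) {s : ℕ}
    (hs : 0 < s) :
    s * #B * Tplus (m + m) A ≤
      3 * s ^ 2 * #B * Tplus m A ^ 2 + 12 * (#A ^ m) ^ 2 * (#(A * B) ^ m) ^ 2 := by
  have h := card_mul_energy_le (Fintype.piFinset fun _ : Fin m => A) (fun u => ∑ i, u i)
    (Fintype.piFinset fun _ : Fin m => A * B) (fun v => ∑ i, v i) B hB (fun b u i => b * u i)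
    (fun b hb u hu => by
      simp only [Fintype.mem_piFinset] at hu ⊢
      exact fun i => mul_comm b (u i) ▸ mul_mem_mul (hu i) hb)
    (fun b hb u v huv => funext fun i =>
      mul_left_cancel₀ (fun h : b = 0 => hB (h ▸ hb)) (congrFun huv i))
    (fun b _ u _ => (mul_sum _ _ _).symm) hs
  rw [← Tplus_add_self] at h
  simpa only [Fintype.card_piFinset_const, ← Tplus.eq_def] using h

theorem card_right_le_card_mul {A B : Finset ℝ} (hA : 2 ≤ #A) : #B ≤ #(A * B) := by
  obtain ⟨a, ha, ha0⟩ := exists_mem_ne hA 0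
  exact card_le_card_of_injOn (a * ·) (fun b hb => mul_mem_mul ha hb)
    fun x _ y _ h => mul_left_cancel₀ ha0 h

/-- Doubling the number of summands: the basic recursive inequality. -/
theorem Tplus_add_self_le {A B : Finset ℝ} {M : ℝ} (hA : 2 ≤ #A) (hB : 2 ≤ #B) (hM : 1 ≤ M)
    (hAB : (#(A * B) : ℝ) ≤ M * #A) {m : ℕ} (hm : m ≠ 0) :
    (Tplus (m + m) A : ℝ) ≤
      30 * M ^ m * (#A : ℝ) ^ (2 * m) * (#B : ℝ) ^ (-(1 / 2) : ℝ) * Tplus m A := by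
  set a : ℝ := (#A : ℝ) with ha
  set T : ℝ := (Tplus m A : ℝ) with hT
  set q : ℝ := Real.sqrt #B with hq
  have ha2 : (2 : ℝ) ≤ a := by rw [ha]; exact_mod_cast hA
  have hb2 : (2 : ℝ) ≤ #B := by exact_mod_cast hB
  have hq2 : q ^ 2 = #B := Real.sq_sqrt (by positivity)
  have hq0 : 0 < q := Real.sqrt_pos.2 (by positivity)
  have hrp : (#B : ℝ) ^ (-(1 / 2) : ℝ) = q⁻¹ := by
    rw [Real.rpow_neg (by positivity), hq, Real.sqrt_eq_rpow]
  have hBle : (#B : ℝ) ≤ M * a :=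
    (Nat.cast_le.2 (card_right_le_card_mul hA)).trans hAB
  have hqle : q ≤ M * a := by
    have h1 : 1 ≤ M * a := by nlinarith
    exact Real.sqrt_le_iff.2 ⟨by linarith, by nlinarith⟩
  have hT0 : 0 < T := by
    obtain ⟨x, hx⟩ : A.Nonempty := card_pos.1 (by omega)
    have : 0 < Tplus m A := card_pos.2 ⟨(fun _ => x, fun _ => x), by simp [hx]⟩
    rw [hT]; exact_mod_cast this
  have hTle : T * a ≤ a ^ (2 * m) := by
    obtain ⟨n, rfl⟩ := Nat.exists_eq_succ_of_ne_zero hm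
    have h : T ≤ a ^ (2 * n + 1) := by
      rw [hT, ha]; exact_mod_cast Tplus_succ_le n A
    calc T * a ≤ a ^ (2 * n + 1) * a := by gcongr
      _ = _ := by rw [Nat.succ_eq_add_one]; ring
  have hMm : M ≤ M ^ m := le_self_pow₀ hM hm
  set s₀ : ℝ := a ^ (2 * m) * M ^ m / (q * T) with hs₀
  have hs₀1 : 1 ≤ s₀ := by
    rw [hs₀, one_le_div (by positivity)]
    calc q * T ≤ (M * a) * T := by gcongr
      _ = (T * a) * M := by ring
      _ ≤ _ := by gcongr
  set s : ℕ := ⌈s₀⌉₊ with hs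
  have hs_pos : 0 < s := Nat.ceil_pos.2 (by linarith)
  have hs_ge : s₀ ≤ s := Nat.le_ceil _
  have hs_le : (s : ℝ) ≤ 2 * s₀ := by
    have := Nat.ceil_lt_add_one (by linarith : 0 ≤ s₀)
    linarith
  have hmain := card_mul_Tplus_add_self_le m A (B.erase 0) (notMem_erase 0 B) hs_pos
  have hcard : (#B : ℝ) ≤ 2 * #(B.erase 0) := by
    have := pred_card_le_card_erase (s := B) (a := 0)
    have h2 : #B ≤ 2 * #(B.erase 0) := by omega
    exact_mod_cast h2
  have hV : (#(A * B.erase 0) : ℝ) ≤ M * a :=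
    le_trans (by exact_mod_cast card_le_card (mul_subset_mul_left (erase_subset 0 B))) hAB
  set β : ℝ := (#(B.erase 0) : ℝ) with hβ
  have hβ0 : 0 < β := by linarith
  have hmainR : s * β * Tplus (m + m) A ≤
      3 * (s : ℝ) ^ 2 * β * T ^ 2 + 12 * (a ^ m) ^ 2 * ((M * a) ^ m) ^ 2 := by
    have h : (s * β * Tplus (m + m) A : ℝ) ≤
        3 * (s : ℝ) ^ 2 * β * T ^ 2 + 12 * (a ^ m) ^ 2 * ((#(A * B.erase 0) : ℝ) ^ m) ^ 2 := by
      rw [hβ, hT, ha]; exact_mod_cast hmain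
    refine h.trans ?_
    gcongr
  have hsR : (0 : ℝ) < s := by exact_mod_cast hs_pos
  have h12 : 12 * (a ^ m) ^ 2 * ((M * a) ^ m) ^ 2 ≤ 24 * s₀ * T ^ 2 * (s * β) := by
    have he : (a ^ m) ^ 2 * ((M * a) ^ m) ^ 2 = s₀ ^ 2 * T ^ 2 * q ^ 2 := by
      rw [hs₀, mul_pow]; field_simp; ring
    calc 12 * (a ^ m) ^ 2 * ((M * a) ^ m) ^ 2 = 12 * (s₀ ^ 2 * T ^ 2 * q ^ 2) := by
          rw [mul_assoc, he]
      _ ≤ 12 * (s₀ * s * T ^ 2 * (2 * β)) := by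
          rw [hq2, sq s₀]; gcongr
      _ = _ := by ring
  have hdiv : (Tplus (m + m) A : ℝ) ≤ 3 * s * T ^ 2 + 24 * s₀ * T ^ 2 := by
    refine le_of_mul_le_mul_left (a := s * β) ?_ (by positivity)
    calc _ ≤ _ := hmainR
      _ ≤ 3 * (s : ℝ) ^ 2 * β * T ^ 2 + 24 * s₀ * T ^ 2 * (s * β) := by gcongr
      _ = _ := by ring
  calc (Tplus (m + m) A : ℝ) ≤ 3 * s * T ^ 2 + 24 * s₀ * T ^ 2 := hdiv
    _ ≤ 3 * (2 * s₀) * T ^ 2 + 24 * s₀ * T ^ 2 := by gcongr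
    _ = 30 * s₀ * T ^ 2 := by ring
    _ = _ := by rw [hrp, hs₀]; field_simp

theorem Tplus_two_pow_le {A B : Finset ℝ} {M : ℝ} (hA : 2 ≤ #A) (hB : 2 ≤ #B) (hM : 1 ≤ M)
    (hAB : (#(A * B) : ℝ) ≤ M * #A) (k : ℕ) :
    (Tplus (2 ^ k) A : ℝ) ≤
      30 ^ k * M ^ (2 ^ k - 1) * (#A : ℝ) ^ (2 ^ (k + 1) - 1) * (#B : ℝ) ^ (-((k : ℝ) / 2)) := by
  induction k with
  | zero =>
    have h : (Tplus 1 A : ℝ) ≤ #A := by exact_mod_cast (Tplus_succ_le 0 A).trans (by simp)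
    simpa using h
  | succ k ih =>
    have h := Tplus_add_self_le hA hB hM hAB (m := 2 ^ k) (by positivity)
    have hk : 1 ≤ 2 ^ k := Nat.one_le_two_pow
    have e0 : 2 ^ (k + 1) = 2 ^ k + 2 ^ k := by ring
    have e1 : 2 ^ (k + 1) - 1 = 2 ^ k + (2 ^ k - 1) := by omega
    have e2 : 2 ^ (k + 1 + 1) - 1 = 2 * 2 ^ k + (2 ^ (k + 1) - 1) := by
      rw [pow_succ 2 (k + 1)]; omega
    have hB0 : (0 : ℝ) < #B := by exact_mod_cast (by omega : 0 < #B)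
    have e3 : (#B : ℝ) ^ (-(((k + 1 : ℕ) : ℝ) / 2)) =
        (#B : ℝ) ^ (-(1 / 2) : ℝ) * (#B : ℝ) ^ (-((k : ℝ) / 2)) := by
      rw [← Real.rpow_add hB0]; congr 1; push_cast; ring
    have e4 : M ^ (2 ^ (k + 1) - 1) = M ^ 2 ^ k * M ^ (2 ^ k - 1) := by rw [e1, pow_add]
    have e5 : Tplus (2 ^ (k + 1)) A = Tplus (2 ^ k + 2 ^ k) A := by rw [e0]
    rw [e5, e4, e3, e2, pow_add (#A : ℝ), pow_succ (30 : ℝ)]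
    calc _ ≤ _ := h
      _ ≤ 30 * M ^ 2 ^ k * (#A : ℝ) ^ (2 * 2 ^ k) * (#B : ℝ) ^ (-(1 / 2) : ℝ) *
          (30 ^ k * M ^ (2 ^ k - 1) * (#A : ℝ) ^ (2 ^ (k + 1) - 1) *
            (#B : ℝ) ^ (-((k : ℝ) / 2))) := by gcongr
      _ = _ := by ring

end Tplus

/-- there is an absolute constant `C ≥ 1` such that for all finite sets
`A, B ⊂ ℝ` with `|A|, |B| ≥ 2`, every real `M ≥ 1` with `|AB| ≤ M|A|`, and every integer
`k ≥ 2`, one has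
`T⁺_{2^k}(A) ≤ 16^{k²} C^{k−1} M^{(3/2)(2^k−1)} (log|A|)^{4(k−1)} |A|^{2^{k+1}−1} |B|^{−k/2}`. -/
theorem stmt_13 :
    ∃ C : ℝ, 1 ≤ C ∧
      ∀ (A B : Finset ℝ) (M : ℝ),
        2 ≤ A.card → 2 ≤ B.card → 1 ≤ M →
        ((A * B).card : ℝ) ≤ M * A.card →
        ∀ k : ℕ, 2 ≤ k →
          (Tplus (2 ^ k) A : ℝ) ≤
            16 ^ (k ^ 2) * C ^ (k - 1) * M ^ ((3 : ℝ) / 2 * ((2 : ℝ) ^ k - 1)) *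
              (Real.logb 2 A.card) ^ (4 * (k - 1)) * (A.card : ℝ) ^ (2 ^ (k + 1) - 1) *
              (B.card : ℝ) ^ (-((k : ℝ) / 2)) := by
  refine ⟨1, le_rfl, fun A B M hA hB hM hAB k hk => ?_⟩
  have h30 : (30 : ℝ) ^ k ≤ 16 ^ (k ^ 2) := by
    calc (30 : ℝ) ^ k ≤ (16 ^ 2) ^ k := by gcongr; norm_num
      _ = 16 ^ (2 * k) := (pow_mul _ _ _).symm
      _ ≤ 16 ^ (k ^ 2) := pow_le_pow_right₀ (by norm_num) (by nlinarith)
  have hMp : M ^ (2 ^ k - 1) ≤ M ^ ((3 : ℝ) / 2 * ((2 : ℝ) ^ k - 1)) := by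
    have h1 : (1 : ℝ) ≤ 2 ^ k := one_le_pow₀ (by norm_num)
    rw [← Real.rpow_natCast, Nat.cast_sub Nat.one_le_two_pow]
    push_cast
    exact Real.rpow_le_rpow_of_exponent_le hM (by linarith)
  have hlog : 1 ≤ Real.logb 2 A.card ^ (4 * (k - 1)) := by
    refine one_le_pow₀ ?_
    rw [Real.le_logb_iff_rpow_le (by norm_num) (by exact_mod_cast (by omega : 0 < #A))]
    simpa using (by exact_mod_cast hA : (2 : ℝ) ≤ #A)
  calc (Tplus (2 ^ k) A : ℝ) ≤ _ := Tplus_two_pow_le hA hB hM hAB k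
    _ = 30 ^ k * 1 ^ (k - 1) * M ^ (2 ^ k - 1) * 1 * (#A : ℝ) ^ (2 ^ (k + 1) - 1) *
        (#B : ℝ) ^ (-((k : ℝ) / 2)) := by ring
    _ ≤ _ := by gcongr
end
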